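/- arXiv:0802.0015 — 2 statements merged into one kernel-verified Lean document; each statement's English description precedes it below -/
import Mathlib

section
/- Let q = 2^t for a positive integer t. The rank over F_2 of the incidence matrix M(P1,L1) satisfies (after casting the rank to the real numbers) rank_{F_2} M(P1,L1) = 1 + ((1+√17)/2)^{2t} + ((1-√17)/2)^{2t} - 2^{t+1}. -/
open Submodule Module
open scoped Classical

noncomputable section

variable (k : Type) [Field k] [Fintype k]

def B (u v : Fin 4 → k) : k := u 0 * v 3 - u 3 * v 0 + u 1 * v 2 - u 2 * v 1

def IsPt (p : Submodule k (Fin 4 → k)) : Prop := finrank k p = 1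

def IsLn (l : Submodule k (Fin 4 → k)) : Prop :=
  finrank k l = 2 ∧ ∀ u ∈ l, ∀ v ∈ l, B k u v = 0

abbrev Pt := {p : Submodule k (Fin 4 → k) // IsPt k p}

def e (i : Fin 4) : Fin 4 → k := Pi.single i 1

def p0 : Submodule k (Fin 4 → k) := span k {e k 0}

def l0 : Submodule k (Fin 4 → k) := span k {e k 0, e k 1}

def InP1 (p : Pt k) : Prop := ∃ v ∈ (p : Submodule k (Fin 4 → k)), B k (e k 0) v ≠ 0

def L1 : Set (Submodule k (Fin 4 → k)) := {l | IsLn k l ∧ l ⊓ l0 k = ⊥}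

instance : Finite (Submodule k (Fin 4 → k)) :=
  Finite.of_injective (fun s => (s : Set (Fin 4 → k))) SetLike.coe_injective

noncomputable instance : Fintype {p : Pt k // InP1 k p} := Fintype.ofFinite _
noncomputable instance : Fintype {l : Submodule k (Fin 4 → k) // l ∈ L1 k} := Fintype.ofFinite _

/-- The incidence matrix `M(P1, L1)` over `F_2`. -/
def MP1L1 : Matrix {p : Pt k // InP1 k p} {l : Submodule k (Fin 4 → k) // l ∈ L1 k} (ZMod 2) :=
  fun p l => if ((p : Pt k) : Submodule k (Fin 4 → k)) ≤ (l : Submodule k (Fin 4 → k)) then 1 else 0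

namespace SymplecticRank

abbrev Ltr := Bool × Bool × Bool

/-- Coordinate functions `a`, `b`, `d` together with all their Frobenius twists,
in a commutative ring of characteristic two. -/
structure Frob (R : Type*) [CommRing R] where
  a : ℕ → R
  b : ℕ → R
  d : ℕ → R
  two : (2 : R) = 0
  a_succ : ∀ s, a (s + 1) = a s ^ 2
  b_succ : ∀ s, b (s + 1) = b s ^ 2
  d_succ : ∀ s, d (s + 1) = d s ^ 2

namespace Frob

variable {R : Type*} [CommRing R] (F : Frob R)

def c (s : ℕ) : R := F.d (s + 1) + F.a s * F.b s

lemma c_succ (s : ℕ) : F.c (s + 1) = F.c s ^ 2 := by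
  unfold c
  rw [F.d_succ (s + 1), F.a_succ s, F.b_succ s]
  linear_combination (-F.d (s + 1) * F.a s * F.b s) * F.two

/-- Coefficients of the cubic `w ^ (1 - W) * (d + a * w) ^ (1 - Δ) * (b + w * d) ^ (1 - D)`. -/
def quad (s : ℕ) : Ltr → R × R × R × R
  | (false, false, false) => (0, F.b s * F.d s, F.c s, F.a s * F.d s)
  | (true, false, false) => (F.b s * F.d s, F.c s, F.a s * F.d s, 0)
  | (false, true, false) => (0, F.b s, F.d s, 0)
  | (false, false, true) => (0, F.d s, F.a s, 0)
  | (true, true, false) => (F.b s, F.d s, 0, 0)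
  | (true, false, true) => (F.d s, F.a s, 0, 0)
  | (false, true, true) => (0, 1, 0, 0)
  | (true, true, true) => (1, 0, 0, 0)

end Frob

section Transfer

variable {R : Type*} [CommRing R]

def act (p : R × R × R × R) : (R × R) →ₗ[R] (R × R) where
  toFun r := (r.1 * p.2.1 + r.2 * p.1, r.1 * p.2.2.2 + r.2 * p.2.2.1)
  map_add' x y := by ext <;> simp <;> ring
  map_smul' x y := by ext <;> simp <;> ring

lemma act_apply (p : R × R × R × R) (r : R × R) :
    act p r = (r.1 * p.2.1 + r.2 * p.1, r.1 * p.2.2.2 + r.2 * p.2.2.1) := rfl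

def actList : List (R × R × R × R) → (R × R) →ₗ[R] (R × R)
  | [] => LinearMap.id
  | p :: l => actList l ∘ₗ act p

lemma actList_append (l m : List (R × R × R × R)) (r : R × R) :
    actList (l ++ m) r = actList m (actList l r) := by
  induction l generalizing r with
  | nil => rfl
  | cons p l ih => simpa [actList] using ih (act p r)

def trc (l : List (R × R × R × R)) : R := (actList l (1, 0)).1 + (actList l (0, 1)).2

lemma trc_cyclic (l m : List (R × R × R × R)) : trc (l ++ m) = trc (m ++ l) := by
  have key : ∀ (f : (R × R) →ₗ[R] (R × R)) (x y : R), f (x, y) = x • f (1, 0) + y • f (0, 1) := by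
    intro f x y
    rw [← map_smul, ← map_smul, ← map_add]
    simp
  simp only [trc, actList_append]
  rw [key (actList m) (actList l (1, 0)).1, key (actList m) (actList l (0, 1)).1,
    key (actList l) (actList m (1, 0)).1, key (actList l) (actList m (0, 1)).1]
  simp
  ring

end Transfer

namespace Frob

variable {R : Type*} [CommRing R] (F : Frob R)

def quads (s : ℕ) : List Ltr → List (R × R × R × R)
  | [] => []
  | v :: N => F.quad s v :: quads (s + 1) N

lemma quads_append (s : ℕ) (N M : List Ltr) :
    F.quads s (N ++ M) = F.quads s N ++ F.quads (s + N.length) M := by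
  induction N generalizing s with
  | nil => rfl
  | cons v N ih =>
    have h : s + 1 + N.length = s + (N.length + 1) := by omega
    simp [quads, ih, h]

lemma length_quads (s : ℕ) (N : List Ltr) : (F.quads s N).length = N.length := by
  induction N generalizing s with
  | nil => rfl
  | cons v N ih => simp [quads, ih]

def rv (s : ℕ) (N : List Ltr) : (R × R) →ₗ[R] (R × R) := actList (F.quads s N)

lemma rv_nil (s : ℕ) (r : R × R) : F.rv s [] r = r := rfl

lemma rv_cons (s : ℕ) (v : Ltr) (N : List Ltr) (r : R × R) :
    F.rv s (v :: N) r = F.rv (s + 1) N (act (F.quad s v) r) := rfl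

lemma rv_append (s : ℕ) (N M : List Ltr) (r : R × R) :
    F.rv s (N ++ M) r = F.rv (s + N.length) M (F.rv s N r) := by
  simp [rv, quads_append, actList_append]

def tr (s : ℕ) (N : List Ltr) : R := trc (F.quads s N)

/-- `t`-periodicity of the twists. -/
def Per (t : ℕ) : Prop :=
  ∀ s, F.a (s + t) = F.a s ∧ F.b (s + t) = F.b s ∧ F.d (s + t) = F.d s

variable {F}

lemma Per.c {t : ℕ} (h : F.Per t) (s : ℕ) : F.c (s + t) = F.c s := by
  have h1 := (h (s + 1)).2.2
  rw [add_right_comm] at h1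
  simp [Frob.c, h1, (h s).1, (h s).2.1]

lemma Per.quad {t : ℕ} (h : F.Per t) (s : ℕ) (v : Ltr) : F.quad (s + t) v = F.quad s v := by
  obtain ⟨_ | _, _ | _, _ | _⟩ := v <;> simp [Frob.quad, h.c, h s]

lemma Per.quads {t : ℕ} (h : F.Per t) (s : ℕ) (N : List Ltr) :
    F.quads (s + t) N = F.quads s N := by
  induction N generalizing s with
  | nil => rfl
  | cons v N ih => rw [Frob.quads, Frob.quads, h.quad, Nat.add_right_comm, ih]

lemma Per.tr_rotate {t : ℕ} (h : F.Per t) (s : ℕ) (N M : List Ltr) (hl : N.length + M.length = t) :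
    F.tr s (N ++ M) = F.tr (s + N.length) (M ++ N) := by
  rw [tr, tr, quads_append, quads_append, trc_cyclic, add_assoc, hl, h.quads]

variable (F)

def e1 : R × R := (1, 0)
def e2 : R × R := (0, 1)
def sg (s : ℕ) : R × R := (F.b s, F.d s)
def sg' (s : ℕ) : R × R := (F.d s, F.a s)
def rho (s : ℕ) : R × R := (F.b s, F.a s)

def rankOne : Ltr → Bool
  | (true, true, _) => true
  | (true, false, true) => true
  | (false, true, true) => true
  | _ => false

lemma act_rankOne (s : ℕ) (v : Ltr) (hv : rankOne v = true) (r : R × R) :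
    (act (F.quad s v) r).2 = 0 := by
  obtain ⟨_ | _, _ | _, _ | _⟩ := v <;> simp_all [rankOne, quad, act_apply]

end Frob

end SymplecticRank

namespace SymplecticRank

/-! ### The counting automaton -/

def step : Bool → Ltr → Option Bool
  | false, (false, false, false) => some true
  | false, (false, false, true) => none
  | false, (true, true, true) => none
  | false, _ => some false
  | true, (false, false, false) => some true
  | true, (true, false, false) => some true
  | true, (false, true, false) => some true
  | true, (false, false, true) => some true
  | true, _ => some false

def run : Bool → List Ltr → Option Bool
  | x, [] => some x
  | x, v :: w => match step x v with
    | none => none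
    | some y => run y w

lemma run_cons (x : Bool) (v : Ltr) (w : List Ltr) :
    run x (v :: w) = (step x v).bind fun y => run y w := by
  rw [run]; cases step x v <;> rfl

lemma run_append (x : Bool) (u w : List Ltr) :
    run x (u ++ w) = (run x u).bind fun y => run y w := by
  induction u generalizing x with
  | nil => rfl
  | cons v u ih =>
    rw [List.cons_append, run_cons, run_cons]
    cases step x v <;> simp [ih]

/-- The product of digit functions collected along a run of the automaton. -/
def wprod {R : Type*} [CommRing R] (φ : ℕ → Bool → Ltr → R) : ℕ → Bool → List Ltr → R
  | _, _, [] => 1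
  | s, x, v :: w => φ s x v * match step x v with
    | none => 1
    | some y => wprod φ (s + 1) y w

lemma wprod_append {R : Type*} [CommRing R] (φ : ℕ → Bool → Ltr → R) (s : ℕ) (x y : Bool)
    (u w : List Ltr) (h : run x u = some y) :
    wprod φ s x (u ++ w) = wprod φ s x u * wprod φ (s + u.length) y w := by
  induction u generalizing x s with
  | nil =>
    simp only [run, Option.some.injEq] at h
    simp [wprod, h]
  | cons v u ih =>
    rw [List.cons_append, wprod, wprod]
    rw [run_cons] at h
    cases hs : step x v with
    | none => simp [hs] at h
    | some z =>
      rw [hs] at h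
      have e : s + 1 + u.length = s + (v :: u).length := by simp; omega
      simp only [ih (s + 1) z h, e, mul_assoc]

lemma wprod_per {R : Type*} [CommRing R] (φ : ℕ → Bool → Ltr → R) (t : ℕ)
    (h : ∀ s x v, φ (s + t) x v = φ s x v) (s : ℕ) (x : Bool) (w : List Ltr) :
    wprod φ (s + t) x w = wprod φ s x w := by
  induction w generalizing s x with
  | nil => rfl
  | cons v w ih =>
    rw [wprod, wprod, h, Nat.add_right_comm]
    simp only [ih]

namespace Frob

variable {R : Type*} [CommRing R] (F : Frob R)

def cf (s : ℕ) : Set R := {1, F.a s, F.b s, F.c s, F.d s}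

def cf2 (s : ℕ) : Set R := {F.a s, F.b s, F.a s * F.c s, F.b s * F.c s}

def side (s : ℕ) : Set (R × R) := {e2, F.sg s, F.sg' s}

lemma act_e1 (s : ℕ) (v : Ltr) :
    act (F.quad s v) e1 = 0 ∨ (∃ u ∈ F.cf s, act (F.quad s v) e1 = u • e1) ∨
      (rankOne v = false ∧ act (F.quad s v) e1 = F.d s • F.rho s) := by
  obtain ⟨_ | _, _ | _, _ | _⟩ := v
  · exact .inr (.inr ⟨rfl, by ext <;> simp [act_apply, quad, e1, rho] <;> ring⟩)
  · exact .inr (.inl ⟨F.d s, by simp [cf], by ext <;> simp [act_apply, quad, e1]⟩)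
  · exact .inr (.inl ⟨F.b s, by simp [cf], by ext <;> simp [act_apply, quad, e1]⟩)
  · exact .inr (.inl ⟨1, by simp [cf], by ext <;> simp [act_apply, quad, e1]⟩)
  · exact .inr (.inl ⟨F.c s, by simp [cf], by ext <;> simp [act_apply, quad, e1]⟩)
  · exact .inr (.inl ⟨F.a s, by simp [cf], by ext <;> simp [act_apply, quad, e1]⟩)
  · exact .inr (.inl ⟨F.d s, by simp [cf], by ext <;> simp [act_apply, quad, e1]⟩)
  · exact .inl (by ext <;> simp [act_apply, quad, e1])

lemma act_side (s : ℕ) (v : Ltr) (x : R × R) (hx : x ∈ F.side s) :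
    act (F.quad s v) x = 0 ∨ (∃ u ∈ F.cf s, act (F.quad s v) x = u • e1) ∨
      (rankOne v = false ∧ ∃ u ∈ F.cf s, ∃ y ∈ F.side (s + 1), act (F.quad s v) x = u • y) ∨
      (rankOne v = false ∧ act (F.quad s v) x = F.d s • F.rho s) := by
  have hc : F.c s = F.d s ^ 2 + F.a s * F.b s := by rw [c, F.d_succ]
  have h1 := F.a_succ s
  have h2 := F.b_succ s
  have h3 := F.d_succ s
  have h4 := F.two
  obtain rfl | rfl | rfl := hx <;> obtain ⟨_ | _, _ | _, _ | _⟩ := v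
  · exact .inr (.inr (.inl ⟨rfl, F.c s, by simp [cf], e2, by simp [side],
      by ext <;> simp [act_apply, quad, e2]⟩))
  · exact .inr (.inr (.inl ⟨rfl, F.a s, by simp [cf], e2, by simp [side],
      by ext <;> simp [act_apply, quad, e2]⟩))
  · exact .inr (.inr (.inl ⟨rfl, F.d s, by simp [cf], e2, by simp [side],
      by ext <;> simp [act_apply, quad, e2]⟩))
  · exact .inl (by ext <;> simp [act_apply, quad, e2])
  · exact .inr (.inr (.inr ⟨rfl, by ext <;> simp [act_apply, quad, e2, rho] <;> ring⟩))
  · exact .inr (.inl ⟨F.d s, by simp [cf], by ext <;> simp [act_apply, quad, e1, e2]⟩)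
  · exact .inr (.inl ⟨F.b s, by simp [cf], by ext <;> simp [act_apply, quad, e1, e2]⟩)
  · exact .inr (.inl ⟨1, by simp [cf], by ext <;> simp [act_apply, quad, e1, e2]⟩)
  · refine .inr (.inr (.inl ⟨rfl, F.d s, by simp [cf], F.sg (s + 1), by simp [side], ?_⟩))
    ext
    · simp [act_apply, quad, sg, h2]; ring
    · simp [act_apply, quad, sg, h3, hc]; linear_combination (F.a s * F.b s * F.d s) * h4
  · exact .inr (.inr (.inr ⟨rfl, by ext <;> simp [act_apply, quad, sg, rho] <;> ring⟩))
  · exact .inr (.inr (.inl ⟨rfl, 1, by simp [cf], F.sg (s + 1), by simp [side],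
      by ext <;> simp [act_apply, quad, sg, h2, h3] <;> ring⟩))
  · exact .inr (.inl ⟨F.b s, by simp [cf], by ext <;> simp [act_apply, quad, e1, sg]⟩)
  · refine .inr (.inr (.inl ⟨rfl, F.a s, by simp [cf], F.sg (s + 1), by simp [side], ?_⟩))
    ext
    · simp [act_apply, quad, sg, h2, hc]; linear_combination (F.b s * F.d s ^ 2) * h4
    · simp [act_apply, quad, sg, h3]; ring
  · exact .inr (.inl ⟨F.c s, by simp [cf], by ext <;> simp [act_apply, quad, e1, sg, hc]; ring⟩)
  · exact .inl (by
      ext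
      · simp [act_apply, quad, sg]; linear_combination (F.b s * F.d s) * h4
      · simp [act_apply, quad, sg])
  · exact .inr (.inl ⟨F.d s, by simp [cf], by ext <;> simp [act_apply, quad, e1, sg]⟩)
  · refine .inr (.inr (.inl ⟨rfl, F.b s, by simp [cf], F.sg' (s + 1), by simp [side], ?_⟩))
    ext
    · simp [act_apply, quad, sg', h3]; ring
    · simp [act_apply, quad, sg', h1, hc]; linear_combination (F.a s * F.d s ^ 2) * h4
  · exact .inr (.inr (.inl ⟨rfl, 1, by simp [cf], F.sg' (s + 1), by simp [side],
      by ext <;> simp [act_apply, quad, sg', h1, h3] <;> ring⟩))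
  · exact .inr (.inr (.inr ⟨rfl, by ext <;> simp [act_apply, quad, sg', rho] <;> ring⟩))
  · exact .inr (.inl ⟨F.d s, by simp [cf], by ext <;> simp [act_apply, quad, e1, sg']⟩)
  · refine .inr (.inr (.inl ⟨rfl, F.d s, by simp [cf], F.sg' (s + 1), by simp [side], ?_⟩))
    ext
    · simp [act_apply, quad, sg', h3, hc]; linear_combination (F.a s * F.b s * F.d s) * h4
    · simp [act_apply, quad, sg', h1]; ring
  · exact .inl (by
      ext
      · simp [act_apply, quad, sg']; linear_combination (F.a s * F.d s) * h4
      · simp [act_apply, quad, sg'])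
  · exact .inr (.inl ⟨F.c s, by simp [cf], by ext <;> simp [act_apply, quad, e1, sg', hc]; ring⟩)
  · exact .inr (.inl ⟨F.a s, by simp [cf], by ext <;> simp [act_apply, quad, e1, sg']⟩)

lemma act_rho (s : ℕ) (v : Ltr) :
    (∃ u ∈ F.cf2 s, act (F.quad (s + 1) v) (F.rho s) = u • e1) ∨
      (rankOne v = false ∧ ∃ u ∈ F.cf2 s, ∃ u' ∈ F.cf2 s, ∃ y, (y = e1 ∨ y ∈ F.side (s + 2)) ∧
        act (F.quad (s + 1) v) (F.rho s) = u • F.rho (s + 1) + u' • y) := by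
  have hd : F.d (s + 1) = F.c s + F.a s * F.b s := by
    rw [c]; linear_combination (-F.a s * F.b s) * F.two
  have h1 := F.a_succ s
  have h2 := F.b_succ s
  have h1' := F.a_succ (s + 1)
  have h2' := F.b_succ (s + 1)
  have h3' := F.d_succ (s + 1)
  have hc := F.c_succ s
  have h4 := F.two
  obtain ⟨_ | _, _ | _, _ | _⟩ := v
  · refine .inr ⟨rfl, _, .inr (.inr (.inr rfl)), _, .inl rfl, F.sg (s + 2),
      .inr (by simp [side]), ?_⟩
    ext
    · simp [act_apply, quad, rho, sg, h2', hd, h1, h2, hc]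
      ring
    · simp [act_apply, quad, rho, sg, h3', hd, h1, h2, hc]
      linear_combination (- F.a s ^ 2 * F.b s * F.c s) * h4
  · exact .inr ⟨rfl, _, .inl rfl, _, .inr (.inr (.inr rfl)), e1, .inl rfl, by
      ext <;> simp [act_apply, quad, rho, e1, hd, h1, h2, hc] <;> ring⟩
  · exact .inr ⟨rfl, _, .inr (.inl rfl), _, .inr (.inr (.inl rfl)), e2, .inr (by simp [side]), by
      ext <;> simp [act_apply, quad, rho, e2, hd, h1, h2, hc] <;> ring⟩
  · exact .inl ⟨_, .inr (.inl rfl), by ext <;> simp [act_apply, quad, rho, e1]⟩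
  · refine .inr ⟨rfl, _, .inr (.inr (.inl rfl)), _, .inr (.inl rfl), F.sg' (s + 2),
      .inr (by simp [side]), ?_⟩
    ext
    · simp [act_apply, quad, rho, sg', h3', hd, h1, h2, hc]
      linear_combination (- F.a s * F.b s ^ 2 * F.c s) * h4
    · simp [act_apply, quad, rho, sg', h1', hd, h1, h2, hc]
      ring
  · exact .inl ⟨_, .inr (.inr (.inl rfl)), by
      ext
      · simp [act_apply, quad, rho, e1, hd, h1, h2]
        linear_combination (F.a s ^ 2 * F.b s) * h4
      · simp [act_apply, quad, rho, e1]⟩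
  · exact .inl ⟨_, .inr (.inr (.inr rfl)), by
      ext
      · simp [act_apply, quad, rho, e1, hd, h1, h2]
        linear_combination (F.b s ^ 2 * F.a s) * h4
      · simp [act_apply, quad, rho, e1]⟩
  · exact .inl ⟨_, .inl rfl, by ext <;> simp [act_apply, quad, rho, e1]⟩

end Frob

end SymplecticRank

namespace SymplecticRank

/-- Letters that do not count towards reaching the side vectors. -/
def idle : Bool → Ltr → Bool
  | false, (false, true, false) => true
  | false, (true, false, true) => true
  | false, _ => false
  | true, v => step true v == some true

namespace Frob

variable {R : Type*} [CommRing R] (F : Frob R)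

def psi (s : ℕ) : Bool → Ltr → R
  | false, (false, false, false) => F.d (s + 1)
  | false, (true, false, false) => F.a (s + 1)
  | false, (false, true, false) => F.b (s + 1)
  | false, (true, true, false) => 1
  | false, (true, false, true) => F.c (s + 1)
  | false, (false, true, true) => F.d (s + 1)
  | false, _ => 0
  | true, (false, false, false) => F.a s
  | true, (true, false, false) => F.b s
  | true, (false, true, false) => F.a s * F.c s
  | true, (false, false, true) => F.b s * F.c s
  | true, (true, true, false) => F.a s
  | true, (true, false, true) => F.b s
  | true, (false, true, true) => F.a s * F.c s
  | true, (true, true, true) => F.b s * F.c s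

lemma psi_false (s : ℕ) {u : R} (hu : u ∈ F.cf (s + 1)) :
    ∃ v, step false v = some false ∧ F.psi s false v = u := by
  obtain rfl | rfl | rfl | rfl | rfl := hu
  · exact ⟨(true, true, false), rfl, rfl⟩
  · exact ⟨(true, false, false), rfl, rfl⟩
  · exact ⟨(false, true, false), rfl, rfl⟩
  · exact ⟨(true, false, true), rfl, rfl⟩
  · exact ⟨(false, true, true), rfl, rfl⟩

lemma psi_true (s : ℕ) {u : R} (hu : u ∈ F.cf2 s) (y : Bool) :
    ∃ v, step true v = some y ∧ F.psi s true v = u := by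
  obtain rfl | rfl | rfl | rfl := hu <;> cases y
  · exact ⟨(true, true, false), rfl, rfl⟩
  · exact ⟨(false, false, false), rfl, rfl⟩
  · exact ⟨(true, false, true), rfl, rfl⟩
  · exact ⟨(true, false, false), rfl, rfl⟩
  · exact ⟨(false, true, true), rfl, rfl⟩
  · exact ⟨(false, true, false), rfl, rfl⟩
  · exact ⟨(true, true, true), rfl, rfl⟩
  · exact ⟨(false, false, true), rfl, rfl⟩

/-- Products along runs of length `n` from `false` to `y`. -/
def RunVal (s n : ℕ) (y : Bool) (f : R) : Prop :=
  ∃ w : List Ltr, w.length = n ∧ run false w = some y ∧ wprod F.psi s false w = f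

/-- Products along closed runs with a letter that is not idle. -/
def GoodVal (s n : ℕ) (f : R) : Prop :=
  ∃ w : List Ltr, w.length = n ∧ run false w = some false ∧ (∃ v ∈ w, idle false v = false) ∧
    wprod F.psi s false w = f

variable {F}

lemma GoodVal.runVal {s n : ℕ} {f : R} (h : F.GoodVal s n f) : F.RunVal s n false f := by
  obtain ⟨w, h1, h2, -, h4⟩ := h
  exact ⟨w, h1, h2, h4⟩

lemma RunVal.snoc {s n : ℕ} {f : R} {x y : Bool} (h : F.RunVal s n x f) {v : Ltr}
    (hv : step x v = some y) : F.RunVal s (n + 1) y (f * F.psi (s + n) x v) := by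
  obtain ⟨w, rfl, h2, rfl⟩ := h
  refine ⟨w ++ [v], by simp, by simp [run_append, h2, run, hv], ?_⟩
  rw [wprod_append _ _ _ _ _ _ h2]
  simp [wprod, hv]

lemma RunVal.cf {s n : ℕ} {f u : R} (h : F.RunVal s n false f) (hu : u ∈ F.cf (s + n + 1)) :
    F.RunVal s (n + 1) false (f * u) := by
  obtain ⟨v, hv, rfl⟩ := F.psi_false _ hu
  exact h.snoc hv

lemma RunVal.enter {s n : ℕ} {f : R} (h : F.RunVal s n false f) :
    F.RunVal s (n + 1) true (f * F.d (s + n + 1)) :=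
  h.snoc (v := (false, false, false)) rfl

lemma RunVal.cf2 {s n : ℕ} {f u : R} (h : F.RunVal s n true f) (hu : u ∈ F.cf2 (s + n)) :
    F.RunVal s (n + 1) true (f * u) := by
  obtain ⟨v, hv, rfl⟩ := F.psi_true _ hu true
  exact h.snoc hv

lemma exists_not_idle_of_run {w : List Ltr} (h : run false w = some true) :
    ∃ v ∈ w, idle false v = false := by
  induction w with
  | nil => simp [run] at h
  | cons v w ih =>
    by_cases hv : idle false v = false
    · exact ⟨v, by simp, hv⟩
    · have : step false v = some false := by
        obtain ⟨_ | _, _ | _, _ | _⟩ := v <;> simp_all [idle, step]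
      rw [run_cons, this] at h
      obtain ⟨v', h1, h2⟩ := ih h
      exact ⟨v', by simp [h1], h2⟩

lemma RunVal.exit {s n : ℕ} {f u : R} (h : F.RunVal s n true f) (hu : u ∈ F.cf2 (s + n)) :
    F.GoodVal s (n + 1) (f * u) := by
  obtain ⟨v, hv, rfl⟩ := F.psi_true _ hu false
  obtain ⟨w, rfl, h2, rfl⟩ := h
  obtain ⟨v', h1, h3⟩ := exists_not_idle_of_run h2
  refine ⟨w ++ [v], by simp, by simp [run_append, h2, run, hv], ⟨v', by simp [h1], h3⟩, ?_⟩
  rw [wprod_append _ _ _ _ _ _ h2]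
  simp [wprod, hv]

lemma GoodVal.cf {s n : ℕ} {f u : R} (h : F.GoodVal s n f) (hu : u ∈ F.cf (s + n + 1)) :
    F.GoodVal s (n + 1) (f * u) := by
  obtain ⟨v, hv, rfl⟩ := F.psi_false _ hu
  obtain ⟨w, rfl, h2, ⟨v', h1, h3⟩, rfl⟩ := h
  refine ⟨w ++ [v], by simp, by simp [run_append, h2, run, hv], ⟨v', by simp [h1], h3⟩, ?_⟩
  rw [wprod_append _ _ _ _ _ _ h2]
  simp [wprod, hv]

variable (F)

/-- Generators of the space containing all `rv (s + 1) N e1` with `N` of length `n`. -/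
def gens (s n : ℕ) : Set (R × R) :=
  {r | (∃ f, F.RunVal s n false f ∧ r = f • e1) ∨
    (∃ f, F.GoodVal s n f ∧ ∃ x ∈ F.side (s + n + 1), r = f • x) ∨
    ∃ f, F.RunVal s n true f ∧ r = f • F.rho (s + n)}

variable {K : Type*} [Field K] [Algebra K R]

lemma act_gens (s n : ℕ) (v : Ltr) {r : R × R} (hr : r ∈ F.gens s n) :
    act (F.quad (s + n + 1) v) r ∈ span K (F.gens s (n + 1)) := by
  have hrho : ∀ f, F.RunVal s (n + 1) true f → f • F.rho (s + n + 1) ∈ span K (F.gens s (n + 1)) :=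
    fun f hf => subset_span (.inr (.inr ⟨f, hf, rfl⟩))
  have he : ∀ f, F.RunVal s (n + 1) false f → f • e1 ∈ span K (F.gens s (n + 1)) :=
    fun f hf => subset_span (.inl ⟨f, hf, rfl⟩)
  have hs : ∀ f, F.GoodVal s (n + 1) f → ∀ x ∈ F.side (s + n + 2),
      f • x ∈ span K (F.gens s (n + 1)) :=
    fun f hf x hx => subset_span (.inr (.inl ⟨f, hf, x, hx, rfl⟩))
  obtain ⟨f, hf, rfl⟩ | ⟨f, hf, x, hx, rfl⟩ | ⟨f, hf, rfl⟩ := hr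
  · rw [map_smul]
    obtain h | ⟨u, hu, h⟩ | ⟨-, h⟩ := F.act_e1 (s + n + 1) v
    · simp [h]
    · rw [h, smul_smul]
      exact he _ (hf.cf hu)
    · rw [h, smul_smul]
      exact hrho _ hf.enter
  · rw [map_smul]
    obtain h | ⟨u, hu, h⟩ | ⟨-, u, hu, y, hy, h⟩ | ⟨-, h⟩ := F.act_side (s + n + 1) v x hx
    · simp [h]
    · rw [h, smul_smul]
      exact he _ (hf.runVal.cf hu)
    · rw [h, smul_smul]
      exact hs _ (hf.cf hu) y hy
    · rw [h, smul_smul]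
      exact hrho _ hf.runVal.enter
  · rw [map_smul]
    obtain ⟨u, hu, h⟩ | ⟨-, u, hu, u', hu', y, rfl | hy, h⟩ := F.act_rho (s + n) v
    · rw [h, smul_smul]
      exact he _ (hf.exit hu).runVal
    · rw [h, smul_add, smul_smul, smul_smul]
      exact add_mem (hrho _ (hf.cf2 hu)) (he _ (hf.exit hu').runVal)
    · rw [h, smul_add, smul_smul, smul_smul]
      exact add_mem (hrho _ (hf.cf2 hu)) (hs _ (hf.exit hu') y hy)

lemma rv_e1_mem (s : ℕ) (N : List Ltr) :
    F.rv (s + 1) N e1 ∈ span K (F.gens s N.length) := by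
  induction N using List.reverseRecOn with
  | nil => exact subset_span (.inl ⟨1, ⟨[], rfl, rfl, rfl⟩, by simp [rv_nil]⟩)
  | append_singleton N v ih =>
    rw [rv_append, rv_cons, rv_nil, List.length_append, List.length_singleton,
      show s + 1 + N.length = s + N.length + 1 by omega]
    have h : span K (F.gens s N.length) ≤ (span K (F.gens s (N.length + 1))).comap
        ((act (F.quad (s + N.length + 1) v)).restrictScalars K) :=
      span_le.2 fun r hr => F.act_gens s N.length v hr
    exact h ih

lemma act_gens_rankOne (s n : ℕ) (v : Ltr) (hv : rankOne v = true) {r : R × R}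
    (hr : r ∈ F.gens s n) :
    (act (F.quad (s + n + 1) v) r).1 ∈ span K {f | F.GoodVal s (n + 1) f} := by
  obtain ⟨f, ⟨w, rfl, hw, rfl⟩, rfl⟩ | ⟨f, hf, x, hx, rfl⟩ | ⟨f, hf, rfl⟩ := hr
  · have key : ∀ l : Ltr, step false l = some false → idle false l = false →
        wprod F.psi s false w * F.psi (s + w.length) false l ∈
          span K {f | F.GoodVal s (w.length + 1) f} := by
      intro l h1 h2
      refine subset_span ⟨w ++ [l], by simp, by simp [run_append, hw, run, h1], ⟨l, by simp, h2⟩, ?_⟩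
      rw [wprod_append _ _ _ _ _ _ hw]
      simp [wprod, h1]
    obtain ⟨_ | _, _ | _, _ | _⟩ := v <;> simp [rankOne] at hv
    · simpa [act_apply, quad, e1, psi] using key (true, true, false) rfl rfl
    · simpa [act_apply, quad, e1, psi] using key (true, false, false) rfl rfl
    · simpa [act_apply, quad, e1, psi] using key (false, true, true) rfl rfl
    · simp [act_apply, quad, e1]
  · rw [map_smul]
    obtain h | ⟨u, hu, h⟩ | ⟨h, -⟩ | ⟨h, -⟩ := F.act_side (s + n + 1) v x hx
    · simp [h]
    · rw [h, smul_smul]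
      exact subset_span (by simpa [e1] using hf.cf hu)
    · simp [h] at hv
    · simp [h] at hv
  · rw [map_smul]
    obtain ⟨u, hu, h⟩ | ⟨h, -⟩ := F.act_rho (s + n) v
    · rw [h, smul_smul]
      exact subset_span (by simpa [e1] using hf.exit hu)
    · simp [h] at hv

lemma tr_eq_of_rankOne (s : ℕ) (N : List Ltr) (v : Ltr) (hv : rankOne v = true) :
    F.tr s (N ++ [v]) = (F.rv s (N ++ [v]) e1).1 := by
  have h : ∀ r, (F.rv s (N ++ [v]) r).2 = 0 := fun r => by
    rw [rv_append, rv_cons, rv_nil, F.act_rankOne _ _ hv]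
  have := h (0, 1)
  rw [rv] at this
  rw [tr, trc, this, add_zero]
  rfl

lemma tr_mem_goodVal (s : ℕ) (N : List Ltr) (v : Ltr) (hv : rankOne v = true) :
    F.tr (s + 1) (N ++ [v]) ∈ span K {f | F.GoodVal s (N.length + 1) f} := by
  rw [tr_eq_of_rankOne _ _ _ _ hv, rv_append, rv_cons, rv_nil,
    show s + 1 + N.length = s + N.length + 1 by omega]
  have h : span K (F.gens s N.length) ≤ (span K {f | F.GoodVal s (N.length + 1) f}).comap
      ((LinearMap.fst R R R ∘ₗ act (F.quad (s + N.length + 1) v)).restrictScalars K) :=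
    span_le.2 fun r hr => F.act_gens_rankOne s N.length v hv hr
  exact h (F.rv_e1_mem s N)

/-- Products along closed runs of length `t`, started at digit `s`, not all letters idle. -/
def closedVals (s t : ℕ) : Set R :=
  {f | ∃ x, ∃ w : List Ltr, w.length = t ∧ run x w = some x ∧ (∃ v ∈ w, idle x v = false) ∧
    wprod F.psi s x w = f}

variable {F}

lemma Per.psi {t : ℕ} (h : F.Per t) (s : ℕ) (x : Bool) (v : Ltr) :
    F.psi (s + t) x v = F.psi s x v := by
  have e : s + t + 1 = s + 1 + t := by omega
  obtain ⟨_ | _, _ | _, _ | _⟩ := v <;> cases x <;> simp [Frob.psi, h.c, h s, h (s + 1), e]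

lemma closedVals_succ_subset {t : ℕ} (ht : 0 < t) (h : F.Per t) (s : ℕ) :
    F.closedVals (s + 1) t ⊆ F.closedVals s t := by
  rintro f ⟨x, w, hw, hx, ⟨v', hv', hi⟩, rfl⟩
  obtain ⟨u, l, rfl⟩ := List.eq_nil_or_concat'  w |>.resolve_left (by rintro rfl; simp at hw; omega)
  rw [run_append] at hx
  cases hy : run x u with
  | none => simp [hy] at hx
  | some y =>
    have hl : step y l = some x := by
      rw [hy] at hx
      simp only [run, Option.bind_some] at hx
      cases hs : step y l <;> simp_all
    refine ⟨y, l :: u, by simpa using hw, by simp [run_cons, hl, hy], ?_, ?_⟩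
    · by_cases hxy : x = y
      · subst hxy
        exact ⟨v', by simpa [or_comm] using hv', hi⟩
      · refine ⟨l, by simp, ?_⟩
        clear hv' hi
        obtain ⟨_ | _, _ | _, _ | _⟩ := l <;> cases x <;> cases y <;> simp_all [step, idle]
    · rw [wprod_append _ _ _ _ _ _ hy]
      have e : s + 1 + u.length = s + t := by simp at hw; omega
      simp only [wprod, hl, e, h.psi]
      ring

lemma closedVals_subset_zero {t : ℕ} (ht : 0 < t) (h : F.Per t) (s : ℕ) :
    F.closedVals s t ⊆ F.closedVals 0 t := by
  induction s with
  | zero => exact subset_rfl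
  | succ s ih => exact (closedVals_succ_subset ht h s).trans ih

lemma Per.tr_mem_of_rankOne {t : ℕ} (h : F.Per t) (N : List Ltr) (hN : N.length = t)
    (hv : ∃ v ∈ N, rankOne v = true) : F.tr 0 N ∈ span K (F.closedVals 0 t) := by
  obtain ⟨v, hv, hr⟩ := hv
  obtain ⟨N₁, N₂, rfl⟩ := List.append_of_mem hv
  have e : N₁ ++ v :: N₂ = (N₁ ++ [v]) ++ N₂ := by simp
  have hl : (N₂ ++ N₁).length + 1 = t := by rw [← hN]; simp; omega
  rw [e, h.tr_rotate 0 _ _ (by rw [← hN]; simp; omega), zero_add, List.length_append,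
    List.length_singleton, ← List.append_assoc]
  refine span_mono ?_ (F.tr_mem_goodVal (K := K) N₁.length (N₂ ++ N₁) v hr)
  refine Set.Subset.trans ?_ (closedVals_subset_zero (by omega) h N₁.length)
  rintro f ⟨w, h1, h2, h3, h4⟩
  exact ⟨false, w, h1.trans hl, h2, h3, h4⟩

/-- The two letters acting diagonally with entries from the first row. -/
def diagLtr : Ltr → Bool
  | (false, true, false) => true
  | (false, false, true) => true
  | _ => false

def diagFst : Ltr → Ltr
  | (false, true, false) => (false, true, false)
  | _ => (false, true, true)

def diagSnd : Ltr → Ltr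
  | (false, true, false) => (false, true, true)
  | _ => (true, false, false)

lemma run_map_diag (N : List Ltr) :
    run false (N.map diagFst) = some false ∧ run false (N.map diagSnd) = some false := by
  induction N with
  | nil => simp [run]
  | cons v N ih =>
    obtain ⟨_ | _, _ | _, _ | _⟩ := v <;> simpa [run_cons, diagFst, diagSnd, step] using ih

variable (F)

lemma rv_diag (s : ℕ) (N : List Ltr) (hN : ∀ v ∈ N, diagLtr v = true) (r : R × R) :
    F.rv (s + 1) N r = (r.1 * wprod F.psi s false (N.map diagFst),
      r.2 * wprod F.psi s false (N.map diagSnd)) := by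
  induction N generalizing s r with
  | nil => simp [rv_nil, wprod]
  | cons v N ih =>
    rw [rv_cons, ih _ fun v hv => hN v (by simp [hv])]
    have hv := hN v (by simp)
    obtain ⟨_ | _, _ | _, _ | _⟩ := v <;>
      simp_all [diagLtr, diagFst, diagSnd, wprod, act_apply, quad, step, psi, mul_assoc]

lemma tr_diag (s : ℕ) (N : List Ltr) (hN : ∀ v ∈ N, diagLtr v = true) :
    F.tr (s + 1) N = wprod F.psi s false (N.map diagFst) + wprod F.psi s false (N.map diagSnd) := by
  have h := F.rv_diag s N hN
  simp only [rv] at h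
  simp [tr, trc, h]

def bprod (t : ℕ) : R := wprod F.psi 0 false (List.replicate t (false, true, false))

variable {F}

lemma Per.tr_mem_of_diag {t : ℕ} (ht : 0 < t) (h : F.Per t) (N : List Ltr) (hN : N.length = t)
    (hd : ∀ v ∈ N, diagLtr v = true) :
    F.tr 0 N ∈ span K (F.closedVals 0 t ∪ {F.bprod t}) := by
  obtain ⟨v, N, rfl⟩ : ∃ v M, N = v :: M := List.exists_cons_of_length_pos (by omega)
  rw [← List.singleton_append, h.tr_rotate 0 [v] N (by simpa [add_comm] using hN)]
  have hM : (N ++ [v]).length = t := by simpa using hN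
  have hd : ∀ u ∈ N ++ [v], diagLtr u = true := fun u hu => hd u (by simpa [or_comm] using hu)
  revert hd hM
  generalize N ++ [v] = M
  intro hM hd
  rw [List.length_singleton, tr_diag _ _ _ hd]
  have hne : M ≠ [] := by rintro rfl; simp at hM; omega
  refine add_mem ?_ (subset_span (.inl ⟨false, _, by simpa using hM, (run_map_diag M).2, ?_, rfl⟩))
  · by_cases hall : ∀ v ∈ M, v = (false, true, false)
    · refine subset_span (.inr ?_)
      rw [List.eq_replicate_of_mem hall, hM, List.map_replicate]
      rfl
    · push Not at hall
      obtain ⟨v, hv, hne⟩ := hall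
      refine subset_span (.inl ⟨false, _, by simpa using hM, (run_map_diag M).1, ?_, rfl⟩)
      refine ⟨diagFst v, List.mem_map_of_mem hv, ?_⟩
      have := hd v hv
      obtain ⟨_ | _, _ | _, _ | _⟩ := v <;> simp_all [diagLtr, diagFst, idle]
  · obtain ⟨v, hv⟩ := List.exists_mem_of_ne_nil M hne
    refine ⟨diagSnd v, List.mem_map_of_mem hv, ?_⟩
    have := hd v hv
    obtain ⟨_ | _, _ | _, _ | _⟩ := v <;> simp_all [diagLtr, diagSnd, idle]

end Frob

/-! ### Counting words -/

def words : ℕ → Finset (List Ltr)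
  | 0 => {[]}
  | n + 1 => Finset.univ.biUnion fun v : Ltr => (words n).map ⟨List.cons v, List.cons_injective⟩

lemma mem_words {n : ℕ} {w : List Ltr} : w ∈ words n ↔ w.length = n := by
  induction n generalizing w with
  | zero => simp [words]
  | succ n ih =>
    cases w with
    | nil => simp [words]
    | cons v w => simp [words, ih]

def cnt (p : List Ltr → Prop) (n : ℕ) : ℕ := ((words n).filter p).card

lemma cnt_false (n : ℕ) : cnt (fun _ => False) n = 0 := by
  rw [cnt, Finset.filter_false, Finset.card_empty]

lemma cnt_succ (p : List Ltr → Prop) (n : ℕ) :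
    cnt p (n + 1) = ∑ v : Ltr, cnt (fun w => p (v :: w)) n := by
  unfold cnt
  rw [words, Finset.filter_biUnion, Finset.card_biUnion]
  · refine Finset.sum_congr rfl fun v _ => ?_
    rw [Finset.filter_map, Finset.card_map]
    rfl
  · intro v _ v' _ hne
    refine Finset.disjoint_left.2 ?_
    intro w hw hw'
    simp only [Finset.mem_filter, Finset.mem_map] at hw hw'
    obtain ⟨⟨u, -, rfl⟩, -⟩ := hw
    obtain ⟨⟨u', -, h⟩, -⟩ := hw'
    simp at h
    exact hne h.1.symm

lemma cnt_congr {p p' : List Ltr → Prop} (n : ℕ) (h : ∀ w, w.length = n → (p w ↔ p' w)) :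
    cnt p n = cnt p' n := by
  unfold cnt
  congr 1
  ext w
  simp only [Finset.mem_filter, mem_words]
  exact and_congr_right fun hw => h w hw

lemma cnt_all (p : Ltr → Bool) (n : ℕ) :
    cnt (fun w => ∀ v ∈ w, p v = true) n = (Finset.univ.filter fun v => p v = true).card ^ n := by
  induction n with
  | zero =>
    rw [cnt_congr (p' := fun _ => True) 0 fun w hw => by simp [List.length_eq_zero_iff.1 hw]]
    simp [cnt, words]
  | succ n ih =>
    rw [cnt_succ, pow_succ', ← ih, ← smul_eq_mul, ← Finset.sum_const, Finset.sum_filter]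
    refine Finset.sum_congr rfl fun v _ => ?_
    by_cases h : p v = true
    · simp [h]
    · simp [h, cnt]

lemma cnt_sub (p r : List Ltr → Prop) (n : ℕ) (h : ∀ w, w.length = n → r w → p w) :
    cnt (fun w => p w ∧ ¬ r w) n + cnt r n = cnt p n := by
  have h1 : cnt r n = cnt (fun w => p w ∧ r w) n :=
    cnt_congr n fun w hw => ⟨fun hr => ⟨h w hw hr, hr⟩, And.right⟩
  rw [h1, cnt, cnt, cnt, ← Finset.card_union_of_disjoint]
  · congr 1
    ext w
    simp only [Finset.mem_union, Finset.mem_filter]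
    tauto
  · rw [Finset.disjoint_left]
    intro w
    simp only [Finset.mem_filter]
    tauto

def closedCnt (x y : Bool) (n : ℕ) : ℕ := cnt (fun w => run x w = some y) n

lemma closedCnt_succ_false (y : Bool) (n : ℕ) :
    closedCnt false y (n + 1) = 5 * closedCnt false y n + closedCnt true y n := by
  simp only [closedCnt, cnt_succ, run_cons, Fintype.sum_prod_type, Fintype.sum_bool, step]
  simp [cnt_false]
  ring

lemma closedCnt_succ_true (y : Bool) (n : ℕ) :
    closedCnt true y (n + 1) = 4 * closedCnt false y n + 4 * closedCnt true y n := by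
  simp only [closedCnt, cnt_succ, run_cons, Fintype.sum_prod_type, Fintype.sum_bool, step]
  simp
  ring

lemma closedCnt_recurrence (n : ℕ) :
    closedCnt false false (n + 2) + closedCnt true true (n + 2) +
      16 * (closedCnt false false n + closedCnt true true n) =
      9 * (closedCnt false false (n + 1) + closedCnt true true (n + 1)) := by
  simp only [closedCnt_succ_false, closedCnt_succ_true]
  ring

lemma closedCnt_zero (x y : Bool) : closedCnt x y 0 = if x = y then 1 else 0 := by
  simp [closedCnt, cnt, words, run, Finset.filter_singleton]
  split_ifs <;> rfl

lemma closedCnt_trace (n : ℕ) :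
    ((closedCnt false false n + closedCnt true true n : ℕ) : ℝ) =
      ((1 + Real.sqrt 17) / 2) ^ (2 * n) + ((1 - Real.sqrt 17) / 2) ^ (2 * n) := by
  have h17 : Real.sqrt 17 ^ 2 = 17 := Real.sq_sqrt (by norm_num)
  have hr : ∀ x : ℝ, x ^ 2 = x + 4 → ∀ n, x ^ (2 * (n + 2)) = 9 * x ^ (2 * (n + 1)) - 16 * x ^ (2 * n) := by
    intro x hx n
    have h4 : x ^ 4 = 9 * x ^ 2 - 16 := by linear_combination (x ^ 2 + x - 4) * hx
    calc x ^ (2 * (n + 2)) = x ^ (2 * n) * x ^ 4 := by ring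
      _ = 9 * x ^ (2 * (n + 1)) - 16 * x ^ (2 * n) := by rw [h4]; ring
  induction n using Nat.twoStepInduction with
  | zero => simp [closedCnt_zero]; norm_num
  | one =>
    simp only [closedCnt_succ_false, closedCnt_succ_true, closedCnt_zero]
    norm_num
    linear_combination (-1 / 2) * h17
  | more n h1 h2 =>
    have h := congrArg (Nat.cast : ℕ → ℝ) (closedCnt_recurrence n)
    rw [hr _ (by linear_combination h17 / 4), hr _ (by linear_combination h17 / 4)]
    push_cast at h h1 h2 ⊢
    linear_combination h + 9 * h2 - 16 * h1

end SymplecticRank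

namespace SymplecticRank

lemma run_of_idle (x : Bool) (w : List Ltr) (h : ∀ v ∈ w, idle x v = true) :
    run x w = some x := by
  induction w with
  | nil => rfl
  | cons v w ih =>
    have hs : step x v = some x := by
      have := h v (by simp)
      obtain ⟨_ | _, _ | _, _ | _⟩ := v <;> cases x <;> simp_all [idle, step]
    rw [run_cons, hs]
    exact ih fun v hv => h v (by simp [hv])

lemma cnt_closed_not_idle (x : Bool) (n : ℕ) :
    cnt (fun w => run x w = some x ∧ ∃ v ∈ w, idle x v = false) n +
      (Finset.univ.filter fun v => idle x v = true).card ^ n = closedCnt x x n := by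
  rw [← cnt_all, closedCnt, ← cnt_sub _ _ n fun w _ => run_of_idle x w]
  congr 1
  refine cnt_congr n fun w _ => and_congr_right fun _ => ?_
  push Not
  simp only [Bool.not_eq_true]

lemma card_idle_false : (Finset.univ.filter fun v => idle false v = true).card = 2 := by decide

lemma card_idle_true : (Finset.univ.filter fun v => idle true v = true).card = 4 := by decide

namespace Frob

variable {K R : Type*} [Field K] [CommRing R] [Algebra K R] {F : Frob R}

lemma diagLtr_not_rankOne (v : Ltr) (h : diagLtr v = true) : (!rankOne v) = true := by
  obtain ⟨_ | _, _ | _, _ | _⟩ := v <;> simp_all [diagLtr, rankOne]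

theorem Per.finrank_le {t : ℕ} (ht : 0 < t) (h : F.Per t) (G : List Ltr → R)
    (hG : ∀ N, N.length = t → (∃ v ∈ N, v ≠ (false, false, false)) → G N = F.tr 0 N) :
    finrank K (span K {f | ∃ N : List Ltr, N.length = t ∧ G N = f}) + 2 ^ (t + 1) ≤
      closedCnt false false t + closedCnt true true t + 1 := by
  set A : Bool → Finset R := fun x => ((words t).filter fun w =>
    run x w = some x ∧ ∃ v ∈ w, idle x v = false).image (wprod F.psi 0 x) with hA
  set C : Finset R := ((words t).filter fun w => (∀ v ∈ w, (!rankOne v) = true) ∧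
    ¬ ∀ v ∈ w, diagLtr v = true).image G with hC
  set S : Finset R := ((A false ∪ A true) ∪ {F.bprod t}) ∪ C with hS
  have hcl : F.closedVals 0 t ⊆ S := by
    rintro f ⟨x, w, h1, h2, h3, rfl⟩
    simp only [hS, Finset.coe_union, Set.mem_union, Finset.mem_coe]
    have : wprod F.psi 0 x w ∈ A x :=
      Finset.mem_image_of_mem _ (Finset.mem_filter.2 ⟨mem_words.2 h1, h2, h3⟩)
    cases x <;> simp [this]
  have hle : span K {f | ∃ N : List Ltr, N.length = t ∧ G N = f} ≤ span K (S : Set R) := by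
    rw [span_le]
    rintro f ⟨N, hN, rfl⟩
    by_cases hr : ∃ v ∈ N, rankOne v = true
    · rw [hG N hN]
      · exact span_mono hcl (h.tr_mem_of_rankOne N hN hr)
      · obtain ⟨v, hv, hr⟩ := hr
        exact ⟨v, hv, by rintro rfl; cases hr⟩
    by_cases hd : ∀ v ∈ N, diagLtr v = true
    · obtain ⟨v, hv⟩ := List.exists_mem_of_length_pos (hN.symm ▸ ht)
      rw [hG N hN ⟨v, hv, by rintro rfl; cases hd _ hv⟩]
      refine span_mono ?_ (h.tr_mem_of_diag (K := K) ht N hN hd)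
      rintro f (hf | rfl)
      · exact hcl hf
      · simp [hS]
    · refine subset_span ?_
      have : G N ∈ C := by
        refine Finset.mem_image_of_mem _ (Finset.mem_filter.2 ⟨mem_words.2 hN, ?_, hd⟩)
        push Not at hr
        simpa using hr
      simp [hS, this]
  have h1 := (Submodule.finrank_mono hle).trans (finrank_span_finset_le_card S)
  have hAc : ∀ x, (A x).card ≤ cnt (fun w => run x w = some x ∧ ∃ v ∈ w, idle x v = false) t :=
    fun x => Finset.card_image_le.trans (le_of_eq (by rw [cnt]; congr))
  have hCc : C.card ≤ cnt (fun w => (∀ v ∈ w, (!rankOne v) = true) ∧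
    ¬ ∀ v ∈ w, diagLtr v = true) t :=
    Finset.card_image_le.trans (le_of_eq (by rw [cnt]; congr))
  have h2 := cnt_closed_not_idle false t
  have h3 := cnt_closed_not_idle true t
  have h4 := cnt_sub (fun w => ∀ v ∈ w, (!rankOne v) = true) (fun w => ∀ v ∈ w, diagLtr v = true) t
    fun w _ hw v hv => diagLtr_not_rankOne v (hw v hv)
  rw [cnt_all, cnt_all, show (Finset.univ.filter fun v => diagLtr v = true).card = 2 by decide,
    show (Finset.univ.filter fun v => (!rankOne v) = true).card = 4 by decide] at h4
  rw [card_idle_false] at h2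
  rw [card_idle_true] at h3
  have h5 : S.card ≤ (A false).card + (A true).card + 1 + C.card := by
    refine (Finset.card_union_le _ _).trans (Nat.add_le_add_right ?_ _)
    refine (Finset.card_union_le _ _).trans ?_
    rw [Finset.card_singleton]
    exact Nat.add_le_add_right (Finset.card_union_le _ _) _
  have h6 := hAc false
  have h7 := hAc true
  rw [pow_succ]
  omega

end Frob

end SymplecticRank

namespace SymplecticRank

open Polynomial

/-! ### Power sums over a finite field of characteristic two -/

lemma charP_two {K : Type*} [Field K] [Fintype K] {t : ℕ} (hK : Fintype.card K = 2 ^ t) :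
    CharP K 2 := by
  obtain ⟨n, hp, h⟩ := FiniteField.card K (ringChar K)
  rw [hK] at h
  have h' : ringChar K = 2 :=
    (Nat.prime_dvd_prime_iff_eq hp Nat.prime_two).1 (hp.dvd_of_dvd_pow
      (h ▸ dvd_pow_self _ n.ne_zero))
  exact h' ▸ ringChar.charP K

lemma sum_pow_eq {K : Type*} [Field K] [Fintype K] {t : ℕ} (ht : 0 < t)
    (hK : Fintype.card K = 2 ^ t) (i : ℕ) :
    ∑ x : K, x ^ i = if 0 < i ∧ (2 ^ t - 1) ∣ i then 1 else 0 := by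
  have h2 : CharP K 2 := charP_two hK
  have hone : (-1 : K) = 1 := CharTwo.neg_eq 1
  rcases Nat.eq_zero_or_pos i with rfl | hi
  · simp [hK, ht.ne', CharTwo.two_eq_zero]
  · have h := FiniteField.sum_pow_units K i
    rw [hK, hone] at h
    rw [← Finset.add_sum_erase _ _ (Finset.mem_univ (0 : K)), zero_pow hi.ne', zero_add]
    simp only [hi, true_and]
    rw [← h]
    symm
    refine Finset.sum_bij (fun u _ => (u : K)) ?_ ?_ ?_ ?_
    · simp
    · intro u _ v _ huv
      exact Units.ext huv
    · intro x hx
      exact ⟨Units.mk0 x (Finset.ne_of_mem_erase hx), by simp⟩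
    · simp

section TraceFormula

variable {R : Type*} [CommRing R]

def evq (p : R × R × R × R) (x : R) : R := p.1 + p.2.1 * x + p.2.2.1 * x ^ 2 + p.2.2.2 * x ^ 3

def evl : List (R × R × R × R) → R → R
  | [], _ => 1
  | p :: l, x => evq p x * evl l (x ^ 2)

def cubic (p : R × R × R × R) : R[X] :=
  C p.1 + C p.2.1 * X + C p.2.2.1 * X ^ 2 + C p.2.2.2 * X ^ 3

def quadPoly : List (R × R × R × R) → R[X]
  | [] => 1
  | p :: l => cubic p * expand R 2 (quadPoly l)

lemma eval_quadPoly (l : List (R × R × R × R)) (x : R) : (quadPoly l).eval x = evl l x := by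
  induction l generalizing x with
  | nil => simp [quadPoly, evl]
  | cons p l ih => simp [quadPoly, evl, ih, evq, cubic, expand_eval]

lemma natDegree_cubic (p : R × R × R × R) : (cubic p).natDegree ≤ 3 := by
  unfold cubic
  compute_degree

lemma natDegree_quadPoly (l : List (R × R × R × R)) :
    (quadPoly l).natDegree ≤ 3 * (2 ^ l.length - 1) := by
  induction l with
  | nil => simp [quadPoly]
  | cons p l ih =>
    rw [quadPoly]
    refine natDegree_mul_le.trans ?_
    rw [natDegree_expand, List.length_cons, pow_succ]
    have := natDegree_cubic p
    have := Nat.one_le_two_pow (n := l.length)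
    omega

lemma coeff_quadPoly (l : List (R × R × R × R)) (r : R × R) :
    ((C r.1 * X + C r.2 * X ^ 2) * quadPoly l).coeff (2 ^ l.length) = (actList l r).1 ∧
    ((C r.1 * X + C r.2 * X ^ 2) * quadPoly l).coeff (2 ^ (l.length + 1)) = (actList l r).2 := by
  induction l generalizing r with
  | nil =>
    simp [quadPoly, actList, coeff_X, coeff_X_pow]
  | cons p l ih =>
    have key : (C r.1 * X + C r.2 * X ^ 2) * quadPoly (p :: l) =
        expand R 2 ((C (act p r).1 * X + C (act p r).2 * X ^ 2) * quadPoly l) +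
        X * expand R 2 ((C (r.1 * p.1) + C (r.1 * p.2.2.1 + r.2 * p.2.1) * X +
          C (r.2 * p.2.2.2) * X ^ 2) * quadPoly l) := by
      simp only [quadPoly, cubic, act_apply, map_mul, map_add, expand_C, expand_X, map_pow]
      ring
    have hodd : ∀ (P : R[X]) (m : ℕ), 0 < m → (X * expand R 2 P).coeff (m * 2) = 0 := by
      intro P m hm
      obtain ⟨j, hj⟩ : ∃ j, m * 2 = j + 1 := ⟨m * 2 - 1, by omega⟩
      rw [hj, coeff_X_mul, coeff_expand two_pos, if_neg (by omega)]
    rw [key, List.length_cons, pow_succ 2 l.length, pow_succ 2 (l.length + 1), coeff_add, coeff_add,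
      hodd _ _ (by positivity), hodd _ _ (by positivity), coeff_expand_mul two_pos,
      coeff_expand_mul two_pos, add_zero, add_zero]
    exact ih (act p r)

lemma coeff_quadPoly_top (l : List (R × R × R × R)) (h : ∃ p ∈ l, p.2.2.2 = 0) :
    (quadPoly l).coeff (3 * (2 ^ l.length - 1)) = 0 := by
  induction l with
  | nil => simp at h
  | cons p l ih =>
    have e : 3 * (2 ^ (l.length + 1) - 1) = 3 + 3 * (2 ^ l.length - 1) * 2 := by
      have := Nat.one_le_two_pow (n := l.length)
      rw [pow_succ]
      omega
    rw [quadPoly, List.length_cons, e, coeff_mul_add_eq_of_natDegree_le (natDegree_cubic p)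
      (by rw [natDegree_expand]; exact Nat.mul_le_mul_right 2 (natDegree_quadPoly l)),
      coeff_expand_mul two_pos]
    obtain ⟨p', hp, h0⟩ := h
    obtain rfl | hp := List.mem_cons.1 hp
    · simp [cubic, h0]
    · rw [ih ⟨p', hp, h0⟩, mul_zero]

variable {K : Type*} [Field K] [Fintype K] [Algebra K R]

theorem sum_evl {t : ℕ} (ht : 0 < t) (hK : Fintype.card K = 2 ^ t)
    (l : List (R × R × R × R)) (hl : l.length = t) (h : ∃ p ∈ l, p.2.2.2 = 0) :
    ∑ x : K, evl l (algebraMap K R x) = trc l := by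
  have hm : 1 < 2 ^ t := Nat.one_lt_two_pow ht.ne'
  obtain ⟨m, hmt⟩ : ∃ m, 2 ^ t = m + 1 := ⟨2 ^ t - 1, by omega⟩
  have hm0 : 0 < m := by omega
  have hdeg : (quadPoly l).natDegree < 3 * m + 1 := by
    have := natDegree_quadPoly l
    rw [hl, hmt] at this
    omega
  simp only [← eval_quadPoly, eval_eq_sum_range' hdeg]
  rw [Finset.sum_comm]
  have hs : ∀ i, ∑ x : K, (quadPoly l).coeff i * algebraMap K R x ^ i =
      if 0 < i ∧ m ∣ i then (quadPoly l).coeff i else 0 := by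
    intro i
    rw [← Finset.mul_sum]
    have := congrArg (algebraMap K R) (sum_pow_eq ht hK i)
    rw [map_sum] at this
    simp only [map_pow] at this
    rw [this, hmt, Nat.add_sub_cancel]
    split_ifs <;> simp
  simp only [hs]
  rw [← Finset.sum_filter]
  have hf : (Finset.range (3 * m + 1)).filter (fun i => 0 < i ∧ m ∣ i) = {m, 2 * m, 3 * m} := by
    ext i
    simp only [Finset.mem_filter, Finset.mem_range, Finset.mem_insert, Finset.mem_singleton]
    constructor
    · rintro ⟨h1, h2, j, rfl⟩
      have : j < 4 := by
        by_contra hj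
        have : m * 4 ≤ m * j := Nat.mul_le_mul_left m (by omega)
        omega
      interval_cases j <;> omega
    · rintro (rfl | rfl | rfl)
      · exact ⟨by omega, hm0, dvd_rfl⟩
      · exact ⟨by omega, by omega, dvd_mul_left _ _⟩
      · exact ⟨by omega, by omega, dvd_mul_left _ _⟩
  rw [hf, Finset.sum_insert (by simp; omega), Finset.sum_insert (by simp; omega),
    Finset.sum_singleton]
  have h3 := coeff_quadPoly_top l h
  have h1 := (coeff_quadPoly l (1, 0)).1
  have h2 := (coeff_quadPoly l (0, 1)).2
  rw [hl, hmt] at h1 h3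
  rw [hl, pow_succ 2 t, hmt, show (m + 1) * 2 = 2 * m + 2 by ring] at h2
  simp only [map_one, map_zero, one_mul, zero_mul, add_zero, zero_add, coeff_X_mul,
    coeff_X_pow_mul] at h1 h2
  rw [Nat.add_sub_cancel] at h3
  rw [h1, h2, h3, add_zero, trc]

theorem sum_evl_shift {t : ℕ} (ht : 0 < t) (hK : Fintype.card K = 2 ^ t)
    (l : List (R × R × R × R)) (hl : l.length = t) (h : ∃ p ∈ l, p.2.2.2 = 0) (s : ℕ) :
    ∑ x : K, evl l (algebraMap K R (x ^ 2 ^ s)) = trc l := by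
  have hc : CharP K 2 := charP_two hK
  have hinj : Function.Injective fun x : K => x ^ 2 ^ s := by
    have : ExpChar K 2 := ExpChar.prime Nat.prime_two
    exact iterateFrobenius_inj K 2 s
  rw [← sum_evl ht hK l hl h]
  exact (Function.Bijective.sum_comp (Finite.injective_iff_bijective.1 hinj)
    fun x => evl l (algebraMap K R x))

end TraceFormula

/-! ### Digit monomials -/

section Mono

variable {K : Type*} [Field K]

def xmono {R : Type*} [CommRing R] : List Bool → R → R
  | [], _ => 1
  | b :: l, x => (if b then x else 1) * xmono l (x ^ 2)

/-- Coefficients of `x ^ ((1 - e) + f)`. -/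
def pairQuad (e f : Bool) : K × K × K × K :=
  (if e && !f then 1 else 0, if e == f then 1 else 0, if !e && f then 1 else 0, 0)

lemma xmono_mul (l : List (Bool × Bool)) (x : K) :
    xmono (l.map fun p => !p.1) x * xmono (l.map Prod.snd) x =
      evl (l.map fun p => pairQuad p.1 p.2) x := by
  induction l generalizing x with
  | nil => simp [xmono, evl]
  | cons p l ih =>
    simp only [List.map_cons, xmono, evl]
    rw [← ih]
    obtain ⟨_ | _, _ | _⟩ := p <;> simp [pairQuad, evq] <;> ring

lemma actList_pair_snd (l : List (Bool × Bool)) (r : K × K) (hr : r.2 = 0) :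
    actList (l.map fun p => pairQuad (K := K) p.1 p.2) r =
      (if ∀ p ∈ l, p.1 = p.2 then r.1 else 0, 0) := by
  induction l generalizing r with
  | nil => ext <;> simp [actList, hr]
  | cons p l ih =>
    rw [List.map_cons, actList, LinearMap.comp_apply, ih _ (by simp [act_apply, pairQuad, hr])]
    by_cases h : p.1 = p.2
    · simp [act_apply, pairQuad, hr, h]
    · simp [act_apply, pairQuad, hr, h]

lemma actList_pair_fst (l : List (Bool × Bool)) (r : K × K) (h : ∃ p ∈ l, p ≠ (false, true)) :
    (actList (l.map fun p => pairQuad (K := K) p.1 p.2) r).2 = 0 := by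
  induction l generalizing r with
  | nil => simp at h
  | cons p l ih =>
    rw [List.map_cons, actList, LinearMap.comp_apply]
    by_cases hp : p = (false, true)
    · refine ih _ ?_
      obtain ⟨p', h1, h2⟩ := h
      obtain rfl | h1 := List.mem_cons.1 h1
      · exact absurd hp h2
      · exact ⟨p', h1, h2⟩
    · rw [actList_pair_snd]
      obtain ⟨_ | _, _ | _⟩ := p <;> simp_all [act_apply, pairQuad]

variable [Fintype K]

lemma sum_xmono_pair {t : ℕ} (ht : 0 < t) (hK : Fintype.card K = 2 ^ t)
    (l : List (Bool × Bool)) (hl : l.length = t) (h : ∃ p ∈ l, p ≠ (false, true)) :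
    ∑ x : K, xmono (l.map fun p => !p.1) x * xmono (l.map Prod.snd) x =
      if ∀ p ∈ l, p.1 = p.2 then 1 else 0 := by
  simp only [xmono_mul]
  obtain ⟨p, hp, -⟩ := id h
  have := sum_evl ht hK (l.map fun p => pairQuad (K := K) p.1 p.2) (by simpa using hl)
    ⟨_, List.mem_map_of_mem hp, rfl⟩
  simp only [Algebra.algebraMap_self, RingHom.id_apply] at this
  rw [this, trc, actList_pair_fst l _ h, actList_pair_snd l _ rfl, add_zero]

end Mono

end SymplecticRank

namespace SymplecticRank

/-! ### Closed runs give values in the row space -/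

/-- Letters that occur in runs which never meet a distinguished letter. -/
def quiet : Bool → Ltr → Bool
  | false, (true, false, false) => true
  | false, (false, true, false) => true
  | false, (true, false, true) => true
  | false, (false, true, true) => true
  | false, _ => false
  | true, (false, true, false) => true
  | true, (false, false, true) => true
  | true, _ => false

def distinguished : Bool → Ltr → Bool
  | _, (false, false, false) => true
  | false, (true, true, false) => true
  | true, (true, false, false) => true
  | _, _ => false

lemma step_cases : ∀ (x : Bool) (v : Ltr) (y : Bool), step x v = some y →
    distinguished x v = true ∨ (x = true ∧ y = false) ∨ (x = y ∧ quiet x v = true) := by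
  decide

lemma run_quiet_or (x z : Bool) (w : List Ltr) (h : run x w = some z) :
    (∃ u y l v, w = u ++ l :: v ∧ run x u = some y ∧ distinguished y l = true) ∨
      (x = true ∧ z = false) ∨ (x = z ∧ ∀ v ∈ w, quiet x v = true) := by
  induction w generalizing x with
  | nil =>
    refine .inr (.inr ⟨by simpa [run] using h, by simp⟩)
  | cons v w ih =>
    by_cases hd : distinguished x v = true
    · exact .inl ⟨[], x, v, w, rfl, rfl, hd⟩
    rw [run_cons] at h
    cases hs : step x v with
    | none => simp [hs] at h
    | some y =>
      rw [hs, Option.bind_some] at h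
      obtain ⟨u, y', l, v', rfl, h1, h2⟩ | hr := ih y h
      · exact .inl ⟨v :: u, y', l, v', rfl, by rw [run_cons, hs, Option.bind_some, h1], h2⟩
      refine .inr ?_
      obtain hd' | ⟨rfl, rfl⟩ | ⟨rfl, hq⟩ := step_cases x v y hs
      · exact absurd hd' hd
      · obtain ⟨hy, -⟩ | ⟨rfl, -⟩ := hr
        · cases hy
        · exact .inl ⟨rfl, rfl⟩
      · obtain h1 | ⟨rfl, h1⟩ := hr
        · exact .inl h1
        · exact .inr ⟨rfl, by simpa [hq] using h1⟩

namespace Frob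

variable {R : Type*} [CommRing R] (F : Frob R)

/-- Digit monomial. -/
def md (s : ℕ) (v : Ltr) : R :=
  (if v.1 then F.a s else 1) * (if v.2.1 then F.b s else 1) * (if v.2.2 then F.c s else 1)

def mon (s : ℕ) : Bool → Ltr → R
  | false, (true, true, false) => F.d (s + 1)
  | _, v => F.md s v

lemma mon_true (s : ℕ) (v : Ltr) : F.mon s true v = F.md s v := by
  obtain ⟨_ | _, _ | _, _ | _⟩ := v <;> rfl

variable {F} in
lemma Per.md {t : ℕ} (h : F.Per t) (s : ℕ) (v : Ltr) : F.md (s + t) v = F.md s v := by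
  rw [Frob.md, Frob.md, h.c, (h s).1, (h s).2.1]

variable {F} in
lemma Per.mon {t : ℕ} (h : F.Per t) (s : ℕ) (x : Bool) (v : Ltr) :
    F.mon (s + t) x v = F.mon s x v := by
  have e : F.d (s + t + 1) = F.d (s + 1) := by
    rw [show s + t + 1 = s + 1 + t by omega, (h (s + 1)).2.2]
  obtain ⟨_ | _, _ | _, _ | _⟩ := v <;> cases x <;> first | exact h.md s _ | exact e

variable (K : Type*) [Field K] [Algebra K R]

def rvSpan (i m : ℕ) : Submodule K (R × R) :=
  span K {r | ∃ Y : List Ltr, Y.length = m ∧ F.rv i Y e1 = r}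

variable {K} (S : Submodule K R)

def coeffSub (i m : ℕ) : Submodule K R where
  carrier := {f | ∀ y, (y, 0) ∈ F.rvSpan K i m → f * y ∈ S}
  add_mem' hf hg y hy := by rw [add_mul]; exact S.add_mem (hf y hy) (hg y hy)
  zero_mem' y _ := by simp
  smul_mem' c f hf y hy := by rw [smul_mul_assoc]; exact S.smul_mem c (hf y hy)

def vecSub (i m : ℕ) : Submodule K (R × R) where
  carrier := {r | ∀ (N : List Ltr) (v : Ltr), rankOne v = true → N.length + 1 ≤ m →
    (F.rv i (N ++ [v]) r).1 ∈ F.coeffSub S (i + (N.length + 1)) (m - (N.length + 1))}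
  add_mem' hf hg N v hv hN := by
    rw [map_add]; exact add_mem (hf N v hv hN) (hg N v hv hN)
  zero_mem' N v _ _ := by simp
  smul_mem' c f hf N v hv hN := by
    rw [LinearMap.map_smul_of_tower]; exact Submodule.smul_mem _ c (hf N v hv hN)

variable {F S}

lemma rv_rankOne_snd (s : ℕ) (N : List Ltr) (v : Ltr) (hv : rankOne v = true) (r : R × R) :
    (F.rv s (N ++ [v]) r).2 = 0 := by
  rw [rv_append, rv_cons, rv_nil, F.act_rankOne _ _ hv]

lemma cf_letter (s : ℕ) {u : R} (hu : u ∈ F.cf s) : ∃ v, act (F.quad s v) e1 = u • e1 := by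
  obtain rfl | rfl | rfl | rfl | rfl := hu
  · exact ⟨(false, true, true), by ext <;> simp [act_apply, quad, e1]⟩
  · exact ⟨(true, false, true), by ext <;> simp [act_apply, quad, e1]⟩
  · exact ⟨(false, true, false), by ext <;> simp [act_apply, quad, e1]⟩
  · exact ⟨(true, false, false), by ext <;> simp [act_apply, quad, e1]⟩
  · exact ⟨(true, true, false), by ext <;> simp [act_apply, quad, e1]⟩

lemma act_enter (s : ℕ) : act (F.quad s (false, false, false)) e1 = F.d s • F.rho s := by
  ext <;> simp [act_apply, quad, e1, rho, mul_comm]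

lemma smul_mem_rvSpan {i m : ℕ} {u : R} (hu : u ∈ F.cf i) {r : R × R}
    (hr : r ∈ F.rvSpan K (i + 1) m) : u • r ∈ F.rvSpan K i (m + 1) := by
  obtain ⟨v, hv⟩ := cf_letter i hu
  have h : F.rvSpan K (i + 1) m ≤ (F.rvSpan K i (m + 1)).comap
      ((LinearMap.lsmul R (R × R) u).restrictScalars K) := by
    refine span_le.2 ?_
    rintro _ ⟨Y, rfl, rfl⟩
    refine subset_span ⟨v :: Y, rfl, ?_⟩
    rw [rv_cons, hv, map_smul]
    rfl
  exact h hr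

lemma rv_side_mem {i : ℕ} (N : List Ltr) {v : Ltr} (hv : rankOne v = true) {x : R × R}
    (hx : x = e1 ∨ x ∈ F.side i) : F.rv i (N ++ [v]) x ∈ F.rvSpan K i (N.length + 1) := by
  induction N generalizing i x with
  | nil =>
    obtain rfl | hx := hx
    · exact subset_span ⟨[v], rfl, rfl⟩
    rw [List.nil_append, rv_cons, rv_nil]
    obtain h | ⟨u, hu, h⟩ | ⟨h, -⟩ | ⟨h, -⟩ := F.act_side i v x hx
    · rw [h]; exact zero_mem _
    · rw [h]
      exact smul_mem_rvSpan hu (subset_span ⟨[], rfl, rfl⟩)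
    · simp [h] at hv
    · simp [h] at hv
  | cons l N ih =>
    obtain rfl | hx := hx
    · exact subset_span ⟨l :: N ++ [v], by simp, rfl⟩
    rw [List.cons_append, rv_cons]
    obtain h | ⟨u, hu, h⟩ | ⟨-, u, hu, y, hy, h⟩ | ⟨-, h⟩ := F.act_side i l x hx
    · rw [h, map_zero]; exact zero_mem _
    · rw [h, map_smul]
      exact smul_mem_rvSpan hu (ih (.inl rfl))
    · rw [h, map_smul]
      exact smul_mem_rvSpan hu (ih (.inr hy))
    · rw [h, ← act_enter, ← rv_cons]
      exact subset_span ⟨(false, false, false) :: (N ++ [v]), by simp, rfl⟩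

lemma rv_mem_rvSpan {i n : ℕ} (Z : List Ltr) {r : R × R} (hr : r ∈ F.rvSpan K i n) :
    F.rv (i + n) Z r ∈ F.rvSpan K i (n + Z.length) := by
  have h : F.rvSpan K i n ≤ (F.rvSpan K i (n + Z.length)).comap
      ((F.rv (i + n) Z).restrictScalars K) := by
    refine span_le.2 ?_
    rintro _ ⟨Y, rfl, rfl⟩
    refine subset_span ⟨Y ++ Z, by simp, ?_⟩
    rw [rv_append]
    rfl
  exact h hr

lemma smul_mem_vecSub {i m : ℕ} {f : R} (hf : f ∈ F.coeffSub S i m) {x : R × R}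
    (hx : x = e1 ∨ x ∈ F.side i) : f • x ∈ F.vecSub S i m := by
  intro N v hv hN y hy
  set n := N.length + 1 with hn
  have hg := rv_side_mem (K := K) N hv hx
  have h0 := rv_rankOne_snd (F := F) i N v hv x
  rw [map_smul, Prod.smul_fst, smul_eq_mul, mul_assoc]
  set g := (F.rv i (N ++ [v]) x).1 with hgdef
  have hg' : F.rv i (N ++ [v]) x = g • e1 := by ext <;> simp [e1, h0, hgdef]
  rw [hg'] at hg
  have h : F.rvSpan K (i + n) (m - n) ≤ (F.rvSpan K i m).comap
      ((LinearMap.lsmul R (R × R) g).restrictScalars K) := by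
    refine span_le.2 ?_
    rintro _ ⟨Z, hZ, rfl⟩
    have := rv_mem_rvSpan Z hg
    rw [map_smul, hZ, Nat.add_sub_cancel' hN] at this
    exact this
  refine hf _ ?_
  simpa using h hy

lemma coeffSub_mul {i m : ℕ} {f : R} (hf : f ∈ F.coeffSub S i (m + 1)) {u : R}
    (hu : u ∈ F.cf i) : f * u ∈ F.coeffSub S (i + 1) m := by
  intro y hy
  rw [mul_assoc]
  refine hf _ ?_
  simpa using smul_mem_rvSpan hu hy

lemma coeffSub_zero {i : ℕ} {f : R} (hf : f ∈ F.coeffSub S i 0) : f ∈ S := by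
  simpa using hf 1 (subset_span ⟨[], rfl, rfl⟩)

lemma act_mem_vecSub {i m : ℕ} {r : R × R} (hr : r ∈ F.vecSub S i (m + 1)) (v : Ltr) :
    act (F.quad i v) r ∈ F.vecSub S (i + 1) m := by
  intro N l hl hN
  have := hr (v :: N) l hl (by simp; omega)
  rw [List.cons_append, rv_cons, List.length_cons, Nat.add_sub_add_right,
    show i + (N.length + 1 + 1) = i + 1 + (N.length + 1) by omega] at this
  exact this

lemma act_fst_mem {i m : ℕ} {r : R × R} (hr : r ∈ F.vecSub S i (m + 1)) {v : Ltr}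
    (hv : rankOne v = true) : (act (F.quad i v) r).1 ∈ F.coeffSub S (i + 1) m :=
  hr [] v hv (by simp)

variable {t : ℕ}

lemma e1_mem_vecSub (hS : ∀ s N, N.length = t → (∃ v ∈ N, rankOne v = true) → F.tr s N ∈ S)
    (s : ℕ) : e1 ∈ F.vecSub S s t := by
  intro N v hv hN y hy
  have h1 := rv_rankOne_snd (F := F) s N v hv e1
  have h2 := rv_rankOne_snd (F := F) s N v hv e2
  set f := (F.rv s (N ++ [v]) e1).1 with hf
  set g := (F.rv s (N ++ [v]) e2).1 with hg
  have h1' : F.rv s (N ++ [v]) e1 = f • e1 := Prod.ext (by simp [e1, hf]) (by simpa [e1] using h1)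
  have h2' : F.rv s (N ++ [v]) e2 = g • e1 := Prod.ext (by simp [e1, hg]) (by simpa [e1] using h2)
  have h : F.rvSpan K (s + (N.length + 1)) (t - (N.length + 1)) ≤ S.comap
      ((LinearMap.lsmul R R f ∘ₗ LinearMap.fst R R R +
        LinearMap.lsmul R R g ∘ₗ LinearMap.snd R R R).restrictScalars K) := by
    refine span_le.2 ?_
    rintro _ ⟨Z, hZ, rfl⟩
    have := hS s (N ++ [v] ++ Z) (by simp; omega) ⟨v, by simp, hv⟩
    rw [tr, trc] at this
    change (F.rv s (N ++ [v] ++ Z) e1).1 + (F.rv s (N ++ [v] ++ Z) e2).2 ∈ S at this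
    rw [F.rv_append s (N ++ [v]) Z e1, F.rv_append s (N ++ [v]) Z e2, h1', h2', map_smul, map_smul,
      List.length_append, List.length_singleton] at this
    simpa using this
  simpa using h hy

variable (F S) in
/-- The property of partial products `f` that is propagated along runs. -/
def Inv (s : ℕ) (x : Bool) (f : R) (m : ℕ) : Prop :=
  match x with
  | true => f • e1 ∈ F.vecSub S s (m + 1)
  | false => f ∈ F.coeffSub S (s + 1) m ∧ f • F.rho s ∈ F.vecSub S (s + 1) m

lemma Inv.add {s m : ℕ} {x : Bool} {f g : R} (hf : F.Inv S s x f m) (hg : F.Inv S s x g m) :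
    F.Inv S s x (f + g) m := by
  cases x
  · exact ⟨add_mem hf.1 hg.1, by rw [add_smul]; exact add_mem hf.2 hg.2⟩
  · rw [Inv, add_smul]; exact add_mem hf hg

lemma Inv.smul_cf_e1 {s m : ℕ} {f u : R} (h : F.Inv S s true f m) (hu : u ∈ F.cf s) :
    (f * u) • e1 ∈ F.vecSub S (s + 1) m := by
  obtain ⟨v, hv⟩ := cf_letter s hu
  have := act_mem_vecSub h v
  rwa [map_smul, hv, smul_smul] at this

lemma Inv.smul_cf {s m : ℕ} {f u : R} (h : F.Inv S s true f (m + 1)) (hu : u ∈ F.cf s) :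
    F.Inv S (s + 1) true (f * u) m :=
  h.smul_cf_e1 hu

lemma Inv.coeff_one {s m : ℕ} {f : R} (h : F.Inv S s true f m) : f ∈ F.coeffSub S (s + 1) m := by
  have := act_fst_mem h (v := (false, true, true)) rfl
  rw [map_smul] at this
  simpa [act_apply, quad, e1] using this

lemma Inv.coeff_a {s m : ℕ} {f : R} (h : F.Inv S s true f m) :
    f * F.a s ∈ F.coeffSub S (s + 1) m := by
  have := act_fst_mem h (v := (true, false, true)) rfl
  rw [map_smul] at this
  simpa [act_apply, quad, e1] using this

lemma Inv.coeff_d {s m : ℕ} {f : R} (h : F.Inv S s true f m) :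
    f * F.d s ∈ F.coeffSub S (s + 1) m := by
  have := act_fst_mem h (v := (true, true, false)) rfl
  rw [map_smul] at this
  simpa [act_apply, quad, e1] using this

lemma Inv.enter {s m : ℕ} {f : R} (h : F.Inv S s true f m) :
    F.Inv S s false (f * F.d s) m := by
  refine ⟨h.coeff_d, ?_⟩
  have := act_mem_vecSub h (false, false, false)
  rwa [map_smul, act_enter, smul_smul] at this

lemma act_rho_cf2 (s : ℕ) {u : R} (hu : u ∈ F.cf2 s) :
    (∃ v, rankOne v = true ∧ act (F.quad (s + 1) v) (F.rho s) = u • e1) ∧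
      ∃ v, ∃ u' ∈ F.cf2 s, ∃ y, (y = e1 ∨ y ∈ F.side (s + 2)) ∧
        act (F.quad (s + 1) v) (F.rho s) = u • F.rho (s + 1) + u' • y := by
  have hd : F.d (s + 1) = F.c s + F.a s * F.b s := by
    rw [c]; linear_combination (-F.a s * F.b s) * F.two
  have h1 := F.a_succ s
  have h2 := F.b_succ s
  have h1' := F.a_succ (s + 1)
  have h2' := F.b_succ (s + 1)
  have h3' := F.d_succ (s + 1)
  have hc := F.c_succ s
  have h4 := F.two
  obtain rfl | rfl | rfl | rfl := hu
  · refine ⟨⟨(true, true, true), rfl, by ext <;> simp [act_apply, quad, rho, e1]⟩,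
      (false, false, true), _, .inr (.inr (.inr rfl)), e1, .inl rfl, ?_⟩
    ext <;> simp [act_apply, quad, rho, e1, hd, h1, h2, hc] <;> ring
  · refine ⟨⟨(false, true, true), rfl, by ext <;> simp [act_apply, quad, rho, e1]⟩,
      (false, true, false), _, .inr (.inr (.inl rfl)), e2, .inr (by simp [side]), ?_⟩
    ext <;> simp [act_apply, quad, rho, e2, hd, h1, h2, hc] <;> ring
  · refine ⟨⟨(true, false, true), rfl, ?_⟩,
      (true, false, false), _, .inr (.inl rfl), F.sg' (s + 2), .inr (by simp [side]), ?_⟩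
    · ext
      · simp [act_apply, quad, rho, e1, hd, h1, h2]
        linear_combination (F.a s ^ 2 * F.b s) * h4
      · simp [act_apply, quad, rho, e1]
    · ext
      · simp [act_apply, quad, rho, sg', h3', hd, h1, h2, hc]
        linear_combination (- F.a s * F.b s ^ 2 * F.c s) * h4
      · simp [act_apply, quad, rho, sg', h1', hd, h1, h2, hc]
        ring
  · refine ⟨⟨(true, true, false), rfl, ?_⟩,
      (false, false, false), _, .inl rfl, F.sg (s + 2), .inr (by simp [side]), ?_⟩
    · ext
      · simp [act_apply, quad, rho, e1, hd, h1, h2]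
        linear_combination (F.b s ^ 2 * F.a s) * h4
      · simp [act_apply, quad, rho, e1]
    · ext
      · simp [act_apply, quad, rho, sg, h2', hd, h1, h2, hc]
        ring
      · simp [act_apply, quad, rho, sg, h3', hd, h1, h2, hc]
        linear_combination (- F.a s ^ 2 * F.b s * F.c s) * h4

lemma Inv.coeff_cf2 {s m : ℕ} {f u : R} (h : F.Inv S s false f (m + 1)) (hu : u ∈ F.cf2 s) :
    f * u ∈ F.coeffSub S (s + 2) m := by
  obtain ⟨⟨v, hv, e⟩, -⟩ := act_rho_cf2 s hu
  have := act_fst_mem h.2 hv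
  rw [map_smul, e] at this
  simpa [e1] using this

lemma Inv.false_cf2 {s m : ℕ} {f u : R} (h : F.Inv S s false f (m + 1)) (hu : u ∈ F.cf2 s) :
    F.Inv S (s + 1) false (f * u) m := by
  refine ⟨h.coeff_cf2 hu, ?_⟩
  obtain ⟨-, v, u', hu', y, hy, e⟩ := act_rho_cf2 s hu
  have h1 := act_mem_vecSub h.2 v
  have h2 := smul_mem_vecSub (h.coeff_cf2 hu') hy
  rw [map_smul, e, smul_add, smul_smul, smul_smul] at h1
  exact (Submodule.add_mem_iff_left _ h2).1 h1

lemma Inv.of_coeff {s m : ℕ} {f : R} (h : f ∈ F.coeffSub S (s + 1) (m + 1)) :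
    F.Inv S (s + 1) true f m :=
  smul_mem_vecSub h (.inl rfl)

lemma Inv.step {s m : ℕ} {x y : Bool} {f : R} {v : Ltr} (h : F.Inv S s x f (m + 1))
    (hv : step x v = some y) : F.Inv S (s + 1) y (f * F.mon s x v) m := by
  have hc : F.c s = F.d (s + 1) + F.a s * F.b s := rfl
  have ca : F.a (s + 1) ∈ F.cf (s + 1) := by simp [cf]
  have cb : F.b (s + 1) ∈ F.cf (s + 1) := by simp [cf]
  have cc : F.c (s + 1) ∈ F.cf (s + 1) := by simp [cf]
  cases x
  · have key : ∀ u, u = F.d (s + 1) → F.Inv S (s + 1) false (f * u) m := by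
      rintro _ rfl
      exact (Inv.of_coeff h.1).enter
    obtain ⟨_ | _, _ | _, _ | _⟩ := v <;> simp only [SymplecticRank.step, Option.some.injEq,
      reduceCtorEq] at hv <;> subst hv <;> simp only [mon, md, if_true, if_false, one_mul, mul_one,
      Bool.false_eq_true]
    · exact Inv.of_coeff h.1
    · exact h.false_cf2 (by simp [cf2])
    · exact h.false_cf2 (by simp [cf2])
    · exact h.false_cf2 (by simp [cf2])
    · exact h.false_cf2 (by simp [cf2])
    · exact key _ rfl
  · rw [mon_true]
    have h1 : F.Inv S (s + 1) true (f * 1) m := h.smul_cf (by simp [cf])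
    have ha : F.Inv S (s + 1) true (f * F.a s) m := h.smul_cf (by simp [cf])
    have hb : F.Inv S (s + 1) true (f * F.b s) m := h.smul_cf (by simp [cf])
    have hcc : F.Inv S (s + 1) true (f * F.c s) m := h.smul_cf (by simp [cf])
    obtain ⟨_ | _, _ | _, _ | _⟩ := v <;> simp only [SymplecticRank.step, Option.some.injEq,
      reduceCtorEq] at hv <;> subst hv <;> simp only [md, if_true, if_false, one_mul, mul_one,
      Bool.false_eq_true]
    · simpa using h1
    · exact hcc
    · exact hb
    · have e : f * (F.b s * F.c s) = f * F.b s * F.d (s + 1) + f * F.a s * F.b (s + 1) := by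
        rw [hc, F.b_succ]; ring
      have er : (f * F.a s * F.b (s + 1)) • F.rho (s + 1) =
          (f * F.a s) • F.sg (s + 2) + (f * F.a s * F.c (s + 1)) • e2 := by
        ext
        · simp [rho, sg, e2, F.b_succ (s + 1)]; ring
        · simp [rho, sg, e2, c]
          linear_combination (-f * F.a s * F.d (s + 1 + 1)) * F.two
      rw [e]
      refine hb.enter.add ⟨coeffSub_mul h.coeff_a cb, ?_⟩
      rw [er]
      exact add_mem (smul_mem_vecSub ha.coeff_one (.inr (by simp [side])))
        (smul_mem_vecSub (coeffSub_mul h.coeff_a cc) (.inr (by simp [side])))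
    · exact ha
    · have e : f * (F.a s * F.c s) = f * F.a s * F.d (s + 1) + f * F.b s * F.a (s + 1) := by
        rw [hc, F.a_succ]; ring
      have er : (f * F.b s * F.a (s + 1)) • F.rho (s + 1) =
          (f * F.b s * F.c (s + 1)) • e1 + (f * F.b s) • F.sg' (s + 2) := by
        ext
        · simp [rho, sg', e1, c]
          linear_combination (-f * F.b s * F.d (s + 1 + 1)) * F.two
        · simp [rho, sg', e1, F.a_succ (s + 1)]; ring
      rw [e]
      refine ha.enter.add ⟨hb.coeff_a, ?_⟩
      rw [er]
      exact add_mem (hb.smul_cf_e1 cc) (smul_mem_vecSub hb.coeff_one (.inr (by simp [side])))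
    · have e : f * (F.a s * F.b s) = f * 1 * F.d (s + 1) + f * F.c s := by
        rw [hc]; linear_combination (-f * F.d (s + 1)) * F.two
      have er : (f * F.c s) • F.rho (s + 1) =
          (f * F.c s * F.b (s + 1)) • e1 + (f * F.c s * F.a (s + 1)) • e2 := by
        ext <;> simp [rho, e1, e2]
      rw [e]
      refine h1.enter.add ⟨hcc.coeff_one, ?_⟩
      rw [er]
      exact add_mem (hcc.smul_cf_e1 cb) (smul_mem_vecSub hcc.coeff_a (.inr (by simp [side])))
    · have e : f * (F.a s * F.b s * F.c s) = f * F.c s * F.d (s + 1) + f * F.c (s + 1) := by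
        rw [F.c_succ, hc]
        linear_combination (-f * (F.d (s + 1) + F.a s * F.b s) * F.d (s + 1)) * F.two
      have er : (f * F.c (s + 1)) • F.rho (s + 1) =
          (f * F.a (s + 1)) • F.sg (s + 2) + (f * F.b (s + 1)) • F.sg' (s + 2) := by
        ext
        · simp [rho, sg, sg', c, F.b_succ (s + 1)]; ring
        · simp [rho, sg, sg', c, F.a_succ (s + 1)]; ring
      rw [e]
      refine hcc.enter.add ⟨coeffSub_mul h.coeff_one cc, ?_⟩
      rw [er]
      exact add_mem (smul_mem_vecSub (coeffSub_mul h.coeff_one ca) (.inr (by simp [side])))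
        (smul_mem_vecSub (coeffSub_mul h.coeff_one cb) (.inr (by simp [side])))

lemma Inv.run {s m : ℕ} {x y : Bool} {f : R} (w : List Ltr) (h : F.Inv S s x f (m + w.length))
    (hw : run x w = some y) : F.Inv S (s + w.length) y (f * wprod F.mon s x w) m := by
  induction w generalizing s x f with
  | nil =>
    obtain rfl : x = y := by simpa [SymplecticRank.run] using hw
    simpa [wprod] using h
  | cons v w ih =>
    rw [run_cons] at hw
    cases hs : SymplecticRank.step x v with
    | none => simp [hs] at hw
    | some z =>
      rw [hs, Option.bind_some] at hw
      have := ih (Inv.step h hs) hw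
      rw [wprod, hs, List.length_cons, ← add_assoc, add_right_comm]
      rwa [mul_assoc] at this

lemma wprod_mem_of_distinguished (h : F.Per t) (hS : ∀ s N, N.length = t → (∃ v ∈ N, rankOne v = true) →
      F.tr s N ∈ S) (s : ℕ) {x y z : Bool} {u v : List Ltr} {l : Ltr}
    (hl : u.length + v.length + 1 = t) (hu : SymplecticRank.run x u = some y)
    (hd : distinguished y l = true) (hs : SymplecticRank.step y l = some z)
    (hv : SymplecticRank.run z v = some x) :
    wprod F.mon s z (v ++ u) * F.mon (s + (v ++ u).length) y l ∈ S := by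
  have h1 : F.Inv S s true 1 (t - 1) := by
    have := e1_mem_vecSub hS s
    rw [Inv, one_smul, Nat.sub_add_cancel (by omega)]
    exact this
  have ht : t - 1 = 0 + (v ++ u).length := by simp; omega
  have hvu : SymplecticRank.run z (v ++ u) = some y := by rw [run_append, hv, Option.bind_some, hu]
  rw [ht] at h1
  cases y
  · obtain ⟨rfl, rfl⟩ | ⟨rfl, rfl⟩ : (l = (false, false, false) ∧ z = true) ∨
        (l = (true, true, false) ∧ z = false) := by
      clear hv hvu; revert l z; decide
    · have := coeffSub_zero (h1.run _ hvu).1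
      simpa [mon, md] using this
    · have := coeffSub_zero (h1.enter.run _ hvu).1
      rw [mon, show s + (v ++ u).length + 1 = s + t by omega, (h s).2.2, mul_comm]
      simpa using this
  · obtain ⟨rfl, rfl⟩ | ⟨rfl, rfl⟩ : (l = (false, false, false) ∧ z = true) ∨
        (l = (true, false, false) ∧ z = true) := by
      clear hv hvu; revert l z; decide
    · have := coeffSub_zero (h1.run _ hvu).coeff_one
      simpa [mon, md] using this
    · have := coeffSub_zero (h1.run _ hvu).coeff_a
      simpa [mon, md] using this

/-- Products along closed runs that meet a letter which is not quiet. -/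
theorem Per.wprod_mem (h : F.Per t)
    (hS : ∀ s N, N.length = t → (∃ v ∈ N, rankOne v = true) → F.tr s N ∈ S) (s : ℕ) {x : Bool}
    {w : List Ltr} (hw : w.length = t) (hr : SymplecticRank.run x w = some x)
    (hq : ∃ v ∈ w, quiet x v = false) : wprod F.mon s x w ∈ S := by
  obtain ⟨u, y, l, v, rfl, hu, hd⟩ | ⟨rfl, h'⟩ | ⟨-, h'⟩ := run_quiet_or x x w hr
  · rw [run_append, hu, Option.bind_some, run_cons] at hr
    cases hs : SymplecticRank.step y l with
    | none => simp [hs] at hr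
    | some z =>
      rw [hs, Option.bind_some] at hr
      have hl : u.length + v.length + 1 = t := by simpa [add_assoc] using hw
      have := wprod_mem_of_distinguished h hS (s + u.length + 1) hl hu hd hs hr
      rw [wprod_append _ _ _ _ _ _ hr, List.length_append] at this
      rw [wprod_append _ _ _ _ _ _ hu, wprod, hs]
      rw [show s + u.length + 1 + v.length = s + t by omega, wprod_per _ t h.mon,
        show s + u.length + 1 + (v.length + u.length) = s + u.length + t by omega, h.mon] at this
      convert this using 1
      dsimp only
      ring
  · cases h'
  · obtain ⟨v, hv, hv'⟩ := hq
    simp [h' v hv] at hv'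

lemma Per.tr_add (h : F.Per t) (s : ℕ) (N : List Ltr) : F.tr (s + t) N = F.tr s N := by
  rw [tr, tr, h.quads]

lemma Per.tr_mem_of_rankOne_all (h : F.Per t)
    (hS : ∀ N, N.length = t → (∃ v ∈ N, rankOne v = true) → F.tr 0 N ∈ S) (s : ℕ) :
    ∀ N, N.length = t → (∃ v ∈ N, rankOne v = true) → F.tr s N ∈ S := by
  induction s with
  | zero => exact hS
  | succ s ih =>
    intro N hN hv
    obtain rfl | ⟨L, l, rfl⟩ := N.eq_nil_or_concat'
    · simp at hv
    rw [← List.length_singleton (a := l), ← h.tr_rotate s [l] L (by simpa [add_comm] using hN)]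
    exact ih _ (by simpa using hN) (by simpa [or_comm] using hv)

lemma rv_b (s : ℕ) (n : ℕ) (r : R × R) :
    F.rv (s + 1) (List.replicate n (false, true, false)) r =
      (r.1 * wprod F.mon (s + 1) true (List.replicate n (false, true, false)),
        r.2 * wprod F.mon s false (List.replicate n (true, true, false))) := by
  induction n generalizing s r with
  | zero => simp [rv_nil, wprod]
  | succ n ih =>
    rw [List.replicate_succ, rv_cons, ih, List.replicate_succ]
    simp [wprod, act_apply, quad, SymplecticRank.step, mon, md, mul_assoc]

/-- The product along the quiet run `b ⋯ b`. -/
theorem Per.wprod_b_mem (ht : 0 < t) (h : F.Per t)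
    (hS : ∀ N, N.length = t → (∃ v ∈ N, rankOne v = true) → F.tr 0 N ∈ S)
    (hb : F.tr 0 (List.replicate t (false, true, false)) ∈ S) :
    wprod F.mon 0 true (List.replicate t (false, true, false)) ∈ S := by
  have h1 : F.tr (t - 1 + 1) (List.replicate t (false, true, false)) =
      wprod F.mon (t - 1 + 1) true (List.replicate t (false, true, false)) +
        wprod F.mon (t - 1) false (List.replicate t (true, true, false)) := by
    have := F.rv_b (t - 1) t
    simp only [rv] at this
    simp [tr, trc, this]
  have e : t - 1 + 1 = 0 + t := by omega
  rw [e, h.tr_add, wprod_per _ t h.mon] at h1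
  have h2 : wprod F.mon (t - 1) false (List.replicate t (true, true, false)) ∈ S := by
    refine h.wprod_mem (h.tr_mem_of_rankOne_all hS) _ (by simp) ?_ ⟨(true, true, false), ?_, rfl⟩
    · clear * -
      induction t with
      | zero => rfl
      | succ n ih => rw [List.replicate_succ, run_cons]; exact ih
    · simpa using ht.ne'
  rw [h1] at hb
  exact (Submodule.add_mem_iff_left _ h2).1 hb

end Frob

end SymplecticRank

namespace SymplecticRank

/-! ### Triangular families -/

lemma linearIndependent_of_triangular {ι K V : Type*} [Field K] [AddCommGroup V] [Module K V]
    (f : ι → V) (φ : ι → V →ₗ[K] K) (wt : ι → ℕ) (h : ∀ i, φ i (f i) ≠ 0)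
    (h' : ∀ i j, i ≠ j → φ i (f j) ≠ 0 → wt i < wt j) : LinearIndependent K f := by
  rw [linearIndependent_iff']
  intro s g hg
  by_contra! hne
  obtain ⟨i, hi, hmax⟩ := (s.filter fun i => g i ≠ 0).exists_max_image wt
    (by obtain ⟨i, hi, h0⟩ := hne; exact ⟨i, by simp [hi, h0]⟩)
  rw [Finset.mem_filter] at hi
  have h1 := congrArg (φ i) hg
  rw [map_sum, map_zero, Finset.sum_eq_single_of_mem i hi.1] at h1
  · rw [map_smul, smul_eq_mul] at h1
    exact mul_ne_zero hi.2 (h i) h1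
  · intro j hj hji
    rw [map_smul, smul_eq_mul]
    by_contra hn
    have h2 := h' i j hji.symm (right_ne_zero_of_mul hn)
    exact absurd (hmax j (by simp [hj, left_ne_zero_of_mul hn])) (not_le.2 h2)

/-! ### Digit monomials in three variables -/

def triMono {R : Type*} [CommRing R] (N : List Ltr) (x y z : R) : R :=
  xmono (N.map (·.1)) x * xmono (N.map (·.2.1)) y * xmono (N.map (·.2.2)) z

def compl (v : Ltr) : Ltr := (!v.1, !v.2.1, !v.2.2)

def weight (N : List Ltr) : ℕ := (N.map fun v => v.1.toNat + v.2.1.toNat + v.2.2.toNat).sum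

lemma weight_le (N : List Ltr) : weight N ≤ 3 * N.length := by
  induction N with
  | nil => simp [weight]
  | cons v N ih =>
    have : v.1.toNat + v.2.1.toNat + v.2.2.toNat ≤ 3 := by
      have h1 := v.1.toNat_le
      have h2 := v.2.1.toNat_le
      have h3 := v.2.2.toNat_le
      omega
    simp only [weight, List.map_cons, List.sum_cons, List.length_cons] at ih ⊢
    omega

lemma eq_or_weight_lt {N M : List Ltr} (h : List.Forall₂ (· ≤ ·) N M) :
    N = M ∨ weight N < weight M := by
  induction h with
  | nil => exact .inl rfl
  | @cons u v N M huv _ ih =>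
    have key : ∀ u v : Ltr, u ≤ v → u = v ∨ u.1.toNat + u.2.1.toNat + u.2.2.toNat <
        v.1.toNat + v.2.1.toNat + v.2.2.toNat := by decide
    simp only [weight, List.map_cons, List.sum_cons] at ih ⊢
    obtain rfl | h1 := key u v huv <;> obtain rfl | h2 := ih
    · exact .inl rfl
    · exact .inr (by omega)
    · exact .inr (by omega)
    · exact .inr (by omega)

section Pairing

variable {K : Type*} [Field K] [Fintype K] {t : ℕ}

lemma sum_xmono_self (ht : 0 < t) (hK : Fintype.card K = 2 ^ t) (l : List Bool)
    (hl : l.length = t) : ∑ x : K, xmono (l.map (!·)) x * xmono l x = 1 := by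
  obtain ⟨b, hb⟩ := List.exists_mem_of_length_pos (hl.symm ▸ ht)
  have := sum_xmono_pair (K := K) ht hK (l.map fun b => (b, b)) (by simpa using hl)
    ⟨(b, b), List.mem_map_of_mem hb, by cases b <;> simp⟩
  simpa [Function.comp_def] using this

lemma forall₂_of_sum_xmono_ne (ht : 0 < t) (hK : Fintype.card K = 2 ^ t) (l m : List Bool)
    (hl : l.length = t) (hm : m.length = t)
    (h : ∑ x : K, xmono (l.map (!·)) x * xmono m x ≠ 0) : List.Forall₂ (· ≤ ·) l m := by
  rw [List.forall₂_iff_zip]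
  refine ⟨hl.trans hm.symm, fun {a b} hab => ?_⟩
  by_cases hz : ∃ p ∈ l.zip m, p ≠ (false, true)
  · have := sum_xmono_pair (K := K) ht hK (l.zip m) (by simp [hl, hm]) hz
    rw [List.map_snd_zip (by omega), show (fun p : Bool × Bool => !p.1) = (!·) ∘ Prod.fst from rfl,
      ← List.map_map, List.map_fst_zip (by omega)] at this
    rw [this] at h
    have h2 : ∀ p ∈ l.zip m, p.1 = p.2 := by
      by_contra hc
      exact h (if_neg hc)
    exact (h2 _ hab).le
  · push Not at hz
    cases hz _ hab
    decide

def pairing (N : List Ltr) : (K × K × K → K) →ₗ[K] K where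
  toFun f := ∑ p, triMono (N.map compl) p.1 p.2.1 p.2.2 * f p
  map_add' f g := by simp [mul_add, Finset.sum_add_distrib]
  map_smul' c f := by simp [Finset.mul_sum, mul_left_comm]

lemma pairing_apply (N : List Ltr) (f : K × K × K → K) :
    pairing N f = ∑ p, triMono (N.map compl) p.1 p.2.1 p.2.2 * f p := rfl

lemma pairing_triMono (N M : List Ltr) :
    pairing N (fun p : K × K × K => triMono M p.1 p.2.1 p.2.2) =
      (∑ x : K, xmono ((N.map (·.1)).map (!·)) x * xmono (M.map (·.1)) x) *
      (∑ x : K, xmono ((N.map (·.2.1)).map (!·)) x * xmono (M.map (·.2.1)) x) *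
      ∑ x : K, xmono ((N.map (·.2.2)).map (!·)) x * xmono (M.map (·.2.2)) x := by
  rw [pairing_apply, mul_assoc, Fintype.sum_prod_type, Finset.sum_mul]
  refine Finset.sum_congr rfl fun x _ => ?_
  rw [Fintype.sum_prod_type, Finset.sum_mul, Finset.mul_sum]
  refine Finset.sum_congr rfl fun y _ => ?_
  rw [Finset.mul_sum, Finset.mul_sum]
  refine Finset.sum_congr rfl fun z _ => ?_
  simp only [triMono, List.map_map, Function.comp_def, compl]
  ring

lemma pairing_self (ht : 0 < t) (hK : Fintype.card K = 2 ^ t) (N : List Ltr) (hN : N.length = t) :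
    pairing N (fun p : K × K × K => triMono N p.1 p.2.1 p.2.2) = 1 := by
  rw [pairing_triMono, sum_xmono_self ht hK _ (by simpa), sum_xmono_self ht hK _ (by simpa),
    sum_xmono_self ht hK _ (by simpa), one_mul, one_mul]

lemma forall₂_of_pairing_ne (ht : 0 < t) (hK : Fintype.card K = 2 ^ t) (N M : List Ltr)
    (hN : N.length = t) (hM : M.length = t)
    (h : pairing N (fun p : K × K × K => triMono M p.1 p.2.1 p.2.2) ≠ 0) :
    List.Forall₂ (· ≤ ·) N M := by
  rw [pairing_triMono] at h
  have h3 := forall₂_of_sum_xmono_ne ht hK _ _ (by simpa) (by simpa) (right_ne_zero_of_mul h)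
  have h2 := forall₂_of_sum_xmono_ne ht hK _ _ (by simpa) (by simpa)
    (right_ne_zero_of_mul (left_ne_zero_of_mul h))
  have h1 := forall₂_of_sum_xmono_ne ht hK _ _ (by simpa) (by simpa)
    (left_ne_zero_of_mul (left_ne_zero_of_mul h))
  rw [List.forall₂_map_left_iff, List.forall₂_map_right_iff] at h1 h2 h3
  clear h hN hM
  induction h1 with
  | nil => exact .nil
  | cons h1 _ ih =>
    cases h2 with
    | cons h2 h2' =>
      cases h3 with
      | cons h3 h3' => exact .cons ⟨h1, h2, h3⟩ (ih h3' h2')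

lemma card_words (n : ℕ) : (words n).card = 8 ^ n := by
  have := cnt_all (fun _ => true) n
  simpa [cnt] using this

/-- The digit monomials span all functions. -/
lemma span_triMono (ht : 0 < t) (hK : Fintype.card K = 2 ^ t) :
    span K (Set.range fun N : {N // N ∈ words t} =>
      fun p : K × K × K => triMono (N.1.map compl) p.1 p.2.1 p.2.2) = ⊤ := by
  have hlen : ∀ N : {N // N ∈ words t}, (N.1.map compl).length = t := fun N => by
    simpa using mem_words.1 N.2
  have hinj : Function.Injective compl := by decide
  refine LinearIndependent.span_eq_top_of_card_eq_finrank' (linearIndependent_of_triangular _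
    (fun N => pairing (N.1.map compl)) (fun N => weight (N.1.map compl)) (fun N => ?_)
    fun N M hNM h => ?_) ?_
  · rw [pairing_self ht hK _ (hlen N)]
    exact one_ne_zero
  · obtain h | h := eq_or_weight_lt (forall₂_of_pairing_ne ht hK _ _ (hlen N) (hlen M) h)
    · exact absurd (Subtype.ext (List.map_injective_iff.2 hinj h)) hNM
    · exact h
  · rw [Module.finrank_fintype_fun_eq_card, Fintype.card_coe, card_words, Fintype.card_prod,
      Fintype.card_prod, hK, show 8 = 2 * (2 * 2) by rfl, mul_pow, mul_pow]

end Pairing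

end SymplecticRank

namespace SymplecticRank

/-! ### The row space as a space of functions -/

namespace Frob

variable {R : Type*} [CommRing R] (F : Frob R)

lemma evl_quads (s : ℕ) (N : List Ltr) (x : R) : evl (F.quads s N) x =
    triMono (N.map compl) x (F.d s + F.a s * x) (F.b s + x * F.d s) := by
  induction N generalizing s x with
  | nil => simp [quads, evl, triMono, xmono]
  | cons v N ih =>
    have h1 : F.d (s + 1) + F.a (s + 1) * x ^ 2 = (F.d s + F.a s * x) ^ 2 := by
      rw [F.d_succ, F.a_succ]; linear_combination (-F.d s * F.a s * x) * F.two
    have h2 : F.b (s + 1) + x ^ 2 * F.d (s + 1) = (F.b s + x * F.d s) ^ 2 := by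
      rw [F.d_succ, F.b_succ]; linear_combination (-F.b s * F.d s * x) * F.two
    have hc : F.c s = F.d s ^ 2 + F.a s * F.b s := by rw [c, F.d_succ]
    have hv : evq (F.quad s v) x = (if (compl v).1 then x else 1) *
        (if (compl v).2.1 then F.d s + F.a s * x else 1) *
        (if (compl v).2.2 then F.b s + x * F.d s else 1) := by
      obtain ⟨_ | _, _ | _, _ | _⟩ := v <;> simp [evq, quad, compl, hc] <;> ring
    rw [quads, evl, ih, h1, h2, hv]
    simp only [triMono, List.map_cons, xmono]
    ring

end Frob

section Functions

variable {K : Type*} [Field K]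

lemma xmono_eval {X : Type*} (l : List Bool) (f : X → K) (p : X) :
    xmono l f p = xmono l (f p) := by
  induction l generalizing f with
  | nil => rfl
  | cons b l ih =>
    rw [xmono, xmono, Pi.mul_apply, ih]
    cases b <;> rfl

lemma triMono_eval {X : Type*} (N : List Ltr) (f g h : X → K) (p : X) :
    triMono N f g h p = triMono N (f p) (g p) (h p) := by
  simp [triMono, xmono_eval]

/-- Coordinates on the points opposite to `p0`. -/
def ptFrob (h : (2 : K) = 0) : Frob (K × K × K → K) where
  a s p := p.1 ^ 2 ^ s
  b s p := p.2.1 ^ 2 ^ s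
  d s p := p.2.2 ^ 2 ^ s
  two := funext fun _ => h
  a_succ s := by ext p; simp [pow_succ, pow_mul]
  b_succ s := by ext p; simp [pow_succ, pow_mul]
  d_succ s := by ext p; simp [pow_succ, pow_mul]

variable [Fintype K] {t : ℕ}

lemma ptFrob_per (hK : Fintype.card K = 2 ^ t) (h : (2 : K) = 0) : (ptFrob h).Per t := by
  have key : ∀ (x : K) s, x ^ 2 ^ (s + t) = x ^ 2 ^ s := fun x s => by
    rw [pow_add, mul_comm, pow_mul, ← hK, FiniteField.pow_card]
  exact fun s => ⟨funext fun p => key _ _, funext fun p => key _ _, funext fun p => key _ _⟩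

/-- Sum of a function of the lines over the lines through each point. -/
def lineSum : (K × K × K → K) →ₗ[K] (K × K × K → K) where
  toFun g p := ∑ w, g (w, p.2.2 + p.1 * w, p.2.1 + w * p.2.2)
  map_add' g h := by ext p; simp [Finset.sum_add_distrib]
  map_smul' c g := by ext p; simp [Finset.mul_sum]

lemma lineSum_apply (g : K × K × K → K) (p : K × K × K) :
    lineSum g p = ∑ w, g (w, p.2.2 + p.1 * w, p.2.1 + w * p.2.2) := rfl

def gen (N : List Ltr) : K × K × K → K :=
  lineSum fun p => triMono (N.map compl) p.1 p.2.1 p.2.2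

lemma gen_eq_tr (ht : 0 < t) (hK : Fintype.card K = 2 ^ t) (h : (2 : K) = 0) (N : List Ltr)
    (hN : N.length = t) (hv : ∃ v ∈ N, v ≠ (false, false, false)) :
    gen N = (ptFrob h).tr 0 N := by
  have hq : ∃ p ∈ (ptFrob h).quads 0 N, p.2.2.2 = 0 := by
    generalize 0 = s
    clear hN
    induction N generalizing s with
    | nil => simp at hv
    | cons u N ih =>
      obtain ⟨v, hv, hne⟩ := hv
      rw [Frob.quads]
      obtain rfl | hv := List.mem_cons.1 hv
      · refine ⟨_, List.mem_cons_self, ?_⟩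
        obtain ⟨_ | _, _ | _, _ | _⟩ := v <;> first | rfl | exact absurd rfl hne
      · obtain ⟨p, hp, h0⟩ := ih ⟨v, hv, hne⟩ (s + 1)
        exact ⟨p, List.mem_cons_of_mem _ hp, h0⟩
  rw [Frob.tr, ← sum_evl (K := K) ht hK _ (by rw [Frob.length_quads, hN]) hq]
  ext p
  rw [gen, lineSum_apply, Finset.sum_apply]
  refine Finset.sum_congr rfl fun w _ => ?_
  rw [Frob.evl_quads, triMono_eval]
  simp [ptFrob]

lemma range_lineSum (ht : 0 < t) (hK : Fintype.card K = 2 ^ t) :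
    LinearMap.range (lineSum (K := K)) = span K {f | ∃ N : List Ltr, N.length = t ∧ gen N = f} := by
  rw [LinearMap.range_eq_map, ← span_triMono ht hK, map_span, ← Set.range_comp]
  congr 1
  ext f
  constructor
  · rintro ⟨⟨N, hN⟩, rfl⟩
    exact ⟨N, mem_words.1 hN, rfl⟩
  · rintro ⟨N, hN, rfl⟩
    exact ⟨⟨N, mem_words.2 hN⟩, rfl⟩

theorem finrank_range_lineSum_le (ht : 0 < t) (hK : Fintype.card K = 2 ^ t) :
    finrank K (LinearMap.range (lineSum (K := K))) + 2 ^ (t + 1) ≤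
      closedCnt false false t + closedCnt true true t + 1 := by
  have := charP_two hK
  rw [range_lineSum ht hK]
  exact (ptFrob_per hK CharTwo.two_eq_zero).finrank_le ht _
    fun N hN hv => gen_eq_tr ht hK _ N hN hv

end Functions

end SymplecticRank

namespace SymplecticRank

/-! ### Functionals detecting the lower bound -/

open Frob (rankOne diagLtr)

section Lines

variable {R : Type*} [CommRing R]

def rootDigit (a b c : R) : Ltr → R
  | (false, false, false) => a
  | (true, false, false) => b
  | (false, true, false) => a * c
  | (false, false, true) => b * c
  | _ => 0

/-- Digit products whose sums along lines are digit monomials in the line coordinates. -/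
def rootMono : List Ltr → R → R → R → R
  | [], _, _, _ => 1
  | v :: M, a, b, c => rootDigit a b c v * rootMono M (a ^ 2) (b ^ 2) (c ^ 2)

def lineQuad (w e B : R) : Ltr → R × R × R × R
  | (false, false, false) => (0, 1, 0, 0)
  | (true, false, false) => (B, w, 0, 0)
  | (false, true, false) => (0, e, B, 0)
  | (false, false, true) => (B * e, B ^ 2 + w * e, w * B, 0)
  | _ => (0, 0, 0, 0)

def lineQuads : List Ltr → R → R → R → List (R × R × R × R)
  | [], _, _, _ => []
  | v :: M, w, e, B => lineQuad w e B v :: lineQuads M (w ^ 2) (e ^ 2) (B ^ 2)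

lemma length_lineQuads (M : List Ltr) (w e B : R) : (lineQuads M w e B).length = M.length := by
  induction M generalizing w e B with
  | nil => rfl
  | cons v M ih => rw [lineQuads, List.length_cons, ih, List.length_cons]

lemma evl_lineQuads (h2 : (2 : R) = 0) (M : List Ltr) (w e B x : R) :
    evl (lineQuads M w e B) x = rootMono M x (B + x * w) (e + x * B) := by
  induction M generalizing w e B x with
  | nil => rfl
  | cons v M ih =>
    have h3 : B ^ 2 + x ^ 2 * w ^ 2 = (B + x * w) ^ 2 := by
      linear_combination (-B * x * w) * h2
    have h4 : e ^ 2 + x ^ 2 * B ^ 2 = (e + x * B) ^ 2 := by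
      linear_combination (-e * x * B) * h2
    rw [lineQuads, evl, ih, rootMono, h3, h4]
    congr 1
    obtain ⟨_ | _, _ | _, _ | _⟩ := v <;> simp [evq, rootDigit, lineQuad] <;> ring

lemma lineQuads_top (M : List Ltr) (hM : M ≠ []) (w e B : R) :
    ∃ p ∈ lineQuads M w e B, p.2.2.2 = 0 := by
  obtain ⟨v, M, rfl⟩ := List.exists_cons_of_ne_nil hM
  refine ⟨_, List.mem_cons_self, ?_⟩
  obtain ⟨_ | _, _ | _, _ | _⟩ := v <;> rfl

lemma actList_lineQuads_fst (h2 : (2 : R) = 0) (M : List Ltr)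
    (hr : ∀ v ∈ M, rankOne v = false) (w e B x : R) :
    (actList (lineQuads M w e B) (x, 0)).1 = x * triMono M w e (B ^ 2 + w * e) := by
  induction M generalizing w e B x with
  | nil => simp [lineQuads, actList, triMono, xmono]
  | cons v M ih =>
    have hv := hr v (by simp)
    have h3 : (B ^ 2) ^ 2 + w ^ 2 * e ^ 2 = (B ^ 2 + w * e) ^ 2 := by
      linear_combination (-B ^ 2 * w * e) * h2
    have ih' := fun y => ih (fun v hv => hr v (by simp [hv])) (w ^ 2) (e ^ 2) (B ^ 2) y
    rw [h3] at ih'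
    obtain ⟨_ | _, _ | _, _ | _⟩ := v <;> first
      | exact absurd hv (by decide)
      | (simp only [lineQuads, lineQuad, actList, LinearMap.comp_apply, act_apply, mul_zero, zero_mul,
          add_zero, ih', triMono, List.map_cons, xmono]
         simp only [if_true, if_false, Bool.false_eq_true]
         ring)

lemma actList_lineQuads_snd_zero (M : List Ltr) (w e B : R) (r : R × R) (h : r.2 = 0) :
    (actList (lineQuads M w e B) r).2 = 0 := by
  induction M generalizing w e B r with
  | nil => exact h
  | cons v M ih =>
    rw [lineQuads, actList, LinearMap.comp_apply]
    refine ih _ _ _ _ ?_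
    rw [act_apply, h]
    obtain ⟨_ | _, _ | _, _ | _⟩ := v <;> simp [lineQuad]

lemma actList_lineQuads_snd (M : List Ltr) (hr : ∀ v ∈ M, rankOne v = false)
    (hd : ∃ v ∈ M, diagLtr v = false) (w e B : R) (r : R × R) :
    (actList (lineQuads M w e B) r).2 = 0 := by
  induction M generalizing w e B r with
  | nil => simp at hd
  | cons v M ih =>
    rw [lineQuads, actList, LinearMap.comp_apply]
    by_cases hv : diagLtr v = false
    · refine actList_lineQuads_snd_zero _ _ _ _ _ ?_
      have h1 := hr v (by simp)
      rw [act_apply]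
      obtain ⟨_ | _, _ | _, _ | _⟩ := v <;> first
        | exact absurd hv (by decide)
        | exact absurd h1 (by decide)
        | simp [lineQuad]
    · obtain ⟨u, hu, hud⟩ := hd
      obtain rfl | hu := List.mem_cons.1 hu
      · exact absurd hud hv
      · exact ih (fun v hv => hr v (by simp [hv])) ⟨u, hu, hud⟩ _ _ _ _

lemma trc_lineQuads (h2 : (2 : R) = 0) (M : List Ltr) (hr : ∀ v ∈ M, rankOne v = false)
    (hd : ∃ v ∈ M, diagLtr v = false) (w e B : R) :
    trc (lineQuads M w e B) = triMono M w e (B ^ 2 + w * e) := by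
  rw [trc, actList_lineQuads_fst h2 M hr, actList_lineQuads_snd M hr hd, one_mul, add_zero]

end Lines

section Functionals

variable {K : Type*} [Field K] [Fintype K] {t : ℕ}

def pointMono (t : ℕ) (M : List Ltr) (p : K × K × K) : K :=
  rootMono M (p.1 ^ 2 ^ (t - 1)) (p.2.1 ^ 2 ^ (t - 1)) ((p.2.2 ^ 2 + p.1 * p.2.1) ^ 2 ^ (t - 1))

/-- Sum of `pointMono` along the points of a line. -/
lemma sum_pointMono (ht : 0 < t) (hK : Fintype.card K = 2 ^ t) (M : List Ltr) (hM : M.length = t)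
    (hr : ∀ v ∈ M, rankOne v = false) (hd : ∃ v ∈ M, diagLtr v = false) (w e D : K) :
    ∑ x, pointMono t M (x, D + w * (e + x * w), e + x * w) = triMono M w e D := by
  have hc := charP_two hK
  have he : ExpChar K 2 := ExpChar.prime Nat.prime_two
  have h2 : (2 : K) = 0 := CharTwo.two_eq_zero
  have hroot : ∀ y : K, (y ^ 2) ^ 2 ^ (t - 1) = y := fun y => by
    rw [← pow_mul, ← pow_succ', Nat.sub_add_cancel ht, ← hK, FiniteField.pow_card]
  have hadd : ∀ y z : K, (y + z) ^ 2 ^ (t - 1) = y ^ 2 ^ (t - 1) + z ^ 2 ^ (t - 1) :=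
    fun y z => add_pow_expChar_pow y z 2 (t - 1)
  set B := (D + w * e) ^ 2 ^ (t - 1) with hB
  have hB2 : B ^ 2 = D + w * e := by rw [hB, pow_right_comm, hroot]
  have h := sum_evl_shift ht hK (lineQuads M w e B) (by rw [length_lineQuads, hM])
    (lineQuads_top M (by rintro rfl; simp at hM; omega) _ _ _) (t - 1)
  rw [trc_lineQuads h2 M hr hd, hB2] at h
  rw [show triMono M w e D = triMono M w e (D + w * e + w * e) by
    congr 1; linear_combination (-w * e) * h2, ← h]
  refine Finset.sum_congr rfl fun x _ => ?_
  rw [Algebra.algebraMap_self, RingHom.id_apply, evl_lineQuads h2, pointMono]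
  congr 1
  · rw [show D + w * (e + x * w) = D + w * e + x * w ^ 2 by ring, hadd, ← hB, mul_pow, hroot]
  · rw [show (e + x * w) ^ 2 + x * (D + w * (e + x * w)) = e ^ 2 + x * (D + w * e) by
      linear_combination (e * x * w + x ^ 2 * w ^ 2) * h2, hadd, hroot, mul_pow, ← hB]

def pointFun (t : ℕ) (M : List Ltr) : (K × K × K → K) →ₗ[K] K where
  toFun f := ∑ p, f p * pointMono t M p
  map_add' f g := by simp [add_mul, Finset.sum_add_distrib]
  map_smul' c f := by simp [Finset.mul_sum, mul_assoc]

/-- The flags of points and lines in their two sets of coordinates. -/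
def flagEquiv (hc : (2 : K) = 0) : (K × K × K) × K ≃ (K × K × K) × K where
  toFun f := ((f.2, f.1.2.2 + f.1.1 * f.2, f.1.2.1 + f.2 * f.1.2.2), f.1.1)
  invFun f := ((f.2, f.1.2.2 + f.1.1 * (f.1.2.1 + f.2 * f.1.1), f.1.2.1 + f.2 * f.1.1), f.1.1)
  left_inv f := by
    obtain ⟨⟨a, b, d⟩, w⟩ := f
    simp only [Prod.mk.injEq, true_and, and_true]
    constructor
    · linear_combination (w * d + a * w ^ 2) * hc
    · linear_combination (a * w) * hc
  right_inv f := by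
    obtain ⟨⟨w, e, D⟩, a⟩ := f
    simp only [Prod.mk.injEq, true_and, and_true]
    constructor
    · linear_combination (a * w) * hc
    · linear_combination (w * e + a * w ^ 2) * hc

lemma pointFun_lineSum (ht : 0 < t) (hK : Fintype.card K = 2 ^ t) (M : List Ltr)
    (hM : M.length = t) (hr : ∀ v ∈ M, rankOne v = false) (hd : ∃ v ∈ M, diagLtr v = false)
    (g : K × K × K → K) :
    pointFun t M (lineSum g) = ∑ l, g l * triMono M l.1 l.2.1 l.2.2 := by
  have hc := charP_two hK
  have h2 : (2 : K) = 0 := CharTwo.two_eq_zero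
  change ∑ p, lineSum g p * pointMono t M p = _
  have e : ∀ l : K × K × K, g l * triMono M l.1 l.2.1 l.2.2 = ∑ x, g l *
      pointMono t M (x, l.2.2 + l.1 * (l.2.1 + x * l.1), l.2.1 + x * l.1) := fun l => by
    rw [← Finset.mul_sum, sum_pointMono ht hK M hM hr hd]
  simp only [lineSum_apply, Finset.sum_mul, e]
  rw [← Fintype.sum_prod_type', ← Fintype.sum_prod_type']
  refine Fintype.sum_equiv (flagEquiv h2) _ _ fun f => ?_
  obtain ⟨⟨a, b, d⟩, w⟩ := f
  change g (w, d + a * w, b + w * d) * pointMono t M (a, b, d) = g (w, d + a * w, b + w * d) *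
    pointMono t M (a, b + w * d + w * (d + a * w + a * w), d + a * w + a * w)
  congr 3
  · congr 1
    · linear_combination (-w * d - a * w ^ 2) * h2
    · linear_combination (-a * w) * h2

lemma pointFun_gen (ht : 0 < t) (hK : Fintype.card K = 2 ^ t) (M : List Ltr)
    (hM : M.length = t) (hr : ∀ v ∈ M, rankOne v = false) (hd : ∃ v ∈ M, diagLtr v = false)
    (N : List Ltr) : pointFun t M (gen (K := K) N) =
      pairing N fun p : K × K × K => triMono M p.1 p.2.1 p.2.2 := by
  rw [gen, pointFun_lineSum ht hK M hM hr hd, pairing_apply]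

lemma coord_bijective (hK : Fintype.card K = 2 ^ t) :
    Function.Bijective fun p : K × K × K => (p.1, p.2.1, p.2.2 ^ 2 + p.1 * p.2.1) := by
  have hc := charP_two hK
  have he : ExpChar K 2 := ExpChar.prime Nat.prime_two
  rw [← Finite.injective_iff_bijective]
  rintro ⟨a, b, d⟩ ⟨a', b', d'⟩ h
  simp only [Prod.mk.injEq] at h
  obtain ⟨rfl, rfl, h⟩ := h
  have : d ^ 2 = d' ^ 2 := add_right_cancel h
  rw [frobenius_inj K 2 this]

def coordEquiv (hK : Fintype.card K = 2 ^ t) : K × K × K ≃ K × K × K :=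
  Equiv.ofBijective _ (coord_bijective hK)

/-- Pairing with a digit monomial in the coordinates `a`, `b`, `c`. -/
def coordFun (hK : Fintype.card K = 2 ^ t) (N : List Ltr) : (K × K × K → K) →ₗ[K] K :=
  pairing N ∘ₗ LinearMap.funLeft K K (coordEquiv hK).symm

lemma coordFun_triMono (hK : Fintype.card K = 2 ^ t) (h : (2 : K) = 0) (N M : List Ltr) :
    coordFun hK N (triMono M ((ptFrob h).a 0) ((ptFrob h).b 0) ((ptFrob h).c 0)) =
      pairing N fun p : K × K × K => triMono M p.1 p.2.1 p.2.2 := by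
  rw [coordFun, LinearMap.comp_apply]
  congr 1
  ext p
  obtain ⟨q, rfl⟩ := (coordEquiv hK).surjective p
  rw [LinearMap.funLeft_apply, Equiv.symm_apply_apply, triMono_eval]
  simp [coordEquiv, ptFrob, Frob.c]

end Functionals

end SymplecticRank

namespace SymplecticRank

open Frob (rankOne diagLtr)

/-! ### The lower bound -/

section Leading

variable {R : Type*} [CommRing R] (F : Frob R)

lemma triMono_cons (v : Ltr) (w : List Ltr) (s : ℕ) :
    triMono (v :: w) (F.a s) (F.b s) (F.c s) =
      F.md s v * triMono w (F.a (s + 1)) (F.b (s + 1)) (F.c (s + 1)) := by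
  rw [F.a_succ, F.b_succ, F.c_succ]
  simp only [triMono, List.map_cons, xmono, Frob.md]
  ring

variable (K : Type*) [Field K] [Algebra K R]

def lowerSpan (s n m : ℕ) : Submodule K R :=
  span K {f | ∃ u : List Ltr, u.length = n ∧ weight u < m ∧ triMono u (F.a s) (F.b s) (F.c s) = f}

lemma md_mul_mem_lowerSpan {s n m : ℕ} (v : Ltr) {f : R} (hf : f ∈ lowerSpan F K (s + 1) n m) :
    F.md s v * f ∈ lowerSpan F K s (n + 1) (m + weight [v]) := by
  have : lowerSpan F K (s + 1) n m ≤ (lowerSpan F K s (n + 1) (m + weight [v])).comap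
      (LinearMap.mulLeft K (F.md s v)) := by
    rw [lowerSpan, span_le]
    rintro _ ⟨u, hu, hw, rfl⟩
    refine subset_span ⟨v :: u, by simp [hu], ?_, triMono_cons F v u s⟩
    simp only [weight, List.map_cons, List.sum_cons, List.map_nil, List.sum_nil] at hw ⊢
    omega
  exact this hf

lemma wprod_mon_sub_mem (s : ℕ) (x y : Bool) (w : List Ltr) (h : run x w = some y) :
    wprod F.mon s x w - triMono w (F.a s) (F.b s) (F.c s) ∈
      lowerSpan F K s w.length (weight w) := by
  induction w generalizing s x with
  | nil => simp [wprod, triMono, xmono]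
  | cons v w ih =>
    rw [run_cons] at h
    cases hs : step x v with
    | none => simp [hs] at h
    | some z =>
      rw [hs, Option.bind_some] at h
      have ih' := ih (s + 1) z h
      have hw : weight (v :: w) = weight w + weight [v] := by
        simp [weight, add_comm]
      have hmain := md_mul_mem_lowerSpan F K v ih'
      rw [mul_sub, ← triMono_cons, ← hw] at hmain
      rw [wprod, hs]
      by_cases hsp : x = false ∧ v = (true, true, false)
      · obtain ⟨rfl, rfl⟩ := hsp
        have hd : F.mon s false (true, true, false) =
            F.md s (true, true, false) + F.md s (false, false, true) := by
          simp only [Frob.mon, Frob.md, Frob.c, if_true, Bool.false_eq_true, if_false]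
          linear_combination (-F.a s * F.b s) * F.two
        have h2 := md_mul_mem_lowerSpan F K (s := s) (false, false, true) ih'
        have h3 : triMono ((false, false, true) :: w) (F.a s) (F.b s) (F.c s) ∈
            lowerSpan F K s (w.length + 1) (weight ((true, true, false) :: w)) :=
          subset_span ⟨_, rfl, by simp [weight], rfl⟩
        have h4 : lowerSpan F K s (w.length + 1) (weight w + weight [(false, false, true)]) ≤
            lowerSpan F K s (w.length + 1) (weight ((true, true, false) :: w)) := by
          refine span_mono ?_
          rintro _ ⟨u, hu, hlt, rfl⟩
          refine ⟨u, hu, hlt.trans_le ?_, rfl⟩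
          simp only [weight, List.map_cons, List.sum_cons, List.map_nil, List.sum_nil,
            Bool.toNat_true, Bool.toNat_false]
          omega
        have h5 := add_mem (add_mem hmain (h4 h2)) h3
        rw [List.length_cons]
        convert h5 using 1
        rw [hd, triMono_cons F (false, false, true)]
        ring
      · have : F.mon s x v = F.md s v := by
          cases x
          · obtain ⟨_ | _, _ | _, _ | _⟩ := v <;> first | rfl | exact absurd ⟨rfl, rfl⟩ hsp
          · exact F.mon_true s v
        rw [this]
        exact hmain

end Leading

lemma exists_eq_false {p : Ltr → Bool} {w : List Ltr} (h : ¬ ∀ v ∈ w, p v = true) :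
    ∃ v ∈ w, p v = false := by
  push Not at h
  exact h.imp fun v hv => ⟨hv.1, Bool.eq_false_of_not_eq_true hv.2⟩

lemma run_of_quiet (x : Bool) (w : List Ltr) (h : ∀ v ∈ w, quiet x v = true) :
    run x w = some x := by
  induction w with
  | nil => rfl
  | cons v w ih =>
    have hs : ∀ x v, quiet x v = true → step x v = some x := by decide
    rw [run_cons, hs x v (h v (by simp)), Option.bind_some, ih fun v hv => h v (by simp [hv])]

lemma quiet_of_run (w : List Ltr) (h0 : run false w = some false) (h1 : run true w = some true) :
    ∀ v ∈ w, quiet false v = true := by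
  induction w with
  | nil => simp
  | cons v w ih =>
    rw [run_cons] at h0 h1
    obtain ⟨y, hy, h0⟩ := Option.bind_eq_some_iff.1 h0
    obtain ⟨z, hz, h1⟩ := Option.bind_eq_some_iff.1 h1
    have hs : ∀ v y z, step false v = some y → step true v = some z →
        y = z ∨ (y = false ∧ z = true ∧ quiet false v = true) := by decide
    obtain rfl | ⟨rfl, rfl, hq⟩ := hs v y z hy hz
    · simp [h0] at h1
    · simpa [hq] using ih h0 h1

section Lower

variable {K : Type*} [Field K] [Fintype K] {t : ℕ}

lemma coordFun_wprod (ht : 0 < t) (hK : Fintype.card K = 2 ^ t) (h : (2 : K) = 0)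
    {N w : List Ltr} (hN : N.length = t) (hw : w.length = t) {x y : Bool} (hr : run x w = some y)
    (hwt : weight w ≤ weight N) : coordFun hK N (wprod (ptFrob h).mon 0 x w) =
      pairing N fun p : K × K × K => triMono w p.1 p.2.1 p.2.2 := by
  rw [← coordFun_triMono hK h, ← sub_eq_zero, ← map_sub]
  have hle : lowerSpan (ptFrob h) K 0 w.length (weight w) ≤ LinearMap.ker (coordFun hK N) := by
    rw [lowerSpan, span_le]
    rintro _ ⟨u, hu, hlt, rfl⟩
    rw [SetLike.mem_coe, LinearMap.mem_ker, coordFun_triMono]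
    by_contra hne
    obtain rfl | h1 := eq_or_weight_lt
      (forall₂_of_pairing_ne ht hK N u hN (hu.trans hw) hne) <;> omega
  exact hle (wprod_mon_sub_mem (ptFrob h) K 0 x y w hr)

/-- Span of the generators that every `pointFun` with rank-two letters annihilates. -/
def rankOneSpan (K : Type*) [Field K] [Fintype K] (t : ℕ) : Submodule K (K × K × K → K) :=
  span K {f | ∃ N : List Ltr, N.length = t ∧ ((∃ v ∈ N, rankOne v = true) ∨
    N = List.replicate t (false, true, false)) ∧ gen N = f}

lemma rankOneSpan_le : rankOneSpan K t ≤ LinearMap.range (lineSum (K := K)) := by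
  rw [rankOneSpan, span_le]
  rintro _ ⟨N, -, -, rfl⟩
  exact ⟨_, rfl⟩

lemma pointFun_rankOneSpan (ht : 0 < t) (hK : Fintype.card K = 2 ^ t) (M : List Ltr)
    (hM : M.length = t) (hr : ∀ v ∈ M, rankOne v = false) (hd : ∃ v ∈ M, diagLtr v = false)
    {f : K × K × K → K} (hf : f ∈ rankOneSpan K t) : pointFun t M f = 0 := by
  have hle : rankOneSpan K t ≤ LinearMap.ker (pointFun t M) := by
    rw [rankOneSpan, span_le]
    rintro _ ⟨N, hN, hc, rfl⟩
    rw [SetLike.mem_coe, LinearMap.mem_ker, pointFun_gen ht hK M hM hr hd]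
    by_contra hne
    have hle := forall₂_of_pairing_ne ht hK N M hN hM hne
    clear hne
    obtain ⟨v, hv, h1⟩ | rfl := hc
    · clear hN hM hd
      have key : ∀ u v : Ltr, u ≤ v → rankOne u = true → rankOne v = true := by decide
      induction hle with
      | nil => simp at hv
      | @cons u u' N M huv _ ih =>
        obtain rfl | hv := List.mem_cons.1 hv
        · have := key _ _ huv h1
          simp [hr u' (by simp)] at this
        · exact ih (fun v hv => hr v (by simp [hv])) hv
    · have key : ∀ v : Ltr, (false, true, false) ≤ v → rankOne v = false → diagLtr v = true := by
        decide
      obtain ⟨v, hv, h1⟩ := hd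
      obtain ⟨i, hi, rfl⟩ := List.getElem_of_mem hv
      have h2 := hle.get (i := i) (by simpa [hM] using hi) hi
      simp only [List.get_eq_getElem, List.getElem_replicate] at h2
      rw [key _ h2 (hr _ hv)] at h1
      cases h1
  exact hle hf

/-- Closed words indexing the part of the row space spanned by rank-one generators. -/
def closedWord (t : ℕ) (w : List Ltr) : Prop :=
  (run false w = some false ∧ ¬ ∀ v ∈ w, quiet false v = true) ∨
    (run true w = some true ∧ ¬ ∀ v ∈ w, quiet true v = true) ∨
    w = List.replicate t (false, true, false)

def initial (w : List Ltr) : Bool :=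
  if run false w = some false ∧ ¬ ∀ v ∈ w, quiet false v = true then false else true

lemma run_initial {w : List Ltr} (h : closedWord t w) : run (initial w) w = some (initial w) := by
  rw [initial]
  split_ifs with h0
  · exact h0.1
  · obtain h | h | rfl := h
    · exact absurd h h0
    · exact h.1
    · exact run_of_quiet _ _ fun v hv => by rw [List.eq_of_mem_replicate hv]; rfl

lemma wprod_initial_mem (ht : 0 < t) (hK : Fintype.card K = 2 ^ t) (h : (2 : K) = 0) {w : List Ltr}
    (hw : w.length = t) (hc : closedWord t w) :
    wprod (ptFrob h).mon 0 (initial w) w ∈ rankOneSpan K t := by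
  have hS : ∀ N, N.length = t → (∃ v ∈ N, rankOne v = true) →
      (ptFrob h).tr 0 N ∈ rankOneSpan K t := fun N hN hv => by
    refine subset_span ⟨N, hN, .inl hv, gen_eq_tr ht hK h N hN ?_⟩
    obtain ⟨v, hv, h1⟩ := hv
    exact ⟨v, hv, by rintro rfl; cases h1⟩
  have hper := ptFrob_per hK h
  have hrun := run_initial hc
  by_cases hq : ∃ v ∈ w, quiet (initial w) v = false
  · exact hper.wprod_mem (hper.tr_mem_of_rankOne_all hS) 0 hw hrun hq
  · rw [initial] at hq ⊢
    split_ifs at hq ⊢ with h0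
    · exact absurd (exists_eq_false h0.2) hq
    · obtain hc | hc | rfl := hc
      · exact absurd hc h0
      · exact absurd (exists_eq_false hc.2) hq
      · refine hper.wprod_b_mem ht hS (subset_span ⟨_, by simp, .inr rfl, ?_⟩)
        exact gen_eq_tr ht hK h _ (by simp) ⟨_, List.mem_replicate.2 ⟨by omega, rfl⟩, by decide⟩

lemma card_le_finrank (ht : 0 < t) (hK : Fintype.card K = 2 ^ t) :
    cnt (fun w => (∀ v ∈ w, (!rankOne v) = true) ∧ ¬ ∀ v ∈ w, diagLtr v = true) t +
      cnt (closedWord t) t ≤ finrank K (LinearMap.range (lineSum (K := K))) := by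
  have hc := charP_two hK
  have h2 : (2 : K) = 0 := CharTwo.two_eq_zero
  set A := (words t).filter fun w =>
    (∀ v ∈ w, (!rankOne v) = true) ∧ ¬ ∀ v ∈ w, diagLtr v = true with hA
  set J := (words t).filter (closedWord t) with hJ
  have hAm : ∀ M : A, M.1.length = t ∧ (∀ v ∈ M.1, rankOne v = false) ∧
      ∃ v ∈ M.1, diagLtr v = false := fun M => by
    obtain ⟨h1, h2, h3⟩ := Finset.mem_filter.1 M.2
    exact ⟨mem_words.1 h1, by simpa using h2, exists_eq_false h3⟩
  have hJm : ∀ w : J, w.1.length = t ∧ closedWord t w.1 := fun w => by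
    obtain ⟨h1, h2⟩ := Finset.mem_filter.1 w.2
    exact ⟨mem_words.1 h1, h2⟩
  let f : A ⊕ J → (K × K × K → K) := Sum.elim (fun M => gen M.1)
    fun w => wprod (ptFrob h2).mon 0 (initial w.1) w.1
  have hf : ∀ i, f i ∈ LinearMap.range (lineSum (K := K)) := by
    rintro (M | w)
    · exact ⟨_, rfl⟩
    · exact rankOneSpan_le (wprod_initial_mem ht hK h2 (hJm w).1 (hJm w).2)
  have hli : LinearIndependent K f := by
    refine linearIndependent_of_triangular f
      (Sum.elim (fun M => pointFun t M.1) fun w => coordFun hK w.1)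
      (Sum.elim (fun M => 3 * t + 1 + (3 * t - weight M.1)) fun w => weight w.1) ?_ ?_
    · rintro (M | w)
      · change pointFun t M.1 (gen M.1) ≠ 0
        rw [pointFun_gen ht hK _ (hAm M).1 (hAm M).2.1 (hAm M).2.2, pairing_self ht hK _ (hAm M).1]
        exact one_ne_zero
      · change coordFun hK w.1 (wprod _ 0 _ w.1) ≠ 0
        rw [coordFun_wprod ht hK h2 (hJm w).1 (hJm w).1 (run_initial (hJm w).2) le_rfl,
          pairing_self ht hK _ (hJm w).1]
        exact one_ne_zero
    · rintro (M | w) (N | u) hne h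
      · change pointFun t M.1 (gen N.1) ≠ 0 at h
        rw [pointFun_gen ht hK _ (hAm M).1 (hAm M).2.1 (hAm M).2.2] at h
        have h1 := weight_le M.1
        rw [(hAm M).1] at h1
        obtain he | h3 := eq_or_weight_lt
          (forall₂_of_pairing_ne ht hK _ _ (hAm N).1 (hAm M).1 h)
        · exact absurd (congrArg Sum.inl (Subtype.ext he.symm)) hne
        · simp only [Sum.elim_inl]
          omega
      · exact absurd (pointFun_rankOneSpan ht hK _ (hAm M).1 (hAm M).2.1 (hAm M).2.2
          (wprod_initial_mem ht hK h2 (hJm u).1 (hJm u).2)) h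
      · have h1 := weight_le w.1
        rw [(hJm w).1] at h1
        simp only [Sum.elim_inl, Sum.elim_inr]
        omega
      · change coordFun hK w.1 (wprod _ 0 _ u.1) ≠ 0 at h
        simp only [Sum.elim_inr]
        by_contra hlt
        rw [coordFun_wprod ht hK h2 (hJm w).1 (hJm u).1 (run_initial (hJm u).2) (not_lt.1 hlt)] at h
        obtain he | h3 := eq_or_weight_lt
          (forall₂_of_pairing_ne ht hK _ _ (hJm w).1 (hJm u).1 h)
        · exact absurd (congrArg Sum.inr (Subtype.ext he)) hne
        · exact hlt h3
  have hli' : LinearIndependent K fun i => (⟨f i, hf i⟩ : LinearMap.range (lineSum (K := K))) :=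
    LinearIndependent.of_comp (LinearMap.range (lineSum (K := K))).subtype hli
  have hcard := hli'.fintype_card_le_finrank
  rw [Fintype.card_sum, Fintype.card_coe, Fintype.card_coe] at hcard
  refine le_trans (le_of_eq ?_) hcard
  rw [hA, hJ, cnt, cnt]
  congr

lemma cnt_closedWord (t : ℕ) :
    cnt (closedWord t) t + 4 ^ t + 2 ^ t = closedCnt false false t + closedCnt true true t + 1 := by
  have h0 := cnt_sub (fun w => run false w = some false) (fun w => ∀ v ∈ w, quiet false v = true) t
    fun w _ => run_of_quiet false w
  have h1 := cnt_sub (fun w => run true w = some true) (fun w => ∀ v ∈ w, quiet true v = true) t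
    fun w _ => run_of_quiet true w
  rw [cnt_all, show (Finset.univ.filter fun v => quiet false v = true).card = 4 by decide] at h0
  rw [cnt_all, show (Finset.univ.filter fun v => quiet true v = true).card = 2 by decide] at h1
  have h2 := cnt_sub (closedWord t)
    (fun w => run false w = some false ∧ ¬ ∀ v ∈ w, quiet false v = true) t fun w _ h => .inl h
  have hb : ∀ x, ∀ v ∈ List.replicate t (false, true, false), quiet x v = true := fun x v hv => by
    rw [List.eq_of_mem_replicate hv]; cases x <;> rfl
  have h3 := cnt_sub (fun w => closedWord t w ∧
      ¬ (run false w = some false ∧ ¬ ∀ v ∈ w, quiet false v = true))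
    (fun w => run true w = some true ∧ ¬ ∀ v ∈ w, quiet true v = true) t
    fun w _ h => ⟨.inr (.inl h), fun h' => h'.2 (quiet_of_run w h'.1 h.1)⟩
  have h4 : cnt (fun w => (closedWord t w ∧
      ¬ (run false w = some false ∧ ¬ ∀ v ∈ w, quiet false v = true)) ∧
      ¬ (run true w = some true ∧ ¬ ∀ v ∈ w, quiet true v = true)) t = 1 := by
    rw [cnt, Finset.card_eq_one]
    refine ⟨List.replicate t (false, true, false), ?_⟩
    ext w
    simp only [Finset.mem_filter, mem_words, Finset.mem_singleton]
    constructor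
    · rintro ⟨-, ⟨h | h | h, h'⟩, h''⟩
      · exact absurd h h'
      · exact absurd h h''
      · exact h
    · rintro rfl
      exact ⟨by simp, ⟨.inr (.inr rfl), fun h => h.2 (hb _)⟩, fun h => h.2 (hb _)⟩
  rw [closedCnt, closedCnt]
  omega

theorem finrank_range_lineSum (ht : 0 < t) (hK : Fintype.card K = 2 ^ t) :
    finrank K (LinearMap.range (lineSum (K := K))) + 2 ^ (t + 1) =
      closedCnt false false t + closedCnt true true t + 1 := by
  refine le_antisymm (finrank_range_lineSum_le ht hK) ?_
  have h1 := card_le_finrank ht hK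
  have h2 := cnt_closedWord t
  have h4 := cnt_sub (fun w => ∀ v ∈ w, (!rankOne v) = true) (fun w => ∀ v ∈ w, diagLtr v = true) t
    fun w _ hw v hv => Frob.diagLtr_not_rankOne v (hw v hv)
  rw [cnt_all, cnt_all, show (Finset.univ.filter fun v => diagLtr v = true).card = 2 by decide,
    show (Finset.univ.filter fun v => (!rankOne v) = true).card = 4 by decide] at h4
  rw [pow_succ]
  omega

end Lower

end SymplecticRank

namespace SymplecticRank

/-! ### The incidence matrix in coordinates -/

lemma rank_map_of_square {m F E : Type*} [Fintype m] [Field F] [Field E] (f : F →+* E)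
    (M : Matrix m m F) : (M.map f).rank = M.rank := by
  obtain ⟨V, U, e, hV, hU, h⟩ := M.exists_rank_normal_form
  have hVf : IsUnit (V.map f) := hV.map f.mapMatrix
  have hUf : IsUnit (U.map f) := hU.map f.mapMatrix
  have h' := congrArg (fun A : Matrix m m F => A.map f) h
  simp only [Matrix.map_mul] at h'
  rw [← Matrix.rank_mul_eq_right_of_isUnit_det _ (M.map f) ((Matrix.isUnit_iff_isUnit_det _).1 hVf),
    ← Matrix.rank_mul_eq_left_of_isUnit_det _ (V.map f * M.map f)
      ((Matrix.isUnit_iff_isUnit_det _).1 hUf), h', ← Matrix.submatrix_map, Matrix.rank_submatrix,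
    Matrix.fromBlocks_map, Matrix.map_one f f.map_zero f.map_one, Matrix.map_zero _ f.map_zero,
    Matrix.map_zero _ f.map_zero, Matrix.map_zero _ f.map_zero, ← Matrix.diagonal_one,
    ← Matrix.diagonal_zero, Matrix.fromBlocks_diagonal, Matrix.rank_diagonal,
    Fintype.card_subtype]
  trans (Finset.univ : Finset (Fin M.rank)).card
  · refine Eq.trans ?_ (Finset.card_map
      (Function.Embedding.inl (β := Fin (Fintype.card m - M.rank))))
    refine congrArg Finset.card (Finset.ext fun i => ?_)
    rcases i with i | i <;> simp
  · simp

section Coordinates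

variable {k}

/-- Incidence of points and lines in coordinates. -/
def coordMatrix (k : Type) [Field k] [Fintype k] :
    Matrix (k × k × k) (k × k × k) (ZMod 2) := fun p l =>
  if l.2.1 = p.2.2 + p.1 * l.1 ∧ l.2.2 = p.2.1 + l.1 * p.2.2 then 1 else 0

lemma rank_coordMatrix (f : ZMod 2 →+* k) :
    (coordMatrix k).rank = finrank k (LinearMap.range (lineSum (K := k))) := by
  rw [← rank_map_of_square f, Matrix.rank]
  suffices h : ((coordMatrix k).map f).mulVecLin = lineSum by rw [h]
  refine LinearMap.ext fun g => funext fun p => ?_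
  rw [Matrix.mulVecLin_apply, lineSum_apply, Matrix.mulVec, dotProduct, Fintype.sum_prod_type]
  refine Finset.sum_congr rfl fun w _ => ?_
  rw [Finset.sum_eq_single (p.2.2 + p.1 * w, p.2.1 + w * p.2.2)]
  · simp [coordMatrix]
  · rintro ⟨x, y⟩ - hne
    rw [Matrix.map_apply, coordMatrix, if_neg fun h => hne (Prod.ext h.1 h.2), map_zero, zero_mul]
  · simp

def ptVec (p : k × k × k) : Fin 4 → k := ![p.2.2 ^ 2 + p.1 * p.2.1, p.2.1, p.1, 1]

def lnVec₁ (l : k × k × k) : Fin 4 → k := ![l.2.2 + l.1 * l.2.1, l.1 ^ 2, 1, 0]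

def lnVec₂ (l : k × k × k) : Fin 4 → k := ![l.2.1 ^ 2, l.2.2 + l.1 * l.2.1, 0, 1]

lemma mem_span_lnVec {K : Type} [Field K] (l : K × K × K) (v : Fin 4 → K) : v ∈ span K {lnVec₁ l, lnVec₂ l} ↔
    v 0 = v 2 * (l.2.2 + l.1 * l.2.1) + v 3 * l.2.1 ^ 2 ∧
      v 1 = v 2 * l.1 ^ 2 + v 3 * (l.2.2 + l.1 * l.2.1) := by
  rw [mem_span_pair]
  constructor
  · rintro ⟨x, y, rfl⟩
    simp [lnVec₁, lnVec₂]
  · rintro ⟨h0, h1⟩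
    refine ⟨v 2, v 3, funext fun i => ?_⟩
    fin_cases i <;> simp [lnVec₁, lnVec₂, h0, h1]

lemma mem_l0_iff {K : Type} [Field K] (v : Fin 4 → K) : v ∈ l0 K ↔ v 2 = 0 ∧ v 3 = 0 := by
  rw [l0, mem_span_pair]
  constructor
  · rintro ⟨x, y, rfl⟩
    simp [e]
  · rintro ⟨h2, h3⟩
    refine ⟨v 0, v 1, funext fun i => ?_⟩
    fin_cases i <;> simp [e, h2, h3]

lemma ptVec_ne_zero {K : Type} [Field K] (p : K × K × K) : ptVec p ≠ 0 := fun h => by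
  simpa [ptVec] using congrFun h 3

def ptMap (p : k × k × k) : {p : Pt k // InP1 k p} :=
  ⟨⟨span k {ptVec p}, finrank_span_singleton (ptVec_ne_zero p)⟩,
    ⟨ptVec p, mem_span_singleton_self _, by simp [B, e, ptVec]⟩⟩

lemma ptMap_bijective {t : ℕ} (hK : Fintype.card k = 2 ^ t) :
    Function.Bijective (ptMap (k := k)) := by
  have hcoord := coord_bijective hK
  constructor
  · intro p p' h
    have hs : span k {ptVec p} = span k {ptVec p'} := congrArg (fun x => (x.1.1)) h
    obtain ⟨x, hx⟩ := mem_span_singleton.1 (hs ▸ mem_span_singleton_self (ptVec p))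
    have h3 : x = 1 := by simpa [ptVec] using congrFun hx 3
    rw [h3, one_smul] at hx
    refine hcoord.1 (Prod.ext ?_ (Prod.ext ?_ ?_))
    · simpa [ptVec] using (congrFun hx 2).symm
    · simpa [ptVec] using (congrFun hx 1).symm
    · simpa [ptVec] using (congrFun hx 0).symm
  · rintro ⟨⟨p, hp⟩, v, hv, hne⟩
    have h3 : v 3 ≠ 0 := by simpa [B, e] using hne
    obtain ⟨x, hx⟩ := hcoord.2 ((v 3)⁻¹ * v 2, (v 3)⁻¹ * v 1, (v 3)⁻¹ * v 0)
    simp only [Prod.mk.injEq] at hx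
    have hxv : ptVec x = (v 3)⁻¹ • v := by
      rw [ptVec, hx.2.2, hx.2.1, hx.1]
      funext i
      fin_cases i <;> simp [inv_mul_cancel₀ h3]
    refine ⟨x, Subtype.ext (Subtype.ext ?_)⟩
    refine eq_of_le_of_finrank_eq ?_ ((finrank_span_singleton (ptVec_ne_zero x)).trans hp.symm)
    change span k {ptVec x} ≤ p
    rw [span_singleton_le_iff_mem, hxv]
    exact p.smul_mem _ hv

lemma span_lnVec_mem_L1 {K : Type} [Field K] (l : K × K × K) : span K {lnVec₁ l, lnVec₂ l} ∈ L1 K := by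
  refine ⟨⟨?_, ?_⟩, ?_⟩
  · have hli : LinearIndependent K ![lnVec₁ l, lnVec₂ l] := by
      rw [LinearIndependent.pair_iff]
      intro x y h
      exact ⟨by simpa [lnVec₁, lnVec₂] using congrFun h 2,
        by simpa [lnVec₁, lnVec₂] using congrFun h 3⟩
    have := finrank_span_eq_card hli
    rwa [Matrix.range_cons_cons_empty] at this
  · intro u hu v hv
    rw [mem_span_lnVec] at hu hv
    rw [B, hu.1, hu.2, hv.1, hv.2]
    ring
  · rw [eq_bot_iff]
    rintro v ⟨h1, h2⟩
    rw [SetLike.mem_coe, mem_span_lnVec] at h1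
    rw [SetLike.mem_coe, mem_l0_iff] at h2
    rw [mem_bot]
    funext i
    fin_cases i <;> simp [h1, h2]

def lnMap (l : k × k × k) : {l : Submodule k (Fin 4 → k) // l ∈ L1 k} :=
  ⟨span k {lnVec₁ l, lnVec₂ l}, span_lnVec_mem_L1 l⟩

lemma lnMap_bijective {t : ℕ} (hK : Fintype.card k = 2 ^ t) :
    Function.Bijective (lnMap (k := k)) := by
  have hc := charP_two hK
  have he : ExpChar k 2 := ExpChar.prime Nat.prime_two
  have hinj := frobenius_inj k 2
  have hsurj : Function.Surjective (frobenius k 2) := Finite.surjective_of_injective hinj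
  constructor
  · intro l l' h
    have hs : span k {lnVec₁ l, lnVec₂ l} = span k {lnVec₁ l', lnVec₂ l'} := congrArg (·.1) h
    have h1 : lnVec₁ l ∈ span k {lnVec₁ l', lnVec₂ l'} := hs ▸ subset_span (by simp)
    have h2 : lnVec₂ l ∈ span k {lnVec₁ l', lnVec₂ l'} := hs ▸ subset_span (by simp)
    rw [mem_span_lnVec] at h1 h2
    simp only [lnVec₁, lnVec₂, Matrix.cons_val, one_mul, zero_mul, add_zero, zero_add] at h1 h2
    obtain ⟨w, d, D⟩ := l
    obtain ⟨w', d', D'⟩ := l'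
    obtain rfl : w = w' := hinj h1.2
    obtain rfl : d = d' := hinj h2.1
    obtain rfl : D = D' := add_right_cancel h1.1
    rfl
  · rintro ⟨l, ⟨hf, hB⟩, hd⟩
    let π : l →ₗ[k] k × k :=
      ((LinearMap.proj 2).prod (LinearMap.proj 3) : (Fin 4 → k) →ₗ[k] k × k) ∘ₗ l.subtype
    have hzero : ∀ v ∈ l, v 2 = 0 → v 3 = 0 → v = 0 := fun v hv h2 h3 => by
      have : v ∈ l ⊓ l0 k := ⟨hv, (mem_l0_iff v).2 ⟨h2, h3⟩⟩
      rwa [hd, mem_bot] at this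
    have hπ : Function.Injective π := by
      rw [← LinearMap.ker_eq_bot, LinearMap.ker_eq_bot']
      rintro ⟨v, hv⟩ h
      exact Subtype.ext (hzero v hv (congrArg Prod.fst h) (congrArg Prod.snd h))
    have hπs : Function.Surjective π :=
      (LinearMap.injective_iff_surjective_of_finrank_eq_finrank (by simp [hf])).1 hπ
    obtain ⟨⟨u, hu⟩, hu'⟩ := hπs (1, 0)
    obtain ⟨⟨v, hv⟩, hv'⟩ := hπs (0, 1)
    have hu2 : u 2 = 1 := congrArg Prod.fst hu'
    have hu3 : u 3 = 0 := congrArg Prod.snd hu'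
    have hv2 : v 2 = 0 := congrArg Prod.fst hv'
    have hv3 : v 3 = 1 := congrArg Prod.snd hv'
    have huv : u 0 = v 1 := by
      have := hB u hu v hv
      rw [B, hu2, hu3, hv2, hv3] at this
      linear_combination this
    obtain ⟨w, hw⟩ := hsurj (u 1)
    obtain ⟨d, hd'⟩ := hsurj (v 0)
    rw [frobenius_def] at hw hd'
    have e1 : lnVec₁ (w, d, u 0 - w * d) = u := funext fun i => by
      fin_cases i <;> simp [lnVec₁, hw, hu2, hu3]
    have e2 : lnVec₂ (w, d, u 0 - w * d) = v := funext fun i => by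
      fin_cases i <;> simp [lnVec₂, hd', hv2, hv3, huv]
    refine ⟨(w, d, u 0 - w * d), Subtype.ext ?_⟩
    change span k {lnVec₁ _, lnVec₂ _} = l
    rw [e1, e2]
    refine le_antisymm (span_le.2 (by rintro _ (rfl | rfl) <;> assumption)) fun x hx => ?_
    rw [mem_span_pair]
    refine ⟨x 2, x 3, (sub_eq_zero.1 (hzero _ (l.sub_mem hx (l.add_mem (l.smul_mem (x 2) hu)
      (l.smul_mem (x 3) hv))) ?_ ?_)).symm⟩
    · simp [hu2, hv2]
    · simp [hu3, hv3]

lemma ptMap_le_lnMap {t : ℕ} (hK : Fintype.card k = 2 ^ t) (p l : k × k × k) :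
    ((ptMap p).1 : Submodule k (Fin 4 → k)) ≤ (lnMap l).1 ↔
      l.2.1 = p.2.2 + p.1 * l.1 ∧ l.2.2 = p.2.1 + l.1 * p.2.2 := by
  have hc := charP_two hK
  have he : ExpChar k 2 := ExpChar.prime Nat.prime_two
  have h2 : (2 : k) = 0 := CharTwo.two_eq_zero
  change span k {ptVec p} ≤ span k {lnVec₁ l, lnVec₂ l} ↔ _
  rw [span_singleton_le_iff_mem, mem_span_lnVec]
  obtain ⟨a, b, d⟩ := p
  obtain ⟨w, e, D⟩ := l
  simp only [ptVec, Matrix.cons_val, one_mul]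
  constructor
  · rintro ⟨h0, h1⟩
    obtain rfl : e = d + a * w := by
      refine frobenius_inj k 2 ?_
      rw [frobenius_def, frobenius_def]
      linear_combination -h0 + a * h1 + (-a * d * w) * h2
    exact ⟨rfl, by linear_combination -h1 - (w * d + a * w ^ 2) * h2⟩
  · rintro ⟨rfl, rfl⟩
    constructor
    · linear_combination (-a * w * d * 2 - a ^ 2 * w ^ 2) * h2
    · linear_combination (-a * w ^ 2 - w * d) * h2

end Coordinates

lemma rank_MP1L1_eq {t : ℕ} (hK : Fintype.card k = 2 ^ t) :
    (MP1L1 k).rank = finrank k (LinearMap.range (lineSum (K := k))) := by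
  have hc := charP_two hK
  rw [← rank_coordMatrix (ZMod.castHom dvd_rfl k), ← Matrix.rank_submatrix (MP1L1 k)
    (Equiv.ofBijective _ (ptMap_bijective hK)) (Equiv.ofBijective _ (lnMap_bijective hK))]
  congr 1
  ext p l
  rw [Matrix.submatrix_apply, MP1L1, coordMatrix]
  exact if_congr (ptMap_le_lnMap hK p l) rfl rfl

end SymplecticRank
theorem rank_MP1L1 (t : ℕ) (ht : 0 < t) (q : ℕ) (hq : q = 2 ^ t)
    (hcard : Fintype.card k = q) :
    ((MP1L1 k).rank : ℝ) =
      1 + ((1 + Real.sqrt 17) / 2) ^ (2 * t) + ((1 - Real.sqrt 17) / 2) ^ (2 * t)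
        - 2 ^ (t + 1) := by
  have hK : Fintype.card k = 2 ^ t := hcard.trans hq
  have h := SymplecticRank.finrank_range_lineSum ht hK
  rw [← SymplecticRank.rank_MP1L1_eq k hK] at h
  have h' := congrArg (Nat.cast : ℕ → ℝ) h
  have htr := SymplecticRank.closedCnt_trace t
  push_cast at h' htr
  linarith
end
end

section
/- Let q = 2^t for a positive integer t. Then dim_{F_2} C(P,L) = dim_{F_2} C(P1,L1) + 2q. -/
open Submodule Module
open scoped Classical

noncomputable section

variable (k : Type) [Field k] [Fintype k]

/-- The characteristic function of a line, as an `F_2`-valued function on `P`. -/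
def chi (l : Submodule k (Fin 4 → k)) : Pt k → ZMod 2 :=
  fun p => if (p : Submodule k (Fin 4 → k)) ≤ l then 1 else 0

/-- The code `C(P,L)`. -/
def CPL : Submodule (ZMod 2) (Pt k → ZMod 2) := span (ZMod 2) (chi k '' {l | IsLn k l})

/-- The code `C(P,L1)`. -/
def CPL1 : Submodule (ZMod 2) (Pt k → ZMod 2) := span (ZMod 2) (chi k '' L1 k)

/-- Restriction of functions on `P` to `P1`. -/
def piP1 : (Pt k → ZMod 2) →ₗ[ZMod 2] ({p : Pt k // InP1 k p} → ZMod 2) :=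
  LinearMap.funLeft (ZMod 2) (ZMod 2) Subtype.val

/-- The code `C(P1,L1)`, the image of `C(P,L1)` under restriction to `P1`. -/
def CP1L1 : Submodule (ZMod 2) ({p : Pt k // InP1 k p} → ZMod 2) := (CPL1 k).map (piP1 k)

/-- `X0`: the characteristic functions of the lines through `p0`, except `χ_{ℓ0}`. -/
def X0 : Set (Pt k → ZMod 2) :=
  (chi k '' {l | IsLn k l ∧ p0 k ≤ l}) \ {chi k (l0 k)}

section

set_option linter.unusedSectionVars false

variable {k}

theorem finrank_eq_two_of_coords {l : Submodule k (Fin 4 → k)} (i j : Fin 4) {w u : Fin 4 → k}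
    (hw : w ∈ l) (hu : u ∈ l) (hwi : w i = 1) (hwj : w j = 0) (hui : u i = 0) (huj : u j = 1)
    (h : ∀ v ∈ l, v = v i • w + v j • u) : finrank k l = 2 := by
  have hl : l = span k (Set.range ![w, u]) := by
    apply le_antisymm
    · intro v hv
      rw [h v hv]
      exact add_mem (smul_mem _ _ (subset_span ⟨0, rfl⟩)) (smul_mem _ _ (subset_span ⟨1, rfl⟩))
    · rw [span_le]
      rintro _ ⟨a, rfl⟩
      fin_cases a
      · exact hw
      · exact hu
  have hli : LinearIndependent k ![w, u] := by
    rw [LinearIndependent.pair_iff]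
    intro a b hab
    have h1 := congrFun hab i
    have h2 := congrFun hab j
    simp [hwi, hwj, hui, huj] at h1 h2
    exact ⟨h1, h2⟩
  rw [hl, finrank_span_eq_card hli]
  simp

theorem eq_of_pair_mem {l m : Submodule k (Fin 4 → k)} (hl : finrank k l = 2)
    (hm : finrank k m = 2) {w u : Fin 4 → k} (hli : LinearIndependent k ![w, u])
    (hwl : w ∈ l) (hul : u ∈ l) (hwm : w ∈ m) (hum : u ∈ m) : l = m := by
  have key : ∀ n : Submodule k (Fin 4 → k), finrank k n = 2 → w ∈ n → u ∈ n →
      span k (Set.range ![w, u]) = n := by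
    intro n hn hw hu
    apply eq_of_le_of_finrank_eq
    · rw [span_le]
      rintro _ ⟨a, rfl⟩
      fin_cases a
      · exact hw
      · exact hu
    · rw [finrank_span_eq_card hli, hn]
      simp
  rw [← key l hl hwl hul, key m hm hwm hum]

/-- The point spanned by a nonzero vector. -/
def pt (v : Fin 4 → k) (hv : v ≠ 0) : Pt k := ⟨span k {v}, finrank_span_singleton hv⟩

theorem exists_eq_pt (p : Pt k) : ∃ v hv, p = pt v hv := by
  obtain ⟨p, hp⟩ := p
  obtain ⟨v, hv, h⟩ := finrank_eq_one_iff'.1 hp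
  refine ⟨v, by simpa using hv, Subtype.ext ?_⟩
  apply le_antisymm
  · intro w hw
    obtain ⟨c, hc⟩ := h ⟨w, hw⟩
    exact mem_span_singleton.2 ⟨c, congrArg Subtype.val hc⟩
  · simp [pt, span_le]

theorem chi_pt (l : Submodule k (Fin 4 → k)) (v : Fin 4 → k) (hv : v ≠ 0) :
    chi k l (pt v hv) = if v ∈ l then 1 else 0 := by
  simp [chi, pt, span_le]

theorem pt_smul {v w : Fin 4 → k} (hv : v ≠ 0) (hw : w ≠ 0) (c : k) (h : w = c • v) :
    pt w hw = pt v hv := by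
  apply Subtype.ext
  have hc : c ≠ 0 := by rintro rfl; simp at h; exact hw h
  simp only [pt, h]
  exact span_singleton_smul_eq (IsUnit.mk0 c hc) v

theorem mem_l0 (v : Fin 4 → k) : v ∈ l0 k ↔ v 2 = 0 ∧ v 3 = 0 := by
  rw [l0, mem_span_pair]
  constructor
  · rintro ⟨a, b, rfl⟩
    simp [e]
  · rintro ⟨h2, h3⟩
    refine ⟨v 0, v 1, ?_⟩
    ext i
    fin_cases i <;> simp [e, h2, h3]

def lineA (t : k) : Submodule k (Fin 4 → k) where
  carrier := {v | v 0 = t * v 2 ∧ v 1 = t * v 3}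
  add_mem' := by rintro a b ⟨h, h'⟩ ⟨h'', h'''⟩; simp; grind
  zero_mem' := by simp
  smul_mem' := by rintro c a ⟨h, h'⟩; simp; grind

theorem mem_lineA (t : k) (v : Fin 4 → k) : v ∈ lineA t ↔ v 0 = t * v 2 ∧ v 1 = t * v 3 := Iff.rfl

theorem finrank_lineA (t : k) : finrank k (lineA t) = 2 := by
  apply finrank_eq_two_of_coords 2 3 (w := ![t, 0, 1, 0]) (u := ![0, t, 0, 1])
  · simp [mem_lineA]
  · simp [mem_lineA]
  · simp
  · simp
  · simp
  · simp
  · rintro v ⟨h, h'⟩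
    ext i
    fin_cases i <;> simp [h, h', mul_comm]


def lineC (s : k) : Submodule k (Fin 4 → k) where
  carrier := {v | v 0 = s * v 1 ∧ v 2 = s * v 3}
  add_mem' := by rintro a b ⟨h, h'⟩ ⟨h'', h'''⟩; simp; grind
  zero_mem' := by simp
  smul_mem' := by rintro c a ⟨h, h'⟩; simp; grind

theorem mem_lineC (s : k) (v : Fin 4 → k) : v ∈ lineC s ↔ v 0 = s * v 1 ∧ v 2 = s * v 3 := Iff.rfl

theorem finrank_lineC (s : k) : finrank k (lineC s) = 2 := by
  apply finrank_eq_two_of_coords 1 3 (w := ![s, 1, 0, 0]) (u := ![0, 0, s, 1])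
  · simp [mem_lineC]
  · simp [mem_lineC]
  · simp
  · simp
  · simp
  · simp
  · rintro v ⟨h, h'⟩
    ext i
    fin_cases i <;> simp [h, h', mul_comm]

/-- The isotropic lines through `p0` other than `l0`. -/
def lineM (a : k) : Submodule k (Fin 4 → k) where
  carrier := {v | v 3 = 0 ∧ v 1 = a * v 2}
  add_mem' := by rintro a b ⟨h, h'⟩ ⟨h'', h'''⟩; simp; grind
  zero_mem' := by simp
  smul_mem' := by rintro c a ⟨h, h'⟩; simp; grind

theorem mem_lineM (a : k) (v : Fin 4 → k) : v ∈ lineM a ↔ v 3 = 0 ∧ v 1 = a * v 2 := Iff.rfl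

theorem finrank_lineM (a : k) : finrank k (lineM a) = 2 := by
  apply finrank_eq_two_of_coords 0 2 (w := ![1, 0, 0, 0]) (u := ![0, a, 1, 0])
  · simp [mem_lineM]
  · simp [mem_lineM]
  · simp
  · simp
  · simp
  · simp
  · rintro v ⟨h, h'⟩
    ext i
    fin_cases i <;> simp [h, h', mul_comm]

theorem finrank_l0 : finrank k (l0 k) = 2 := by
  apply finrank_eq_two_of_coords 0 1 (w := ![1, 0, 0, 0]) (u := ![0, 1, 0, 0])
  · simp [mem_l0]
  · simp [mem_l0]
  · simp
  · simp
  · simp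
  · simp
  · intro v hv
    obtain ⟨h, h'⟩ := (mem_l0 v).1 hv
    ext i
    fin_cases i <;> simp [h, h']

theorem isLn_l0 : IsLn k (l0 k) := by
  refine ⟨finrank_l0, fun u hu v hv => ?_⟩
  rw [mem_l0] at hu hv
  simp [B, hu, hv]

theorem isLn_lineM (a : k) : IsLn k (lineM a) := by
  refine ⟨finrank_lineM a, fun u hu v hv => ?_⟩
  rw [mem_lineM] at hu hv
  simp only [B, hu, hv]
  ring

theorem isLn_lineA (t : k) : IsLn k (lineA t) := by
  refine ⟨finrank_lineA t, fun u hu v hv => ?_⟩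
  rw [mem_lineA] at hu hv
  simp only [B, hu, hv]
  ring

theorem isLn_lineC (h2 : (2 : k) = 0) (s : k) : IsLn k (lineC s) := by
  refine ⟨finrank_lineC s, fun u hu v hv => ?_⟩
  rw [mem_lineC] at hu hv
  simp only [B, hu, hv]
  linear_combination (s * u 1 * v 3 - s * u 3 * v 1) * h2

/-- A transvection-type change of coordinates, which preserves `B` in characteristic two. -/
def shear (s c : k) : (Fin 4 → k) ≃ₗ[k] (Fin 4 → k) where
  toFun v := ![v 0 + s * v 1, v 1, v 2 + s * v 3, v 3 + c * (v 0 + s * v 1)]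
  invFun w := ![w 0 - s * w 1, w 1, w 2 - s * (w 3 - c * w 0), w 3 - c * w 0]
  map_add' u v := by ext i; fin_cases i <;> simp <;> ring
  map_smul' a v := by ext i; fin_cases i <;> simp <;> ring
  left_inv v := by ext i; fin_cases i <;> simp
  right_inv v := by ext i; fin_cases i <;> simp

theorem shear_apply (s c : k) (v : Fin 4 → k) : shear s c v =
    ![v 0 + s * v 1, v 1, v 2 + s * v 3, v 3 + c * (v 0 + s * v 1)] := rfl

theorem B_shear (h2 : (2 : k) = 0) (s c : k) (u v : Fin 4 → k) :
    B k (shear s c u) (shear s c v) = B k u v := by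
  simp [B, shear_apply]
  linear_combination (s * u 1 * v 3 - s * u 3 * v 1) * h2

theorem isLn_comap_shear (h2 : (2 : k) = 0) (s c : k) {l : Submodule k (Fin 4 → k)}
    (hl : IsLn k l) : IsLn k (l.comap (shear s c : (Fin 4 → k) →ₗ[k] (Fin 4 → k))) := by
  refine ⟨?_, fun u hu v hv => ?_⟩
  · rw [comap_equiv_eq_map_symm, LinearEquiv.finrank_map_eq, hl.1]
  · rw [← B_shear h2 s c]
    exact hl.2 _ hu _ hv

theorem sum_ruling (a b c d : k) (h : ¬ (a = 0 ∧ b = 0 ∧ c = 0 ∧ d = 0)) :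
    (if c = 0 ∧ d = 0 then (1 : ZMod 2) else 0) + ∑ t : k, (if a = t * c ∧ b = t * d then 1 else 0)
      = if a * d = b * c then 1 else 0 := by
  by_cases hc : c = 0 ∧ d = 0
  · obtain ⟨rfl, rfl⟩ := hc
    have : ¬ (a = 0 ∧ b = 0) := by tauto
    simp [this]
  rw [if_neg hc, zero_add]
  split_ifs with hq
  · obtain ⟨t, ht⟩ : ∃ t, ∀ x, (a = x * c ∧ b = x * d) ↔ x = t := by
      by_cases h0 : c = 0
      · have hd : d ≠ 0 := by tauto
        refine ⟨b / d, fun x => ?_⟩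
        rw [eq_div_iff hd]
        subst h0
        have : a = 0 := by simpa [hd] using hq
        simp [this, eq_comm]
      · refine ⟨a / c, fun x => ?_⟩
        rw [eq_div_iff h0]
        constructor
        · rintro ⟨h1, -⟩; exact h1.symm
        · intro h1
          refine ⟨h1.symm, mul_right_cancel₀ h0 ?_⟩
          rw [← hq, ← h1]; ring
    simp [ht]
  · apply Finset.sum_eq_zero
    intro t _
    rw [if_neg]
    rintro ⟨rfl, rfl⟩
    exact hq (by ring)

/-- The two rulings of a hyperbolic quadric have the same sum. -/
theorem sum_chi_ruling (T : (Fin 4 → k) ≃ₗ[k] (Fin 4 → k)) :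
    chi k ((l0 k).comap (T : (Fin 4 → k) →ₗ[k] _)) +
        ∑ t, chi k ((lineA t).comap (T : (Fin 4 → k) →ₗ[k] _)) =
      chi k ((lineM 0).comap (T : (Fin 4 → k) →ₗ[k] _)) +
        ∑ s, chi k ((lineC s).comap (T : (Fin 4 → k) →ₗ[k] _)) := by
  funext p
  obtain ⟨v, hv, rfl⟩ := exists_eq_pt p
  have hT : T v ≠ 0 := by simpa using hv
  have h0 : ¬ (T v 0 = 0 ∧ T v 1 = 0 ∧ T v 2 = 0 ∧ T v 3 = 0) := by
    rintro ⟨h0, h1, h2, h3⟩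
    exact hT (by ext i; fin_cases i <;> assumption)
  have e1 := sum_ruling (T v 0) (T v 1) (T v 2) (T v 3) h0
  have e2 := sum_ruling (T v 0) (T v 2) (T v 1) (T v 3) (by tauto)
  simp only [Pi.add_apply, Finset.sum_apply, chi_pt, mem_comap, LinearEquiv.coe_coe, mem_l0,
    mem_lineA, mem_lineC, mem_lineM, zero_mul]
  simp only [and_comm (a := T v 3 = 0)]
  rw [e1, e2, mul_comm (T v 1)]

theorem mem_L1 {l : Submodule k (Fin 4 → k)} (hl : IsLn k l)
    (h : ∀ v ∈ l, v 2 = 0 → v 3 = 0 → v 0 = 0 ∧ v 1 = 0) : l ∈ L1 k := by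
  refine ⟨hl, (Submodule.eq_bot_iff _).2 ?_⟩
  rintro v ⟨hv, hv'⟩
  obtain ⟨h2, h3⟩ := (mem_l0 v).1 hv'
  obtain ⟨h0, h1⟩ := h v hv h2 h3
  ext i
  fin_cases i <;> assumption

theorem chi_mem_CPL1 {l : Submodule k (Fin 4 → k)} (hl : l ∈ L1 k) : chi k l ∈ CPL1 k :=
  subset_span ⟨l, hl, rfl⟩

theorem chi_mem_CPL {l : Submodule k (Fin 4 → k)} (hl : IsLn k l) : chi k l ∈ CPL k :=
  subset_span ⟨l, hl, rfl⟩

theorem lineA_mem_L1 (t : k) : lineA t ∈ L1 k := by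
  apply mem_L1 (isLn_lineA t)
  rintro v ⟨h, h'⟩ h2 h3
  simp [h, h', h2, h3]

theorem chi_comap_shear_sub_mem (h2 : (2 : k) = 0) (s c : k) (hc : c ≠ 0) :
    chi k ((l0 k).comap (shear s c : (Fin 4 → k) →ₗ[k] _)) - chi k (lineC s) ∈ CPL1 k := by
  have hs : (lineC 0).comap (shear s c : (Fin 4 → k) →ₗ[k] (Fin 4 → k)) = lineC s := by
    ext v
    simp [mem_lineC, shear_apply]
    constructor
    · rintro ⟨h, h'⟩
      exact ⟨by linear_combination h - s * v 1 * h2, by linear_combination h' - s * v 3 * h2⟩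
    · rintro ⟨h, h'⟩
      exact ⟨by linear_combination h + s * v 1 * h2, by linear_combination h' + s * v 3 * h2⟩
  have key := sum_chi_ruling (shear s c)
  rw [← Finset.add_sum_erase Finset.univ
    (fun x => chi k ((lineC x).comap (shear s c : (Fin 4 → k) →ₗ[k] _))) (Finset.mem_univ 0)] at key
  simp only [hs] at key
  have hM : (lineM 0).comap (shear s c : (Fin 4 → k) →ₗ[k] (Fin 4 → k)) ∈ L1 k := by
    apply mem_L1 (isLn_comap_shear h2 s c (isLn_lineM 0))
    intro v hv h2 h3
    simp [mem_lineM, shear_apply, h3, hc] at hv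
    obtain ⟨h, h'⟩ := hv
    simp [h'] at h
    exact ⟨h, h'⟩
  have hA : ∀ t, (lineA t).comap (shear s c : (Fin 4 → k) →ₗ[k] (Fin 4 → k)) ∈ L1 k := by
    intro t
    apply mem_L1 (isLn_comap_shear h2 s c (isLn_lineA t))
    intro v hv h2 h3
    simp [mem_lineA, shear_apply, h3, h2] at hv
    obtain ⟨h, h'⟩ := hv
    simp [h] at h'
    simp [h'] at h
    exact ⟨h, h'⟩
  have hC : ∀ t ≠ 0, (lineC t).comap (shear s c : (Fin 4 → k) →ₗ[k] (Fin 4 → k)) ∈ L1 k := by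
    intro t ht
    apply mem_L1 (isLn_comap_shear h2 s c (isLn_lineC h2 t))
    intro v hv h2 h3
    simp [mem_lineC, shear_apply, h3, h2, hc, ht] at hv
    obtain ⟨h, h'⟩ := hv
    simp [h', ht] at h
    simp [h] at h'
    exact ⟨h', h⟩
  have e : chi k ((l0 k).comap (shear s c : (Fin 4 → k) →ₗ[k] _)) - chi k (lineC s) =
      chi k ((lineM 0).comap (shear s c : (Fin 4 → k) →ₗ[k] _)) +
      ∑ x ∈ Finset.univ.erase 0, chi k ((lineC x).comap (shear s c : (Fin 4 → k) →ₗ[k] _)) -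
      ∑ t, chi k ((lineA t).comap (shear s c : (Fin 4 → k) →ₗ[k] _)) := by
    linear_combination (exp := 1) key
  rw [e]
  refine sub_mem (add_mem (chi_mem_CPL1 hM) (sum_mem fun x hx => chi_mem_CPL1 (hC x ?_)))
    (sum_mem fun t _ => chi_mem_CPL1 (hA t))
  exact (Finset.mem_erase.1 hx).1

/-- Combinations of the lines through `p0` other than `l0`. -/
def combM : (k → ZMod 2) →ₗ[ZMod 2] (Pt k → ZMod 2) :=
  Fintype.linearCombination (ZMod 2) (fun a => chi k (lineM a))

/-- Combinations of the lines `lineC s`, one through each point of `l0` other than `p0`. -/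
def combC : (k → ZMod 2) →ₗ[ZMod 2] (Pt k → ZMod 2) :=
  Fintype.linearCombination (ZMod 2) (fun s => chi k (lineC s))

theorem chi_lineM_mem (a : k) : chi k (lineM a) ∈ LinearMap.range (combM (k := k)) :=
  ⟨Pi.single a 1, by simp [combM]⟩

theorem chi_lineC_mem (a : k) : chi k (lineC a) ∈ LinearMap.range (combC (k := k)) :=
  ⟨Pi.single a 1, by simp [combC]⟩

theorem line_cases (h2 : (2 : k) = 0) {l : Submodule k (Fin 4 → k)} (hl : IsLn k l) :
    l ∈ L1 k ∨ l = l0 k ∨ (∃ a, l = lineM a) ∨ (∃ s, l = lineC s) ∨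
      ∃ s c : k, c ≠ 0 ∧ l = (l0 k).comap (shear s c : (Fin 4 → k) →ₗ[k] _) := by
  by_cases hL : l ⊓ l0 k = ⊥
  · exact Or.inl ⟨hl, hL⟩
  right
  by_cases hl0 : l = l0 k
  · exact Or.inl hl0
  right
  obtain ⟨w, ⟨hw, hw'⟩, hw0⟩ := exists_mem_ne_zero_of_ne_bot hL
  rw [SetLike.mem_coe, mem_l0] at hw'
  obtain ⟨u, hu, hu'⟩ : ∃ u ∈ l, u ∉ l0 k := by
    by_contra! h
    exact hl0 (eq_of_le_of_finrank_eq h (hl.1.trans finrank_l0.symm))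
  have hli : LinearIndependent k ![w, u] := by
    rw [LinearIndependent.pair_iff' hw0]
    rintro a rfl
    exact hu' ((mem_l0 _).2 (by simp [hw']))
  have hB := hl.2 w hw u hu
  simp only [B, hw'] at hB
  rw [mem_l0] at hu'
  by_cases h1 : w 1 = 0
  · have h0 : w 0 ≠ 0 := by
      intro h0
      exact hw0 (by ext i; fin_cases i <;> simp [*])
    have h3 : u 3 = 0 := by simpa [h1, h0] using hB
    have hu2 : u 2 ≠ 0 := by tauto
    refine Or.inl ⟨u 1 / u 2, eq_of_pair_mem hl.1 (finrank_lineM _) hli hw hu ?_ ?_⟩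
    · simp [mem_lineM, hw', h1]
    · simp [mem_lineM, h3, hu2]
  right
  have hs : w 0 = (w 0 / w 1) * w 1 := by field_simp
  generalize w 0 / w 1 = s at hs
  have hu2 : u 2 = s * u 3 := by
    apply mul_left_cancel₀ h1
    linear_combination hB - u 3 * hs - s * w 1 * u 3 * h2
  have hu3 : u 3 ≠ 0 := by
    intro h; exact hu' ⟨by simp [hu2, h], h⟩
  by_cases ha : u 0 = s * u 1
  · exact Or.inl ⟨s, eq_of_pair_mem hl.1 (finrank_lineC _) hli hw hu
      ⟨hs, by simp [hw']⟩ ⟨ha, hu2⟩⟩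
  · right
    have ha' : u 0 + s * u 1 ≠ 0 := by
      intro h; exact ha (by linear_combination h - s * u 1 * h2)
    refine ⟨s, u 3 / (u 0 + s * u 1), div_ne_zero hu3 ha',
      eq_of_pair_mem hl.1 (isLn_comap_shear h2 _ _ isLn_l0).1 hli hw hu ?_ ?_⟩
    · have : w 0 + s * w 1 = 0 := by linear_combination hs + s * w 1 * h2
      simp [mem_l0, shear_apply, hw', this]
    · simp [mem_l0, shear_apply, div_mul_cancel₀ _ ha']
      exact ⟨by linear_combination hu2 + s * u 3 * h2, by linear_combination u 3 * h2⟩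

theorem CPL_le (h2 : (2 : k) = 0) :
    CPL k ≤ CPL1 k ⊔ LinearMap.range combM ⊔ LinearMap.range combC := by
  have hM : ∀ a : k, chi k (lineM a) ∈ CPL1 k ⊔ LinearMap.range combM ⊔ LinearMap.range combC :=
    fun a => mem_sup_left (mem_sup_right (chi_lineM_mem a))
  have hC : ∀ s : k, chi k (lineC s) ∈ CPL1 k ⊔ LinearMap.range combM ⊔ LinearMap.range combC :=
    fun s => mem_sup_right (chi_lineC_mem s)
  have h1 : ∀ f ∈ CPL1 k, f ∈ CPL1 k ⊔ LinearMap.range combM ⊔ LinearMap.range combC :=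
    fun f hf => mem_sup_left (mem_sup_left hf)
  rw [CPL, span_le]
  rintro _ ⟨l, hl, rfl⟩
  rcases line_cases h2 hl with h | rfl | ⟨a, rfl⟩ | ⟨s, rfl⟩ | ⟨s, c, hc, rfl⟩
  · exact h1 _ (chi_mem_CPL1 h)
  · have key := sum_chi_ruling (LinearEquiv.refl k (Fin 4 → k))
    simp only [LinearEquiv.refl_toLinearMap, comap_id] at key
    rw [SetLike.mem_coe, eq_sub_of_add_eq key]
    exact sub_mem (add_mem (hM 0) (sum_mem fun s _ => hC s))
      (sum_mem fun t _ => h1 _ (chi_mem_CPL1 (lineA_mem_L1 t)))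
  · exact hM a
  · exact hC s
  · have := add_mem (h1 _ (chi_comap_shear_sub_mem h2 s c hc)) (hC s)
    rwa [sub_add_cancel] at this

/-- `B` as a bundled bilinear form. -/
def bilin : LinearMap.BilinForm k (Fin 4 → k) :=
  LinearMap.mk₂ k (B k) (by intros; simp [B]; ring) (by intros; simp [B]; ring)
    (by intros; simp [B]; ring) (by intros; simp [B]; ring)

theorem bilin_apply (u v : Fin 4 → k) : bilin u v = B k u v := rfl

theorem B_swap (u v : Fin 4 → k) : B k u v = - B k v u := by
  simp only [B]; ring

theorem bilin_nondegenerate : (bilin (k := k)).Nondegenerate := by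
  have key : ∀ m : Fin 4 → k, (∀ n, bilin m n = 0) → m = 0 := by
    intro m h
    have h0 := h ![1, 0, 0, 0]
    have h1 := h ![0, 1, 0, 0]
    have h2 := h ![0, 0, 1, 0]
    have h3 := h ![0, 0, 0, 1]
    simp [bilin_apply, B] at h0 h1 h2 h3
    ext i
    fin_cases i <;> simp [h0, h1, h2, h3]
  refine ⟨key, fun m h => key m fun n => ?_⟩
  rw [bilin_apply, B_swap, ← bilin_apply, h n, neg_zero]

theorem orthogonal_eq_self {l : Submodule k (Fin 4 → k)} (hl : IsLn k l) :
    bilin.orthogonal l = l := by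
  symm
  apply eq_of_le_of_finrank_eq
  · intro v hv
    rw [LinearMap.BilinForm.mem_orthogonal_iff]
    exact fun u hu => hl.2 u hu v hv
  · rw [LinearMap.BilinForm.finrank_orthogonal bilin_nondegenerate, hl.1]
    simp

theorem finrank_inf_orthogonal {l h : Submodule k (Fin 4 → k)} (hl : IsLn k l)
    (hh : finrank k h = 2) :
    finrank k (l ⊓ bilin.orthogonal h : Submodule k (Fin 4 → k)) =
      finrank k (l ⊓ h : Submodule k (Fin 4 → k)) := by
  have e : l ⊓ bilin.orthogonal h = bilin.orthogonal (l ⊔ h) := by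
    conv_lhs => rw [← orthogonal_eq_self hl]
    apply le_antisymm
    · rintro v ⟨hv, hv'⟩
      rw [LinearMap.BilinForm.mem_orthogonal_iff]
      intro n hn
      obtain ⟨a, ha, b, hb, rfl⟩ := mem_sup.1 hn
      rw [map_add, LinearMap.add_apply]
      rw [SetLike.mem_coe, LinearMap.BilinForm.mem_orthogonal_iff] at hv hv'
      rw [hv a ha, hv' b hb, add_zero]
    · exact le_inf (LinearMap.BilinForm.orthogonal_le le_sup_left)
        (LinearMap.BilinForm.orthogonal_le le_sup_right)
  have h1 := finrank_sup_add_finrank_inf_eq l h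
  rw [e, LinearMap.BilinForm.finrank_orthogonal bilin_nondegenerate]
  rw [hl.1, hh] at h1
  have h2 : finrank k (Fin 4 → k) = 4 := by simp
  omega

theorem sum_chi_mul_chi (l h : Submodule k (Fin 4 → k)) :
    ∑ p, chi k l p * chi k h p = ∑ p, chi k (l ⊓ h) p := by
  refine Finset.sum_congr rfl fun p _ => ?_
  simp only [chi, le_inf_iff, ite_and]
  split_ifs <;> simp

theorem sum_chi_of_finrank_eq_one {l : Submodule k (Fin 4 → k)} (hl : finrank k l = 1) :
    ∑ p, chi k l p = 1 := by
  rw [Finset.sum_eq_single_of_mem (⟨l, hl⟩ : Pt k) (Finset.mem_univ _)]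
  · simp [chi]
  · rintro ⟨p, hp⟩ - hne
    rw [chi, if_neg]
    exact fun hle => hne (Subtype.ext (eq_of_le_of_finrank_eq hle (hp.trans hl.symm)))

/-- Words of `C(P,L)` take equal sums on a plane and on its polar plane. -/
theorem sum_mul_chi_orthogonal {f : Pt k → ZMod 2} (hf : f ∈ CPL k)
    {h : Submodule k (Fin 4 → k)} (hh : finrank k h = 2) :
    ∑ p, f p * chi k h p = ∑ p, f p * chi k (bilin.orthogonal h) p := by
  induction hf using span_induction with
  | mem f hf =>
    obtain ⟨l, hl, rfl⟩ := hf
    rw [sum_chi_mul_chi, sum_chi_mul_chi]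
    have e := finrank_inf_orthogonal hl hh
    have hle : finrank k (l ⊓ h : Submodule k (Fin 4 → k)) ≤ 2 :=
      (finrank_mono inf_le_left).trans hl.1.le
    obtain h0 | h1 | h2 : finrank k (l ⊓ h : Submodule k (Fin 4 → k)) = 0 ∨
      finrank k (l ⊓ h : Submodule k (Fin 4 → k)) = 1 ∨
      finrank k (l ⊓ h : Submodule k (Fin 4 → k)) = 2 := by omega
    · rw [h0] at e
      rw [finrank_eq_zero] at e h0
      rw [e, h0]
    · rw [sum_chi_of_finrank_eq_one h1, sum_chi_of_finrank_eq_one (e.trans h1)]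
    · rw [eq_of_le_of_finrank_eq inf_le_left (h2.trans hl.1.symm),
        eq_of_le_of_finrank_eq inf_le_left ((e.trans h2).trans hl.1.symm)]
  | zero => simp
  | add f g _ _ hf hg => simp only [Pi.add_apply, add_mul, Finset.sum_add_distrib, hf, hg]
  | smul a f _ hf => simp only [Pi.smul_apply, smul_eq_mul, mul_assoc, ← Finset.mul_sum, hf]

/-- The point of `l0` with affine coordinate `s`. -/
def ptL (s : k) : Pt k := pt ![s, 1, 0, 0] (fun h => by simpa using congrFun h 1)

/-- The point of `lineM a` with affine coordinate `b`. -/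
def ptM (a b : k) : Pt k := pt ![b, a, 1, 0] (fun h => by simpa using congrFun h 2)

/-- `p0` as a point. -/
def pt0 : Pt k := pt ![1, 0, 0, 0] (fun h => by simpa using congrFun h 0)

theorem pt_cases (p : Pt k) :
    (∃ v hv, p = pt v hv ∧ v 3 ≠ 0) ∨ (∃ a b, p = ptM a b) ∨ (∃ s, p = ptL s) ∨ p = pt0 := by
  obtain ⟨v, hv, rfl⟩ := exists_eq_pt p
  by_cases h3 : v 3 = 0
  swap
  · exact Or.inl ⟨v, hv, rfl, h3⟩
  right
  by_cases h2 : v 2 = 0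
  swap
  · refine Or.inl ⟨v 1 / v 2, v 0 / v 2, pt_smul _ _ (v 2) ?_⟩
    ext i
    fin_cases i <;> simp [mul_div_cancel₀, h3, h2]
  right
  by_cases h1 : v 1 = 0
  swap
  · refine Or.inl ⟨v 0 / v 1, pt_smul _ _ (v 1) ?_⟩
    ext i
    fin_cases i <;> simp [mul_div_cancel₀, h3, h2, h1]
  right
  refine pt_smul _ _ (v 0) ?_
  ext i
  fin_cases i <;> simp [h3, h2, h1]

theorem inP1_pt (v : Fin 4 → k) (hv : v ≠ 0) : InP1 k (pt v hv) ↔ v 3 ≠ 0 := by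
  constructor
  · rintro ⟨w, hw, h⟩ h3
    obtain ⟨c, rfl⟩ := mem_span_singleton.1 hw
    simp [B, e, h3] at h
  · intro h
    exact ⟨v, mem_span_singleton_self v, by simpa [B, e] using h⟩

/-- The plane spanned by `(b, a, 1, 0)` and `(0, c, 0, 1)`. -/
def plane (a b c : k) : Submodule k (Fin 4 → k) where
  carrier := {v | v 0 = b * v 2 ∧ v 1 = a * v 2 + c * v 3}
  add_mem' := by rintro a b ⟨h, h'⟩ ⟨h'', h'''⟩; simp; grind
  zero_mem' := by simp
  smul_mem' := by rintro c a ⟨h, h'⟩; simp; grind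

theorem mem_plane (a b c : k) (v : Fin 4 → k) :
    v ∈ plane a b c ↔ v 0 = b * v 2 ∧ v 1 = a * v 2 + c * v 3 := Iff.rfl

theorem finrank_plane (a b c : k) : finrank k (plane a b c) = 2 := by
  apply finrank_eq_two_of_coords 2 3 (w := ![b, a, 1, 0]) (u := ![0, c, 0, 1])
  · simp [mem_plane]
  · simp [mem_plane]
  · simp
  · simp
  · simp
  · simp
  · rintro v ⟨h, h'⟩
    ext i
    fin_cases i <;> simp [h, h', mul_comm]

theorem orthogonal_plane (a b c : k) : bilin.orthogonal (plane a b c) = plane a c b := by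
  symm
  apply eq_of_le_of_finrank_eq
  · intro v hv
    rw [LinearMap.BilinForm.mem_orthogonal_iff]
    intro u hu
    rw [mem_plane] at hu hv
    rw [bilin_apply]
    simp only [B, hu, hv]
    ring
  · rw [LinearMap.BilinForm.finrank_orthogonal bilin_nondegenerate, finrank_plane, finrank_plane]
    simp

theorem sum_mul_chi_plane {f : Pt k → ZMod 2} (hf : ∀ v hv, v 3 ≠ 0 → f (pt v hv) = 0)
    (a b c : k) : ∑ p, f p * chi k (plane a b c) p = f (ptM a b) := by
  rw [Finset.sum_eq_single_of_mem (ptM a b) (Finset.mem_univ _)]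
  · simp [ptM, chi_pt, mem_plane]
  · intro p _ hp
    rcases pt_cases p with ⟨v, hv, rfl, h⟩ | ⟨a', b', rfl⟩ | ⟨s, rfl⟩ | rfl
    · rw [hf v hv h, zero_mul]
    · rw [ptM, chi_pt, if_neg, mul_zero]
      intro h
      simp [mem_plane] at h
      exact hp (by rw [h.1, h.2])
    · rw [ptL, chi_pt, if_neg, mul_zero]
      simp [mem_plane]
    · rw [pt0, chi_pt, if_neg, mul_zero]
      simp [mem_plane]

theorem apply_ptM_eq {f : Pt k → ZMod 2} (hC : f ∈ CPL k)
    (hf : ∀ v hv, v 3 ≠ 0 → f (pt v hv) = 0) (a b c : k) : f (ptM a b) = f (ptM a c) := by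
  rw [← sum_mul_chi_plane hf a b c, sum_mul_chi_orthogonal hC (finrank_plane a b c),
    orthogonal_plane, sum_mul_chi_plane hf]

/-- A hyperbolic plane through `p0`. -/
def plane0 : Submodule k (Fin 4 → k) where
  carrier := {v | v 1 = 0 ∧ v 2 = 0}
  add_mem' := by rintro a b ⟨h, h'⟩ ⟨h'', h'''⟩; simp; grind
  zero_mem' := by simp
  smul_mem' := by rintro c a ⟨h, h'⟩; simp; grind

theorem mem_plane0 (v : Fin 4 → k) : v ∈ plane0 ↔ v 1 = 0 ∧ v 2 = 0 := Iff.rfl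

theorem finrank_plane0 : finrank k (plane0 (k := k)) = 2 := by
  apply finrank_eq_two_of_coords 0 3 (w := ![1, 0, 0, 0]) (u := ![0, 0, 0, 1])
  · simp [mem_plane0]
  · simp [mem_plane0]
  · simp
  · simp
  · simp
  · simp
  · rintro v ⟨h, h'⟩
    ext i
    fin_cases i <;> simp [h, h']

theorem eq_zero_of_support {f : Pt k → ZMod 2} (hC : f ∈ CPL k) (hf : ∀ p ≠ pt0, f p = 0) :
    f = 0 := by
  have key := sum_mul_chi_orthogonal hC (finrank_plane0 (k := k))
  rw [Finset.sum_eq_single_of_mem pt0 (Finset.mem_univ _) (fun p _ hp => by simp [hf p hp]),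
    Finset.sum_eq_single_of_mem pt0 (Finset.mem_univ _) (fun p _ hp => by simp [hf p hp]),
    pt0, chi_pt, chi_pt, if_pos (by simp [mem_plane0]), if_neg, mul_one, mul_zero] at key
  · funext p
    by_cases hp : p = pt0
    · rw [hp]; exact key
    · exact hf p hp
  · rw [LinearMap.BilinForm.mem_orthogonal_iff]
    intro h
    simpa [bilin_apply, B] using h ![0, 0, 0, 1] (by simp [mem_plane0])

theorem combM_apply (c : k → ZMod 2) (p : Pt k) : combM c p = ∑ a, c a * chi k (lineM a) p := by
  simp [combM, Fintype.linearCombination_apply]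

theorem combM_ptM (c : k → ZMod 2) (a b : k) : combM c (ptM a b) = c a := by
  simp [combM_apply, ptM, chi_pt, mem_lineM]

theorem combM_ptL (c : k → ZMod 2) (s : k) : combM c (ptL s) = 0 := by
  simp [combM_apply, ptL, chi_pt, mem_lineM]

theorem combM_pt (c : k → ZMod 2) (v : Fin 4 → k) (hv : v ≠ 0) (h3 : v 3 ≠ 0) :
    combM c (pt v hv) = 0 := by
  simp [combM_apply, chi_pt, mem_lineM, h3]

theorem combC_ptL (d : k → ZMod 2) (s : k) : combC d (ptL s) = d s := by
  simp [combC, Fintype.linearCombination_apply, ptL, chi_pt, mem_lineC]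

theorem combM_mem (c : k → ZMod 2) : combM c ∈ CPL k := by
  rw [combM, Fintype.linearCombination_apply]
  exact sum_mem fun a _ => smul_mem _ _ (chi_mem_CPL (isLn_lineM a))

theorem combC_mem (h2 : (2 : k) = 0) (c : k → ZMod 2) : combC c ∈ CPL k := by
  rw [combC, Fintype.linearCombination_apply]
  exact sum_mem fun a _ => smul_mem _ _ (chi_mem_CPL (isLn_lineC h2 a))

theorem CPL1_le_CPL : CPL1 k ≤ CPL k :=
  span_mono (Set.image_mono fun _ h => h.1)

/-- Evaluation at the points of `l0` other than `p0`. -/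
def evalL : (Pt k → ZMod 2) →ₗ[ZMod 2] (k → ZMod 2) :=
  LinearMap.funLeft (ZMod 2) (ZMod 2) ptL

theorem evalL_CPL1 {f : Pt k → ZMod 2} (hf : f ∈ CPL1 k) : evalL f = 0 := by
  have : CPL1 k ≤ LinearMap.ker evalL := by
    rw [CPL1, span_le]
    rintro _ ⟨l, hl, rfl⟩
    rw [SetLike.mem_coe, LinearMap.mem_ker]
    funext s
    change chi k l (ptL s) = 0
    rw [ptL, chi_pt, if_neg]
    intro h
    have h' : ![s, 1, 0, 0] ∈ l ⊓ l0 k := ⟨h, (mem_l0 _).2 (by simp)⟩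
    rw [hl.2, mem_bot] at h'
    simpa using congrFun h' 1
  exact this hf

theorem mem_ker_piP1 (f : Pt k → ZMod 2) :
    f ∈ LinearMap.ker (piP1 k) ↔ ∀ v hv, v 3 ≠ 0 → f (pt v hv) = 0 := by
  rw [LinearMap.mem_ker]
  constructor
  · intro h v hv h3
    exact congrFun h ⟨pt v hv, (inP1_pt v hv).2 h3⟩
  · intro h
    funext ⟨p, hp⟩
    obtain ⟨v, hv, rfl⟩ := exists_eq_pt p
    exact h v hv ((inP1_pt v hv).1 hp)

theorem inf_ker_eq_range_combM :
    CPL k ⊓ LinearMap.ker evalL ⊓ LinearMap.ker (piP1 k) = LinearMap.range combM := by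
  apply le_antisymm
  · rintro f ⟨⟨hC, hL⟩, hf⟩
    rw [SetLike.mem_coe, mem_ker_piP1] at hf
    refine ⟨fun a => f (ptM a 0), ?_⟩
    rw [← sub_eq_zero]
    apply eq_zero_of_support (sub_mem (combM_mem _) hC)
    intro p hp
    rw [Pi.sub_apply, sub_eq_zero]
    rcases pt_cases p with ⟨v, hv, rfl, h⟩ | ⟨a, b, rfl⟩ | ⟨s, rfl⟩ | rfl
    · rw [hf v hv h, combM_pt _ _ _ h]
    · rw [combM_ptM, apply_ptM_eq hC hf]
    · rw [combM_ptL]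
      exact (congrFun hL s).symm
    · exact absurd rfl hp
  · rintro _ ⟨c, rfl⟩
    refine ⟨⟨combM_mem c, ?_⟩, ?_⟩
    · rw [SetLike.mem_coe, LinearMap.mem_ker]
      exact funext fun s => combM_ptL c s
    · rw [SetLike.mem_coe, mem_ker_piP1]
      exact fun v hv h => combM_pt c v hv h

theorem map_evalL (h2 : (2 : k) = 0) : (CPL k).map evalL = ⊤ :=
  eq_top_iff.2 fun d _ => ⟨combC d, combC_mem h2 d, funext fun s => combC_ptL d s⟩

theorem map_piP1 (h2 : (2 : k) = 0) :
    (CPL k ⊓ LinearMap.ker evalL).map (piP1 k) = CP1L1 k := by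
  apply le_antisymm
  · rintro _ ⟨f, ⟨hC, hL⟩, rfl⟩
    obtain ⟨_, hg', _, ⟨d, rfl⟩, rfl⟩ := mem_sup.1 (CPL_le h2 hC)
    obtain ⟨g, hg, _, ⟨c, rfl⟩, rfl⟩ := mem_sup.1 hg'
    have hd : d = 0 := by
      funext s
      have h := congrFun hL s
      rw [map_add, map_add, evalL_CPL1 hg] at h
      change 0 + combM c (ptL s) + combC d (ptL s) = 0 at h
      simpa [combM_ptL, combC_ptL] using h
    have hM : piP1 k (combM c) = 0 :=
      (mem_ker_piP1 _).2 fun v hv h => combM_pt c v hv h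
    rw [hd, map_zero, add_zero, map_add, hM, add_zero]
    exact mem_map_of_mem hg
  · exact map_mono (le_inf CPL1_le_CPL fun f hf => evalL_CPL1 hf)

theorem finrank_map_add_finrank_inf_ker {F V W : Type*} [Field F] [AddCommGroup V] [Module F V]
    [AddCommGroup W] [Module F W] [FiniteDimensional F V] (S : Submodule F V) (f : V →ₗ[F] W) :
    finrank F (S.map f) + finrank F (S ⊓ LinearMap.ker f : Submodule F V) = finrank F S := by
  rw [← LinearMap.finrank_range_add_finrank_ker (f.domRestrict S), LinearMap.range_domRestrict,
    LinearMap.ker_domRestrict, ← finrank_map_subtype_eq S, map_comap_subtype]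

end

theorem dim_CPL_eq_dim_CP1L1_add_2q (t : ℕ) (ht : 0 < t) (q : ℕ) (hq : q = 2 ^ t)
    (hcard : Fintype.card k = q) :
    finrank (ZMod 2) (CPL k) = finrank (ZMod 2) (CP1L1 k) + 2 * q := by
  have h2 : (2 : k) = 0 := by
    have h := FiniteField.cast_card_eq_zero k
    rw [hcard, hq, Nat.cast_pow, Nat.cast_ofNat] at h
    exact pow_eq_zero_iff ht.ne' |>.1 h
  have hM : finrank (ZMod 2) (LinearMap.range (combM (k := k))) = q := by
    rw [LinearMap.finrank_range_of_inj, finrank_fintype_fun_eq_card, hcard]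
    intro c c' h
    funext a
    rw [← combM_ptM c a 0, h, combM_ptM]
  have e1 := finrank_map_add_finrank_inf_ker (CPL k) evalL
  have e2 := finrank_map_add_finrank_inf_ker (CPL k ⊓ LinearMap.ker evalL) (piP1 k)
  rw [map_evalL h2, finrank_top, finrank_fintype_fun_eq_card, hcard] at e1
  rw [map_piP1 h2, inf_ker_eq_range_combM, hM] at e2
  omega
end
end
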